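/- Let k ≥ 1 and A ≥ 0 be integers with A > binom(2k,k)/(2k) − 1. Then there is a constant C(k,A) > 0 such that for all x ≥ R ≥ 2 and every real T ≥ 1, Σ_{n ≤ x, Ω(n;R) ≥ T} M_{f_A}(n;R)^{2k} ≤ C(k,A)·x/(T·log R). -/

import Mathlib

open scoped Classical

/-- `M_f(n;R) := Σ_{d | n} μ(d) f(log d / log R)`. -/
noncomputable def Mf (f : ℝ → ℝ) (n : ℕ) (R : ℝ) : ℝ :=
  ∑ d ∈ n.divisors,
    ((ArithmeticFunction.moebius d : ℤ) : ℝ) * f (Real.log d / Real.log R)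

/-- `f_A(t) = (1−t)^A` for `t ≤ 1` and `0` otherwise. -/
noncomputable def fA (A : ℕ) : ℝ → ℝ := fun t => if t ≤ 1 then (1 - t) ^ A else 0

/-- `Ω(n;R)`: the number of prime factors of `n` that are `≤ R`, counted with
multiplicity. -/
noncomputable def bigOmega (n : ℕ) (R : ℝ) : ℕ :=
  ∑ p ∈ n.primeFactors.filter (fun p : ℕ => (p : ℝ) ≤ R), n.factorization p

section

open Finset

lemma norm_cpow_neg_sub_telescope_le {s : ℂ} (hs : 1 < s.re) {a : ℝ} (ha : 1 ≤ a) :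
    ‖(a : ℂ) ^ (-s) - ((a : ℂ) ^ (1 - s) - ((a + 1 : ℝ) : ℂ) ^ (1 - s)) / (s - 1)‖
      ≤ ‖s‖ * a ^ (-2 : ℝ) := by
  have hs1 : s - 1 ≠ 0 := by
    intro h
    have := congrArg Complex.re h
    simp at this
    linarith
  have hs0 : s ≠ 0 := by
    rintro rfl
    simp at hs
    linarith
  have ha0 : 0 < a := by linarith
  have hd1 : ∀ x ∈ Set.Icc a (a + 1), HasDerivWithinAt (fun x : ℝ => (x : ℂ) ^ (-s))
      ((-s) * (x : ℂ) ^ (-s - 1)) (Set.Icc a (a + 1)) x := fun x hx =>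
    (hasDerivAt_ofReal_cpow_const (by linarith [hx.1]) (neg_ne_zero.mpr hs0)).hasDerivWithinAt
  have hb1 : ∀ x ∈ Set.Icc a (a + 1), ‖(-s) * (x : ℂ) ^ (-s - 1)‖ ≤ ‖s‖ * a ^ (-2 : ℝ) := by
    intro x hx
    rw [norm_mul, norm_neg, Complex.norm_cpow_eq_rpow_re_of_pos (by linarith [hx.1])]
    refine mul_le_mul_of_nonneg_left ?_ (norm_nonneg _)
    simp only [Complex.sub_re, Complex.neg_re, Complex.one_re]
    calc x ^ (-s.re - 1) ≤ x ^ (-2 : ℝ) :=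
          Real.rpow_le_rpow_of_exponent_le (by linarith [hx.1]) (by linarith)
      _ ≤ a ^ (-2 : ℝ) := Real.rpow_le_rpow_of_nonpos ha0 hx.1 (by norm_num)
  have hC : ∀ x ∈ Set.Icc a (a + 1), ‖(x : ℂ) ^ (-s) - (a : ℂ) ^ (-s)‖ ≤ ‖s‖ * a ^ (-2 : ℝ) := by
    intro x hx
    have h := (convex_Icc a (a + 1)).norm_image_sub_le_of_norm_hasDerivWithin_le hd1 hb1
      (Set.left_mem_Icc.mpr (by linarith)) hx
    refine h.trans ?_
    have : ‖x - a‖ ≤ 1 := by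
      rw [Real.norm_eq_abs, abs_le]
      constructor <;> linarith [hx.1, hx.2]
    exact mul_le_of_le_one_right (by positivity) this
  have h1s : (1 : ℂ) - s ≠ 0 := by
    intro h
    apply hs1
    linear_combination -h
  have hd2 : ∀ x ∈ Set.Icc a (a + 1), HasDerivWithinAt
      (fun x : ℝ => (x : ℂ) ^ (1 - s) / (1 - s) - (x : ℂ) * (a : ℂ) ^ (-s))
      ((x : ℂ) ^ (-s) - (a : ℂ) ^ (-s)) (Set.Icc a (a + 1)) x := by
    intro x hx
    have e1 := (hasDerivAt_ofReal_cpow_const (x := x) (by linarith [hx.1]) h1s).div_const (1 - s)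
    have e2 : HasDerivAt (fun x : ℝ => (x : ℂ) * (a : ℂ) ^ (-s)) (1 * (a : ℂ) ^ (-s)) x :=
      (Complex.ofRealCLM.hasDerivAt (x := x)).mul_const _
    refine ((e1.sub e2).congr_deriv ?_).hasDerivWithinAt
    rw [mul_div_cancel_left₀ _ h1s, one_mul]
    congr 2
    ring
  have h := (convex_Icc a (a + 1)).norm_image_sub_le_of_norm_hasDerivWithin_le hd2 hC
      (Set.left_mem_Icc.mpr (by linarith)) (Set.right_mem_Icc.mpr (by linarith))
  simp only [add_sub_cancel_left, norm_one, mul_one] at h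
  rw [← norm_neg]
  refine le_of_eq_of_le (congrArg norm ?_) h
  push_cast
  rw [show s - 1 = -(1 - s) by ring]
  field_simp
  ring

lemma norm_zeta_sub_sum_le {s : ℂ} (hs : 1 < s.re) {N : ℕ} (hN : 1 ≤ N) :
    ‖riemannZeta s - ∑ n ∈ range N, ((n + 1 : ℝ) : ℂ) ^ (-s)‖ ≤ 2 / ‖s - 1‖ + 2 * ‖s‖ / N := by
  have hs1 : s - 1 ≠ 0 := by
    intro h
    have := congrArg Complex.re h
    simp at this
    linarith
  have hN0 : (0 : ℝ) < N := by exact_mod_cast hN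
  have key : ∀ m : ℕ, ‖∑ n ∈ range m, ((N + n + 1 : ℝ) : ℂ) ^ (-s)
      - (((N + 1 : ℝ) : ℂ) ^ (1 - s) - ((N + m + 1 : ℝ) : ℂ) ^ (1 - s)) / (s - 1)‖
      ≤ ‖s‖ * (1 / N - 1 / (N + m : ℝ)) := by
    intro m
    induction m with
    | zero => simp
    | succ m ih =>
      rw [sum_range_succ]
      have h1 := norm_cpow_neg_sub_telescope_le hs (a := (N + m + 1 : ℝ))
        (by linarith [(Nat.cast_nonneg m : (0:ℝ) ≤ m)])
      have h2 : (N + m + 1 : ℝ) ^ (-2 : ℝ) ≤ 1 / (N + m : ℝ) - 1 / (N + m + 1 : ℝ) := by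
        have hp : (0 : ℝ) < N + m := by positivity
        rw [Real.rpow_neg (by positivity), Real.rpow_two, div_sub_div _ _ hp.ne' (by positivity),
          inv_eq_one_div, div_le_div_iff₀ (by positivity) (by positivity)]
        nlinarith
      have h3 := norm_add_le _ _ |>.trans (add_le_add ih h1)
      calc _ = _ := ?_
        _ ≤ _ := h3
        _ ≤ _ := ?_
      · congr 1
        push_cast
        rw [show (N : ℂ) + (m + 1) + 1 = N + m + 1 + 1 by ring]
        ring
      · have := mul_le_mul_of_nonneg_left h2 (norm_nonneg s)
        push_cast
        rw [show (N : ℝ) + (m + 1) = N + m + 1 by ring]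
        linarith
  have hsum : Summable fun n : ℕ => ((n + 1 : ℝ) : ℂ) ^ (-s) := by
    have := (Complex.summable_one_div_nat_cpow.mpr hs)
    have := (summable_nat_add_iff 1).mpr this
    refine this.congr fun n => ?_
    push_cast
    rw [Complex.cpow_neg, one_div]
  have hz : riemannZeta s = ∑' n : ℕ, ((n + 1 : ℝ) : ℂ) ^ (-s) := by
    rw [zeta_eq_tsum_one_div_nat_add_one_cpow hs]
    refine tsum_congr fun n => ?_
    push_cast
    rw [Complex.cpow_neg, one_div]
  have hlim : Filter.Tendsto (fun m => ‖∑ n ∈ range (N + m), ((n + 1 : ℝ) : ℂ) ^ (-s)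
      - ∑ n ∈ range N, ((n + 1 : ℝ) : ℂ) ^ (-s)‖) Filter.atTop
      (nhds ‖riemannZeta s - ∑ n ∈ range N, ((n + 1 : ℝ) : ℂ) ^ (-s)‖) := by
    refine (Filter.Tendsto.sub_const ?_ _).norm
    rw [hz]
    have := hsum.hasSum.tendsto_sum_nat
    refine this.comp ?_
    exact Filter.tendsto_atTop_mono (fun m => Nat.le_add_left m N) Filter.tendsto_id
  refine le_of_tendsto' hlim fun m => ?_
  have hk := key m
  have hpow : ∀ b : ℝ, 1 ≤ b → ‖(b : ℂ) ^ (1 - s)‖ ≤ 1 := by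
    intro b hb
    rw [Complex.norm_cpow_eq_rpow_re_of_pos (by linarith)]
    exact Real.rpow_le_one_of_one_le_of_nonpos hb (by simp; linarith)
  have e : ∑ n ∈ range (N + m), ((n + 1 : ℝ) : ℂ) ^ (-s)
      - ∑ n ∈ range N, ((n + 1 : ℝ) : ℂ) ^ (-s) = ∑ n ∈ range m, ((N + n + 1 : ℝ) : ℂ) ^ (-s) := by
    rw [sum_range_add]
    push_cast
    ring
  rw [e]
  set S := ∑ n ∈ range m, ((N + n + 1 : ℝ) : ℂ) ^ (-s)
  set A := (((N + 1 : ℝ) : ℂ) ^ (1 - s) - ((N + m + 1 : ℝ) : ℂ) ^ (1 - s))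
  have hA : ‖A / (s - 1)‖ ≤ 2 / ‖s - 1‖ := by
    rw [norm_div]
    refine div_le_div_of_nonneg_right ?_ (norm_nonneg _)
    refine (norm_sub_le _ _).trans ?_
    have := hpow (N + 1) (by linarith)
    have := hpow (N + m + 1) (by linarith [(Nat.cast_nonneg m : (0:ℝ) ≤ m)])
    linarith
  have : ‖S‖ ≤ ‖S - A / (s - 1)‖ + ‖A / (s - 1)‖ := by
    simpa using norm_add_le (S - A / (s - 1)) (A / (s - 1))
  have h5 : ‖s‖ * (1 / N - 1 / (N + m : ℝ)) ≤ 2 * ‖s‖ / N := by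
    have : ‖s‖ * (1 / N - 1 / (N + m : ℝ)) ≤ ‖s‖ * (1 / N) := by
      refine mul_le_mul_of_nonneg_left ?_ (norm_nonneg _)
      have : (0:ℝ) ≤ 1 / (N + m : ℝ) := by positivity
      linarith
    have h7 : 0 ≤ ‖s‖ * (1 / N) := by positivity
    have : 2 * ‖s‖ / N = 2 * (‖s‖ * (1 / N)) := by ring
    linarith
  linarith

/-- The real part of the prime zeta function at `1 + σ + iτ`. -/
noncomputable def primeCosSum (σ τ : ℝ) : ℝ :=
  ∑' p : Nat.Primes, (p : ℝ) ^ (-1 - σ) * Real.cos (τ * Real.log p)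

lemma prime_cpow_re (p : Nat.Primes) (σ τ : ℝ) :
    (((p : ℕ) : ℂ) ^ (-(⟨1 + σ, τ⟩ : ℂ))).re
      = (p : ℝ) ^ (-1 - σ) * Real.cos (τ * Real.log p) := by
  have hp : (0 : ℝ) < (p : ℕ) := by exact_mod_cast p.2.pos
  rw [show (((p : ℕ) : ℂ)) = (((p : ℕ) : ℝ) : ℂ) by simp,
    Complex.cpow_def_of_ne_zero (by exact_mod_cast hp.ne'), ← Complex.ofReal_log hp.le,
    Complex.exp_re, Real.rpow_def_of_pos hp]
  simp only [Complex.mul_re, Complex.mul_im, Complex.neg_re, Complex.neg_im, Complex.ofReal_re,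
    Complex.ofReal_im, zero_mul, sub_zero, add_zero]
  rw [show Real.log (p : ℕ) * -τ = -(τ * Real.log (p : ℕ)) by ring, Real.cos_neg]
  congr 2
  ring

lemma prime_cpow_norm (p : Nat.Primes) (σ τ : ℝ) :
    ‖((p : ℕ) : ℂ) ^ (-(⟨1 + σ, τ⟩ : ℂ))‖ = (p : ℝ) ^ (-1 - σ) := by
  have hp : (0 : ℝ) < (p : ℕ) := by exact_mod_cast p.2.pos
  rw [show (((p : ℕ) : ℂ)) = (((p : ℕ) : ℝ) : ℂ) by simp, Complex.norm_cpow_eq_rpow_re_of_pos hp]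
  simp
  ring_nf

lemma summable_primes_weight {σ : ℝ} (hσ : 0 < σ) :
    Summable fun p : Nat.Primes => (p : ℝ) ^ (-1 - σ) :=
  Nat.Primes.summable_rpow.mpr (by linarith)

lemma summable_primes_weight_mul {σ : ℝ} (hσ : 0 < σ) {f : Nat.Primes → ℝ} {B : ℝ}
    (hf : ∀ p, |f p| ≤ B) :
    Summable fun p : Nat.Primes => (p : ℝ) ^ (-1 - σ) * f p := by
  refine Summable.of_norm_bounded ((summable_primes_weight hσ).mul_right B) fun p => ?_
  rw [norm_mul, Real.norm_of_nonneg (by positivity)]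
  exact mul_le_mul_of_nonneg_left (hf p) (by positivity)

lemma exists_log_norm_zeta_sub_primeCosSum_le :
    ∃ K : ℝ, ∀ σ τ : ℝ, 0 < σ →
      |Real.log ‖riemannZeta ⟨1 + σ, τ⟩‖ - primeCosSum σ τ| ≤ K := by
  refine ⟨∑' p : Nat.Primes, (p : ℝ) ^ (-2 : ℝ), fun σ τ hσ => ?_⟩
  set s : ℂ := ⟨1 + σ, τ⟩ with hs
  have hs1 : 1 < s.re := by simp [hs, hσ]
  have hsum : Summable fun p : Nat.Primes => ((p : ℕ) : ℂ) ^ (-s) := by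
    refine Summable.of_norm ?_
    simp_rw [hs, prime_cpow_norm]
    exact summable_primes_weight hσ
  have hlog := hsum.clog_one_sub.neg
  have h2 : Summable fun p : Nat.Primes => (p : ℝ) ^ (-2 : ℝ) :=
    Nat.Primes.summable_rpow.mpr (by norm_num)
  have hre := Complex.hasSum_re hlog.hasSum
  have hre2 := Complex.hasSum_re hsum.hasSum
  rw [← riemannZeta_eulerProduct_exp_log hs1, Complex.norm_exp, Real.log_exp]
  have e1 : primeCosSum σ τ = (∑' p : Nat.Primes, ((p : ℕ) : ℂ) ^ (-s)).re := by
    rw [← hre2.tsum_eq]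
    simp_rw [hs, prime_cpow_re]
    rfl
  rw [e1, ← Complex.sub_re, ← hlog.tsum_sub hsum]
  refine (Complex.abs_re_le_norm _).trans (tsum_of_norm_bounded h2.hasSum fun p => ?_)
  have hp2 : (2 : ℝ) ≤ (p : ℕ) := by exact_mod_cast p.2.two_le
  have hn : ‖((p : ℕ) : ℂ) ^ (-s)‖ ≤ (p : ℝ) ^ (-1 : ℝ) := by
    rw [hs, prime_cpow_norm]
    exact Real.rpow_le_rpow_of_exponent_le (by linarith) (by linarith)
  have hinv : (p : ℝ) ^ (-1 : ℝ) ≤ 1 / 2 := by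
    rw [Real.rpow_neg_one, inv_eq_one_div]
    exact one_div_le_one_div_of_le (by norm_num) hp2
  have hlt : ‖((p : ℕ) : ℂ) ^ (-s)‖ < 1 := by linarith
  have hb := Complex.norm_log_one_sub_inv_sub_self_le hlt
  rw [Complex.log_inv _ (Complex.slitPlane_arg_ne_pi ?_)] at hb
  · refine hb.trans ?_
    have h3 : (1 - ‖((p : ℕ) : ℂ) ^ (-s)‖)⁻¹ ≤ 2 := by
      rw [inv_le_comm₀ (by linarith) (by norm_num)]
      linarith
    have h4 : ‖((p : ℕ) : ℂ) ^ (-s)‖ ^ 2 ≤ (p : ℝ) ^ (-2 : ℝ) := by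
      have : (p : ℝ) ^ (-2 : ℝ) = ((p : ℝ) ^ (-1 : ℝ)) ^ 2 := by
        rw [← Real.rpow_natCast, ← Real.rpow_mul (by linarith)]
        norm_num
      rw [this]
      exact pow_le_pow_left₀ (norm_nonneg _) hn 2
    have h5 := mul_le_mul_of_nonneg_left h3 (sq_nonneg ‖((p : ℕ) : ℂ) ^ (-s)‖)
    linarith
  · refine Complex.mem_slitPlane_of_norm_lt_one (z := -((p : ℕ) : ℂ) ^ (-s)) (by simpa using hlt)
    |> fun h => ?_
    simpa [sub_eq_add_neg] using h

lemma primeCosSum_three_four_one {σ : ℝ} (hσ : 0 < σ) (τ : ℝ) :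
    0 ≤ 3 * primeCosSum σ 0 + 4 * primeCosSum σ τ + primeCosSum σ (2 * τ) := by
  have hb : ∀ t : ℝ, ∀ p : Nat.Primes, |Real.cos (t * Real.log p)| ≤ 1 := fun t p =>
    Real.abs_cos_le_one _
  have h0 := summable_primes_weight_mul hσ (hb 0)
  have h1 := summable_primes_weight_mul hσ (hb τ)
  have h2 := summable_primes_weight_mul hσ (hb (2 * τ))
  unfold primeCosSum
  rw [← tsum_mul_left, ← tsum_mul_left, ← (h0.mul_left 3).tsum_add (h1.mul_left 4),
    ← ((h0.mul_left 3).add (h1.mul_left 4)).tsum_add h2]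
  refine tsum_nonneg fun p => ?_
  rw [mul_assoc 2 τ, Real.cos_two_mul]
  have hp : (0 : ℝ) ≤ (p : ℝ) ^ (-1 - σ) := by positivity
  have : (0 : ℝ) ≤ (p : ℝ) ^ (-1 - σ) * (2 * (1 + Real.cos (τ * Real.log p)) ^ 2) := by positivity
  simp only [zero_mul, Real.cos_zero]
  linarith

/-- `max 0 (-log a)`. -/
noncomputable def negLogPlus (a : ℝ) : ℝ := max 0 (-Real.log a)

lemma exists_log_norm_zeta_near {B : ℝ} (hB : 0 ≤ B) :
    ∃ K : ℝ, ∀ σ τ : ℝ, 0 < σ → σ ≤ 1 → |τ| ≤ B →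
      |Real.log ‖riemannZeta ⟨1 + σ, τ⟩‖ - negLogPlus (σ + |τ|)| ≤ K := by
  have hc : IsCompact ((Set.Icc (1 : ℝ) 2) ×ℂ (Set.Icc (-B) B)) :=
    isCompact_Icc.reProdIm isCompact_Icc
  have hne : ∀ s ∈ (Set.Icc (1 : ℝ) 2) ×ℂ (Set.Icc (-B) B), ‖riemannZeta₁ s‖ ≠ 0 := by
    intro s hs h0
    rw [norm_eq_zero] at h0
    have h1 : s ≠ 1 := by
      rintro rfl
      simp at h0
    have := riemannZeta_eq_inv_sub_mul h1
    rw [h0, mul_zero] at this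
    exact riemannZeta_ne_zero_of_one_le_re hs.1.1 this
  have hcont : ContinuousOn (fun s => Real.log ‖riemannZeta₁ s‖)
      ((Set.Icc (1 : ℝ) 2) ×ℂ (Set.Icc (-B) B)) :=
    ContinuousOn.log (differentiable_riemannZeta₁.continuous.norm.continuousOn) hne
  obtain ⟨K, hK⟩ := hc.exists_bound_of_continuousOn hcont
  refine ⟨K + Real.log 2 + Real.log (1 + B) , fun σ τ hσ hσ1 hτ => ?_⟩
  set s : ℂ := ⟨1 + σ, τ⟩ with hs
  have hmem : s ∈ (Set.Icc (1 : ℝ) 2) ×ℂ (Set.Icc (-B) B) :=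
    ⟨⟨by simp [hs, hσ.le], by simp [hs]; linarith⟩, abs_le.mp hτ⟩
  have h1 : s ≠ 1 := by
    intro h
    have := congrArg Complex.re h
    simp [hs] at this
    linarith
  have hs1 : s - 1 = ⟨σ, τ⟩ := by
    apply Complex.ext <;> simp [hs]
  have hup : ‖s - 1‖ ≤ σ + |τ| := by
    rw [hs1]
    refine (Complex.norm_le_abs_re_add_abs_im _).trans ?_
    simp [abs_of_pos hσ]
  have hlo : σ + |τ| ≤ 2 * ‖s - 1‖ := by
    rw [hs1]
    have a1 := Complex.abs_re_le_norm ⟨σ, τ⟩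
    have a2 := Complex.abs_im_le_norm ⟨σ, τ⟩
    simp only [abs_of_pos hσ] at a1 a2
    linarith
  have hpos : 0 < ‖s - 1‖ := by
    rw [norm_pos_iff]
    exact sub_ne_zero.mpr h1
  have hpos' : 0 < σ + |τ| := by positivity
  have hz := riemannZeta_eq_inv_sub_mul h1
  rw [hz, norm_mul, norm_inv, Real.log_mul (by positivity) (hne s hmem), Real.log_inv]
  have hk := hK s hmem
  rw [Real.norm_eq_abs, abs_le] at hk
  have l1 := Real.log_le_log hpos hup
  have l2 := Real.log_le_log hpos' hlo
  rw [Real.log_mul (by norm_num) hpos.ne'] at l2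
  have l3 : Real.log (σ + |τ|) ≤ Real.log (1 + B) := Real.log_le_log hpos' (by linarith)
  have l4 : 0 ≤ Real.log (1 + B) := Real.log_nonneg (by linarith)
  have l5 : 0 ≤ Real.log 2 := Real.log_nonneg (by norm_num)
  unfold negLogPlus
  rw [abs_le]
  rcases max_cases 0 (-Real.log (σ + |τ|)) with ⟨h, h'⟩ | ⟨h, h'⟩ <;> rw [h] <;>
    constructor <;> linarith

lemma norm_mk_add_le {σ τ : ℝ} (hσ : 0 < σ) (hσ1 : σ ≤ 1) : ‖(⟨1 + σ, τ⟩ : ℂ)‖ ≤ 2 + |τ| := by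
  refine (Complex.norm_le_abs_re_add_abs_im _).trans ?_
  simp only
  rw [abs_of_pos (by linarith)]
  linarith

lemma abs_le_norm_mk_sub_one (σ τ : ℝ) : |τ| ≤ ‖(⟨1 + σ, τ⟩ : ℂ) - 1‖ := by
  have := Complex.abs_im_le_norm ((⟨1 + σ, τ⟩ : ℂ) - 1)
  simpa using this

lemma one_le_log_of_three_le {t : ℝ} (ht : 3 ≤ t) : 1 ≤ Real.log t := by
  rw [Real.le_log_iff_exp_le (by linarith)]
  linarith [Real.exp_one_lt_d9]

lemma nat_cpow_neg_norm (n : ℕ) (σ τ : ℝ) :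
    ‖((n + 1 : ℝ) : ℂ) ^ (-(⟨1 + σ, τ⟩ : ℂ))‖ = (n + 1 : ℝ) ^ (-1 - σ) := by
  rw [Complex.norm_cpow_eq_rpow_re_of_pos (by positivity)]
  simp
  ring_nf

lemma norm_zeta_le_log {σ τ : ℝ} (hσ : 0 < σ) (hσ1 : σ ≤ 1) (hτ : 3 ≤ |τ|) :
    ‖riemannZeta ⟨1 + σ, τ⟩‖ ≤ 8 * Real.log |τ| := by
  have hl := one_le_log_of_three_le hτ
  set N := ⌈|τ|⌉₊
  have hN1 : |τ| ≤ N := Nat.le_ceil _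
  have hN2 : (N : ℝ) ≤ |τ| ^ 2 := by
    have := (Nat.ceil_lt_add_one (abs_nonneg τ)).le
    nlinarith
  have hN : 1 ≤ N := by
    have : (1 : ℝ) ≤ N := by linarith
    exact_mod_cast this
  have h := norm_zeta_sub_sum_le (s := ⟨1 + σ, τ⟩) (by simpa using hσ) hN
  have h1 : ‖∑ n ∈ range N, ((n + 1 : ℝ) : ℂ) ^ (-(⟨1 + σ, τ⟩ : ℂ))‖ ≤ 1 + 2 * Real.log |τ| := by
    calc _ ≤ ∑ n ∈ range N, ((n : ℝ) + 1)⁻¹ := by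
          refine norm_sum_le_of_le _ fun n _ => ?_
          rw [nat_cpow_neg_norm, ← Real.rpow_neg_one]
          exact Real.rpow_le_rpow_of_exponent_le (by linarith [(Nat.cast_nonneg n : (0:ℝ) ≤ n)])
            (by linarith)
      _ = (harmonic N : ℝ) := by
          simp [harmonic]
      _ ≤ 1 + Real.log N := harmonic_le_one_add_log N
      _ ≤ 1 + 2 * Real.log |τ| := by
          have := Real.log_le_log (by positivity) hN2
          rw [Real.log_pow] at this
          push_cast at this
          linarith
  have h2 : 2 / ‖(⟨1 + σ, τ⟩ : ℂ) - 1‖ ≤ 1 := by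
    have := abs_le_norm_mk_sub_one σ τ
    rw [div_le_one (by linarith)]
    linarith
  have h3 : 2 * ‖(⟨1 + σ, τ⟩ : ℂ)‖ / N ≤ 4 := by
    have := norm_mk_add_le (τ := τ) hσ hσ1
    rw [div_le_iff₀ (by positivity)]
    linarith
  have h4 := norm_add_le
    (riemannZeta ⟨1 + σ, τ⟩ - ∑ n ∈ range N, ((n + 1 : ℝ) : ℂ) ^ (-(⟨1 + σ, τ⟩ : ℂ)))
    (∑ n ∈ range N, ((n + 1 : ℝ) : ℂ) ^ (-(⟨1 + σ, τ⟩ : ℂ)))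
  rw [sub_add_cancel] at h4
  linarith

lemma norm_cpow_sub_cpow_le (n : ℕ) {σ σ₀ τ : ℝ} (hσ : 0 < σ) (h0 : σ ≤ σ₀) :
    ‖((n + 1 : ℝ) : ℂ) ^ (-(⟨1 + σ, τ⟩ : ℂ)) - ((n + 1 : ℝ) : ℂ) ^ (-(⟨1 + σ₀, τ⟩ : ℂ))‖
      ≤ ((n : ℝ) + 1)⁻¹ * ((σ₀ - σ) * Real.log (n + 1)) := by
  have hn : (1 : ℝ) ≤ n + 1 := by linarith [(Nat.cast_nonneg n : (0:ℝ) ≤ n)]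
  have hn0 : ((n + 1 : ℝ) : ℂ) ≠ 0 := by
    exact_mod_cast (by linarith : (n + 1 : ℝ) ≠ 0)
  have e : -(⟨1 + σ₀, τ⟩ : ℂ) = -(⟨1 + σ, τ⟩ : ℂ) + ((σ - σ₀ : ℝ) : ℂ) := by
    apply Complex.ext
    · simp
      ring
    · simp
  rw [e, Complex.cpow_add _ _ hn0, ← mul_one_sub, norm_mul, nat_cpow_neg_norm,
    ← Complex.ofReal_cpow (by linarith), ← Complex.ofReal_one, ← Complex.ofReal_sub,
    Complex.norm_real, Real.norm_eq_abs]
  have hlog : 0 ≤ Real.log (n + 1) := Real.log_nonneg hn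
  have h1 : |1 - (n + 1 : ℝ) ^ (σ - σ₀)| ≤ (σ₀ - σ) * Real.log (n + 1) := by
    rw [abs_of_nonneg]
    · rw [Real.rpow_def_of_pos (by linarith)]
      have := Real.add_one_le_exp (Real.log (n + 1) * (σ - σ₀))
      linarith
    · have := Real.rpow_le_one_of_one_le_of_nonpos hn (by linarith : σ - σ₀ ≤ 0)
      linarith
  refine mul_le_mul ?_ h1 (abs_nonneg _) (by positivity)
  rw [← Real.rpow_neg_one]
  exact Real.rpow_le_rpow_of_exponent_le hn (by linarith)

lemma norm_zeta_sub_zeta_le {σ σ₀ τ : ℝ} (hσ : 0 < σ) (h0 : σ ≤ σ₀) (h1 : σ₀ ≤ 1) (hτ : 3 ≤ |τ|) :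
    ‖riemannZeta ⟨1 + σ, τ⟩ - riemannZeta ⟨1 + σ₀, τ⟩‖
      ≤ 12 * Real.log |τ| ^ 2 * (σ₀ - σ) + 12 / |τ| := by
  have hl := one_le_log_of_three_le hτ
  set N := ⌈|τ| ^ 2⌉₊
  have hN1 : |τ| ^ 2 ≤ N := Nat.le_ceil _
  have hN2 : (N : ℝ) ≤ |τ| ^ 3 := by
    have := (Nat.ceil_lt_add_one (sq_nonneg |τ|)).le
    nlinarith [sq_nonneg |τ|]
  have hN : 1 ≤ N := by
    have : (1 : ℝ) ≤ N := by nlinarith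
    exact_mod_cast this
  have hN0 : (0 : ℝ) < N := by exact_mod_cast hN
  have hlogN : Real.log N ≤ 3 * Real.log |τ| := by
    have := Real.log_le_log (by positivity) hN2
    rw [Real.log_pow] at this
    push_cast at this
    linarith
  have herr : ∀ σ' : ℝ, 0 < σ' → σ' ≤ 1 →
      ‖riemannZeta ⟨1 + σ', τ⟩ - ∑ n ∈ range N, ((n + 1 : ℝ) : ℂ) ^ (-(⟨1 + σ', τ⟩ : ℂ))‖
        ≤ 6 / |τ| := by
    intro σ' hσ' hσ1'
    refine (norm_zeta_sub_sum_le (s := ⟨1 + σ', τ⟩) (by simpa using hσ') hN).trans ?_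
    have h2 : 2 / ‖(⟨1 + σ', τ⟩ : ℂ) - 1‖ ≤ 2 / |τ| :=
      div_le_div_of_nonneg_left (by norm_num) (by linarith) (abs_le_norm_mk_sub_one σ' τ)
    have h3 : 2 * ‖(⟨1 + σ', τ⟩ : ℂ)‖ / N ≤ 4 / |τ| := by
      have := norm_mk_add_le (τ := τ) hσ' hσ1'
      rw [div_le_div_iff₀ hN0 (by linarith)]
      nlinarith
    have : 6 / |τ| = 2 / |τ| + 4 / |τ| := by ring
    linarith
  have e1 := herr σ hσ (h0.trans h1)
  have e2 := herr σ₀ (hσ.trans_le h0) h1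
  have e3 : ‖∑ n ∈ range N, ((n + 1 : ℝ) : ℂ) ^ (-(⟨1 + σ, τ⟩ : ℂ))
      - ∑ n ∈ range N, ((n + 1 : ℝ) : ℂ) ^ (-(⟨1 + σ₀, τ⟩ : ℂ))‖
      ≤ 12 * Real.log |τ| ^ 2 * (σ₀ - σ) := by
    rw [← sum_sub_distrib]
    calc _ ≤ ∑ n ∈ range N, ((n : ℝ) + 1)⁻¹ * ((σ₀ - σ) * Real.log N) := by
          refine norm_sum_le_of_le _ fun n hn => (norm_cpow_sub_cpow_le n hσ h0).trans ?_
          have : (n + 1 : ℝ) ≤ N := by exact_mod_cast mem_range.mp hn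
          have := Real.log_le_log (by positivity) this
          gcongr
      _ = (harmonic N : ℝ) * ((σ₀ - σ) * Real.log N) := by
          rw [← sum_mul]
          simp [harmonic]
      _ ≤ (1 + 3 * Real.log |τ|) * ((σ₀ - σ) * (3 * Real.log |τ|)) := by
          have h5 := harmonic_le_one_add_log N
          have : 0 ≤ Real.log N := Real.log_natCast_nonneg N
          have : 0 ≤ σ₀ - σ := by linarith
          gcongr
          linarith
      _ ≤ _ := by
          have : 0 ≤ (σ₀ - σ) * (Real.log |τ| * (Real.log |τ| - 1)) :=
            mul_nonneg (by linarith) (mul_nonneg (by linarith) (by linarith))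
          nlinarith
  set S := ∑ n ∈ range N, ((n + 1 : ℝ) : ℂ) ^ (-(⟨1 + σ, τ⟩ : ℂ))
  set S₀ := ∑ n ∈ range N, ((n + 1 : ℝ) : ℂ) ^ (-(⟨1 + σ₀, τ⟩ : ℂ))
  have e4 : riemannZeta ⟨1 + σ, τ⟩ - riemannZeta ⟨1 + σ₀, τ⟩
      = (riemannZeta ⟨1 + σ, τ⟩ - S) + (S - S₀) - (riemannZeta ⟨1 + σ₀, τ⟩ - S₀) := by ring
  rw [e4]
  refine (norm_sub_le _ _).trans ((add_le_add (norm_add_le _ _) le_rfl).trans ?_)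
  have : 12 / |τ| = 6 / |τ| + 6 / |τ| := by ring
  linarith

lemma zeta_mk_ne_zero {σ : ℝ} (hσ : 0 < σ) (τ : ℝ) : riemannZeta ⟨1 + σ, τ⟩ ≠ 0 :=
  riemannZeta_ne_zero_of_one_le_re (by simp [hσ.le])

lemma exists_log_norm_zeta_ge :
    ∃ K : ℝ, ∀ σ τ : ℝ, 0 < σ → σ ≤ 1 → 3 ≤ |τ| →
      3 / 4 * Real.log σ - Real.log (Real.log |τ|) - K ≤ Real.log ‖riemannZeta ⟨1 + σ, τ⟩‖ := by
  obtain ⟨K₁, h₁⟩ := exists_log_norm_zeta_sub_primeCosSum_le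
  obtain ⟨K₂, h₂⟩ := exists_log_norm_zeta_near le_rfl
  refine ⟨K₁ + 3 / 4 * (K₁ + K₂) + (Real.log 16 + K₁) / 4, fun σ τ hσ hσ1 hτ => ?_⟩
  have hl := one_le_log_of_three_le hτ
  have hll := Real.log_nonneg hl
  have a := primeCosSum_three_four_one hσ τ
  have b0 := abs_le.mp (h₁ σ 0 hσ)
  have b1 := abs_le.mp (h₁ σ τ hσ)
  have b2 := abs_le.mp (h₁ σ (2 * τ) hσ)
  have c := abs_le.mp (h₂ σ 0 hσ hσ1 (by simp))
  rw [abs_zero, add_zero] at c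
  have d : negLogPlus σ = -Real.log σ :=
    max_eq_right (by linarith [Real.log_nonpos hσ.le hσ1])
  have h2τ : |2 * τ| = 2 * |τ| := by rw [abs_mul, abs_two]
  have e := norm_zeta_le_log (τ := 2 * τ) hσ hσ1 (by rw [h2τ]; linarith)
  have f : Real.log |2 * τ| ≤ 2 * Real.log |τ| := by
    rw [h2τ, Real.log_mul (by norm_num) (by linarith)]
    have := Real.log_le_log (by norm_num) (by linarith : 2 ≤ |τ|)
    linarith
  have g : Real.log ‖riemannZeta ⟨1 + σ, 2 * τ⟩‖ ≤ Real.log 16 + Real.log (Real.log |τ|) := by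
    rw [← Real.log_mul (by norm_num) (by linarith)]
    exact Real.log_le_log (norm_pos_iff.mpr (zeta_mk_ne_zero hσ _)) (by linarith)
  linarith [c.1, c.2, b0.1, b0.2, b1.1, b1.2, b2.1, b2.2]

lemma exists_log_norm_zeta_far :
    ∃ K B : ℝ, 3 ≤ B ∧ ∀ σ τ : ℝ, 0 < σ → σ ≤ 1 → B ≤ |τ| →
      |Real.log ‖riemannZeta ⟨1 + σ, τ⟩‖| ≤ 10 * Real.log (Real.log |τ|) + K := by
  obtain ⟨K, hK⟩ := exists_log_norm_zeta_ge
  set κ := Real.exp (-K)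
  have hκ : 0 < κ := Real.exp_pos _
  set c := min 1 (κ / 48)
  have hc : 0 < c := lt_min one_pos (by positivity)
  have hc1 : c ≤ 1 := min_le_left _ _
  have hcκ : c ≤ κ / 48 := min_le_right _ _
  have hlit : ∀ᶠ t : ℝ in Filter.atTop, Real.log t ^ 10 ≤ κ * c ^ 3 / 48 * t := by
    have := (Real.isLittleO_pow_log_id_atTop (n := 10)).bound (c := κ * c ^ 3 / 48) (by positivity)
    filter_upwards [this, Filter.eventually_ge_atTop 1] with t ht ht1
    rw [Real.norm_of_nonneg (pow_nonneg (Real.log_nonneg ht1) _), id,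
      Real.norm_of_nonneg (by linarith)] at ht
    exact ht
  obtain ⟨B, hB⟩ := Filter.eventually_atTop.mp hlit
  refine ⟨max (Real.log 8) (-Real.log (κ * c ^ 3 / 2)), max 3 B, le_max_left _ _,
    fun σ τ hσ hσ1 hτ => ?_⟩
  have hτ3 : 3 ≤ |τ| := (le_max_left _ _).trans hτ
  have hbig := hB |τ| ((le_max_right _ _).trans hτ)
  have hl := one_le_log_of_three_le hτ3
  set l := Real.log |τ|
  have hll := Real.log_nonneg hl
  have hl0 : 0 < l := by linarith
  have hpos := norm_pos_iff.mpr (zeta_mk_ne_zero hσ τ)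
  have hup := Real.log_le_log hpos (norm_zeta_le_log hσ hσ1 hτ3)
  rw [Real.log_mul (by norm_num) hl0.ne'] at hup
  set σ₀ := (c / l ^ 3) ^ 4 with hσ₀
  have hν : 0 < c / l ^ 3 := by positivity
  have hν1 : c / l ^ 3 ≤ 1 := by
    rw [div_le_one (by positivity)]
    exact hc1.trans (one_le_pow₀ hl)
  have hσ₀0 : 0 < σ₀ := by positivity
  have hσ₀1 : σ₀ ≤ 1 := pow_le_one₀ hν.le hν1
  have hlogσ₀ : 3 / 4 * Real.log σ₀ = Real.log ((c / l ^ 3) ^ 3) := by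
    rw [hσ₀, Real.log_pow, Real.log_pow]
    push_cast
    ring
  have hlow : ∀ σ' : ℝ, σ₀ ≤ σ' → σ' ≤ 1 →
      κ * c ^ 3 / l ^ 10 ≤ ‖riemannZeta ⟨1 + σ', τ⟩‖ := by
    intro σ' h h1
    have hσ' : 0 < σ' := hσ₀0.trans_le h
    have a := hK σ' τ hσ' h1 hτ3
    have b := Real.log_le_log hσ₀0 h
    rw [← Real.log_le_log_iff (by positivity) (norm_pos_iff.mpr (zeta_mk_ne_zero hσ' τ))]
    have e : κ * c ^ 3 / l ^ 10 = κ * (c / l ^ 3) ^ 3 / l := by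
      field_simp
    rw [e, Real.log_div (by positivity) (by positivity),
      Real.log_mul (by positivity) (by positivity),
      ← hlogσ₀, Real.log_exp]
    linarith
  have hmain : κ * c ^ 3 / 2 / l ^ 10 ≤ ‖riemannZeta ⟨1 + σ, τ⟩‖ := by
    have h9 : κ * c ^ 3 / l ^ 10 = 2 * (κ * c ^ 3 / 2 / l ^ 10) := by ring
    have h10 : 0 < κ * c ^ 3 / 2 / l ^ 10 := by positivity
    rcases le_total σ₀ σ with h | h
    · have := hlow σ h hσ1
      linarith
    · have a := hlow σ₀ le_rfl hσ₀1
      have b := norm_zeta_sub_zeta_le hσ h hσ₀1 hτ3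
      have d : 12 / |τ| ≤ κ * c ^ 3 / 2 / l ^ 10 / 2 := by
        rw [div_div, div_div, div_le_div_iff₀ (by linarith) (by positivity)]
        linarith
      have e : 12 * l ^ 2 * (σ₀ - σ) ≤ κ * c ^ 3 / 2 / l ^ 10 / 2 := by
        have : 12 * l ^ 2 * (σ₀ - σ) ≤ 12 * l ^ 2 * σ₀ := by
          refine mul_le_mul_of_nonneg_left (by linarith) (by positivity)
        refine this.trans ?_
        have : 12 * l ^ 2 * σ₀ = 12 * c * c ^ 3 / l ^ 10 := by
          rw [hσ₀]
          field_simp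
        rw [this, show κ * c ^ 3 / 2 / l ^ 10 / 2 = (κ / 4) * c ^ 3 / l ^ 10 by ring]
        gcongr
        linarith
      have f := norm_sub_norm_le (riemannZeta ⟨1 + σ₀, τ⟩) (riemannZeta ⟨1 + σ, τ⟩)
      rw [norm_sub_rev] at f
      linarith
  have hlo := Real.log_le_log (by positivity) hmain
  rw [Real.log_div (by positivity) (by positivity), Real.log_pow] at hlo
  push_cast at hlo
  rw [abs_le]
  have m1 := le_max_left (Real.log 8) (-Real.log (κ * c ^ 3 / 2))
  have m2 := le_max_right (Real.log 8) (-Real.log (κ * c ^ 3 / 2))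
  constructor <;> linarith

theorem exists_primeCosSum_bound {ε : ℝ} (hε : 0 < ε) :
    ∃ K : ℝ, 0 ≤ K ∧ ∀ σ τ : ℝ, 0 < σ →
      |primeCosSum σ τ - negLogPlus (σ + |τ|)| ≤ ε * Real.log (2 + |τ|) + K := by
  obtain ⟨K₁, h₁⟩ := exists_log_norm_zeta_sub_primeCosSum_le
  obtain ⟨K₂, B, hB, h₂⟩ := exists_log_norm_zeta_far
  obtain ⟨K₃, h₃⟩ := exists_log_norm_zeta_near (B := B) (by linarith)
  set K₄ := ∑' p : Nat.Primes, (p : ℝ) ^ (-2 : ℝ)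
  set K₅ := -10 * Real.log (ε / 10)
  refine ⟨|K₁| + |K₂| + |K₃| + |K₄| + |K₅|, by positivity, fun σ τ hσ => ?_⟩
  have p1 := abs_nonneg K₁
  have p2 := abs_nonneg K₂
  have p3 := abs_nonneg K₃
  have p4 := abs_nonneg K₄
  have p5 := abs_nonneg K₅
  have q1 := le_abs_self K₁
  have q2 := le_abs_self K₂
  have q3 := le_abs_self K₃
  have q4 := le_abs_self K₄
  have q5 := le_abs_self K₅
  have hL : 0 ≤ ε * Real.log (2 + |τ|) :=
    mul_nonneg hε.le (Real.log_nonneg (by linarith [abs_nonneg τ]))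
  rcases le_total σ 1 with hσ1 | hσ1
  · have a := abs_le.mp (h₁ σ τ hσ)
    rcases le_total |τ| B with h | h
    · have b := abs_le.mp (h₃ σ τ hσ hσ1 h)
      rw [abs_le]
      constructor <;> linarith [a.1, a.2, b.1, b.2]
    · have b := abs_le.mp (h₂ σ τ hσ hσ1 h)
      have hl := one_le_log_of_three_le (hB.trans h)
      have hn : negLogPlus (σ + |τ|) = 0 := by
        refine max_eq_left ?_
        have := Real.log_nonneg (by linarith : 1 ≤ σ + |τ|)
        linarith
      rw [hn, sub_zero]
      have c := Real.log_le_sub_one_of_pos (by positivity : 0 < ε / 10 * Real.log |τ|)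
      rw [Real.log_mul (by positivity) (by positivity)] at c
      have d := Real.log_le_log (by linarith) (by linarith : |τ| ≤ 2 + |τ|)
      have e := mul_le_mul_of_nonneg_left d hε.le
      have f : K₅ = -10 * Real.log (ε / 10) := rfl
      rw [abs_le]
      constructor <;> linarith [a.1, a.2, b.1, b.2]
  · have hn : negLogPlus (σ + |τ|) = 0 := by
      refine max_eq_left ?_
      have := Real.log_nonneg (by linarith [abs_nonneg τ] : 1 ≤ σ + |τ|)
      linarith
    rw [hn, sub_zero]
    have h2 : Summable fun p : Nat.Primes => (p : ℝ) ^ (-2 : ℝ) :=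
      Nat.Primes.summable_rpow.mpr (by norm_num)
    have : |primeCosSum σ τ| ≤ K₄ := by
      rw [← Real.norm_eq_abs]
      refine tsum_of_norm_bounded h2.hasSum fun p => ?_
      have hp2 : (2 : ℝ) ≤ (p : ℕ) := by exact_mod_cast p.2.two_le
      rw [norm_mul, Real.norm_of_nonneg (by positivity)]
      calc (p : ℝ) ^ (-1 - σ) * ‖Real.cos (τ * Real.log p)‖ ≤ (p : ℝ) ^ (-1 - σ) * 1 :=
            mul_le_mul_of_nonneg_left (Real.abs_cos_le_one _) (by positivity)
        _ ≤ _ := by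
            rw [mul_one]
            exact Real.rpow_le_rpow_of_exponent_le (by linarith) (by linarith)
    linarith

/-- The primes up to `R`. -/
noncomputable def primesUpTo (R : ℝ) : Finset ℕ := (Finset.range (⌊R⌋₊ + 1)).filter Nat.Prime

lemma mem_primesUpTo {R : ℝ} (hR : 0 ≤ R) {p : ℕ} :
    p ∈ primesUpTo R ↔ p.Prime ∧ (p : ℝ) ≤ R := by
  simp only [primesUpTo, mem_filter, mem_range, Nat.lt_succ_iff, Nat.le_floor_iff hR]
  tauto

lemma hasSum_primeCosSum {σ : ℝ} (hσ : 0 < σ) (τ : ℝ) :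
    HasSum (fun p : Nat.Primes => (p : ℝ) ^ (-1 - σ) * Real.cos (τ * Real.log p))
      (primeCosSum σ τ) :=
  (summable_primes_weight_mul hσ (B := 1) fun _ => Real.abs_cos_le_one _).hasSum

lemma sum_primesUpTo_le_tsum {f : ℕ → ℝ} (hf : ∀ p : ℕ, p.Prime → 0 ≤ f p)
    (hs : Summable fun p : Nat.Primes => f p) (R : ℝ) :
    ∑ p ∈ primesUpTo R, f p ≤ ∑' p : Nat.Primes, f p := by
  have h := Summable.sum_le_tsum (f := fun p : Nat.Primes => f p)
    ((primesUpTo R).subtype Nat.Prime) (fun p _ => hf p p.2) hs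
  refine le_trans (le_of_eq ?_) h
  exact (Finset.sum_subtype_of_mem f fun p hp => (mem_filter.mp hp).2).symm

lemma negLogPlus_anti {a b : ℝ} (ha : 0 < a) (hab : a ≤ b) : negLogPlus b ≤ negLogPlus a := by
  have := Real.log_le_log ha hab
  exact max_le_max le_rfl (by linarith)

lemma negLogPlus_sub_le {a b : ℝ} (ha : 0 < a) (hab : a ≤ b) :
    negLogPlus a - negLogPlus b ≤ Real.log (b / a) := by
  have h1 := Real.log_le_log ha hab
  rw [Real.log_div (by linarith) ha.ne']
  unfold negLogPlus
  rcases max_cases 0 (-Real.log a) with ⟨h, h'⟩ | ⟨h, h'⟩ <;>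
    rcases max_cases 0 (-Real.log b) with ⟨g, g'⟩ | ⟨g, g'⟩ <;> rw [h, g] <;> linarith

lemma exists_sum_primesUpTo_one_sub_le :
    ∃ K : ℝ, 0 ≤ K ∧ ∀ R : ℝ, 2 ≤ R →
      ∑ p ∈ primesUpTo R, (1 - (p : ℝ) ^ (-(1 / Real.log R))) / p ≤ K := by
  obtain ⟨K, hK0, hK⟩ := exists_primeCosSum_bound one_pos
  refine ⟨Real.exp 1 * (Real.log 2 + 2 * (1 * Real.log 2 + K)), by positivity, fun R hR => ?_⟩
  have hlog : 0 < Real.log R := Real.log_pos (by linarith)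
  set σ := 1 / Real.log R with hσdef
  have hσ : 0 < σ := by positivity
  have h1 := hasSum_primeCosSum hσ 0
  have h2 := hasSum_primeCosSum (σ := 2 * σ) (by positivity) 0
  have h3 := h1.sub h2
  simp only [zero_mul, Real.cos_zero, mul_one] at h3
  have hle : ∀ p : ℕ, p.Prime → 0 ≤ (p : ℝ) ^ (-1 - σ) - (p : ℝ) ^ (-1 - 2 * σ) := by
    intro p hp
    have : (1 : ℝ) ≤ p := by exact_mod_cast hp.one_lt.le
    exact sub_nonneg.mpr (Real.rpow_le_rpow_of_exponent_le this (by linarith))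
  have h4 := sum_primesUpTo_le_tsum (f := fun p => (p : ℝ) ^ (-1 - σ) - (p : ℝ) ^ (-1 - 2 * σ))
    hle h3.summable R
  rw [h3.tsum_eq] at h4
  calc _ ≤ ∑ p ∈ primesUpTo R, Real.exp 1 * ((p : ℝ) ^ (-1 - σ) - (p : ℝ) ^ (-1 - 2 * σ)) := by
        refine sum_le_sum fun p hp => ?_
        obtain ⟨hp, hpR⟩ := (mem_primesUpTo (by linarith)).mp hp
        have hp0 : (0 : ℝ) < p := by exact_mod_cast hp.pos
        have hp1 : (1 : ℝ) ≤ p := by exact_mod_cast hp.one_lt.le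
        have e1 : (p : ℝ) ^ (-1 - σ) = (p : ℝ) ^ (-σ) / p := by
          rw [show -1 - σ = -σ - 1 by ring, Real.rpow_sub_one hp0.ne']
        have e2 : (p : ℝ) ^ (-1 - 2 * σ) = (p : ℝ) ^ (-σ) * (p : ℝ) ^ (-σ) / p := by
          rw [show -1 - 2 * σ = (-σ + -σ) - 1 by ring, Real.rpow_sub_one hp0.ne', Real.rpow_add hp0]
        have e3 : (p : ℝ) ^ (-σ) ≤ 1 := Real.rpow_le_one_of_one_le_of_nonpos hp1 (by linarith)
        have e4 : Real.exp (-1) ≤ (p : ℝ) ^ (-σ) := by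
          rw [Real.rpow_def_of_pos hp0, Real.exp_le_exp]
          have := Real.log_le_log hp0 hpR
          have : Real.log p * σ ≤ 1 := by
            rw [hσdef, mul_one_div, div_le_one hlog]
            exact this
          linarith
        have e5 : 1 ≤ Real.exp 1 * (p : ℝ) ^ (-σ) := by
          have := mul_le_mul_of_nonneg_left e4 (Real.exp_pos 1).le
          rwa [← Real.exp_add, add_neg_cancel, Real.exp_zero] at this
        rw [e1, e2, ← sub_div, mul_div_assoc']
        refine div_le_div_of_nonneg_right ?_ hp0.le
        nlinarith
    _ ≤ Real.exp 1 * (primeCosSum σ 0 - primeCosSum (2 * σ) 0) := by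
        rw [← mul_sum]
        exact mul_le_mul_of_nonneg_left h4 (Real.exp_pos 1).le
    _ ≤ _ := by
        refine mul_le_mul_of_nonneg_left ?_ (Real.exp_pos 1).le
        have a := abs_le.mp (hK σ 0 hσ)
        have b := abs_le.mp (hK (2 * σ) 0 (by positivity))
        have c := negLogPlus_sub_le hσ (by linarith : σ ≤ 2 * σ)
        rw [mul_div_assoc, div_self hσ.ne', mul_one] at c
        simp only [abs_zero, add_zero] at a b
        linarith [a.2, b.1]

theorem exists_sum_primesUpTo_div_le :
    ∃ K : ℝ, 0 ≤ K ∧ ∀ (R : ℝ) (F G : ℕ → ℝ) (B B' : ℝ), 2 ≤ R → 0 ≤ B' →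
      (∀ p : ℕ, p.Prime → 0 ≤ G p) → (∀ p : ℕ, p.Prime → G p ≤ B) →
      (∀ p : ℕ, p.Prime → F p ≤ G p + B' * (1 - (p : ℝ) ^ (-(1 / Real.log R)))) →
      ∑ p ∈ primesUpTo R, F p / p
        ≤ ∑' p : Nat.Primes, (p : ℝ) ^ (-1 - 1 / Real.log R) * G p + (B + B') * K := by
  obtain ⟨K, hK0, hK⟩ := exists_sum_primesUpTo_one_sub_le
  refine ⟨K, hK0, fun R F G B B' hR hB' hG0 hGB hF => ?_⟩
  have hlog : 0 < Real.log R := Real.log_pos (by linarith)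
  set σ := 1 / Real.log R with hσdef
  have hσ : 0 < σ := by positivity
  have hB : 0 ≤ B := (hG0 2 Nat.prime_two).trans (hGB 2 Nat.prime_two)
  have hs : Summable fun p : Nat.Primes => (p : ℝ) ^ (-1 - σ) * G p :=
    summable_primes_weight_mul hσ (f := fun p => G p) (B := B) fun p => by
      rw [abs_of_nonneg (hG0 p p.2)]
      exact hGB p p.2
  have h4 := sum_primesUpTo_le_tsum (f := fun p => (p : ℝ) ^ (-1 - σ) * G p)
    (fun p hp => mul_nonneg (by positivity) (hG0 p hp)) hs R
  have h5 : ∑ p ∈ primesUpTo R, F p / p ≤ ∑ p ∈ primesUpTo R, ((p : ℝ) ^ (-1 - σ) * G p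
      + (B + B') * ((1 - (p : ℝ) ^ (-σ)) / p)) := by
    refine sum_le_sum fun p hp => ?_
    obtain ⟨hp, hpR⟩ := (mem_primesUpTo (by linarith)).mp hp
    have hp0 : (0 : ℝ) < p := by exact_mod_cast hp.pos
    have hp1 : (1 : ℝ) ≤ p := by exact_mod_cast hp.one_lt.le
    have e1 : (p : ℝ) ^ (-1 - σ) = (p : ℝ) ^ (-σ) / p := by
      rw [show -1 - σ = -σ - 1 by ring, Real.rpow_sub_one hp0.ne']
    have e3 : (p : ℝ) ^ (-σ) ≤ 1 := Real.rpow_le_one_of_one_le_of_nonpos hp1 (by linarith)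
    rw [e1, div_mul_eq_mul_div, mul_div_assoc', ← add_div]
    refine div_le_div_of_nonneg_right ?_ hp0.le
    have a := hF p hp
    have b := mul_le_mul_of_nonneg_right (hGB p hp) (by linarith : 0 ≤ 1 - (p : ℝ) ^ (-σ))
    linarith
  rw [sum_add_distrib, ← mul_sum] at h5
  have h6 := mul_le_mul_of_nonneg_left (hK R hR) (by positivity : 0 ≤ B + B')
  linarith

lemma exists_sum_primesUpTo_inv_le :
    ∃ K : ℝ, 0 ≤ K ∧ ∀ R : ℝ, 2 ≤ R →
      ∑ p ∈ primesUpTo R, 1 / (p : ℝ) ≤ Real.log (Real.log R) + K := by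
  obtain ⟨K, hK0, hK⟩ := exists_primeCosSum_bound one_pos
  obtain ⟨K', hK0', hK'⟩ := exists_sum_primesUpTo_div_le
  refine ⟨1 * Real.log 2 + K + K' + |Real.log (Real.log 2)|, by positivity, fun R hR => ?_⟩
  have hlog : 0 < Real.log R := Real.log_pos (by linarith)
  have hσ : 0 < 1 / Real.log R := by positivity
  have h := hK' R (fun _ => 1) (fun _ => 1) 1 0 hR le_rfl (by simp) (by simp) (by simp)
  have e := (hasSum_primeCosSum hσ 0).tsum_eq
  simp only [zero_mul, Real.cos_zero] at e
  rw [e] at h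
  have a := abs_le.mp (hK _ 0 hσ)
  simp only [abs_zero, add_zero] at a
  have b : negLogPlus (1 / Real.log R) ≤ Real.log (Real.log R) + |Real.log (Real.log 2)| := by
    have c : Real.log (Real.log 2) ≤ Real.log (Real.log R) :=
      Real.log_le_log (Real.log_pos (by norm_num)) (Real.log_le_log (by norm_num) hR)
    have d := neg_abs_le (Real.log (Real.log 2))
    have d' := abs_nonneg (Real.log (Real.log 2))
    rw [negLogPlus, one_div, Real.log_inv, neg_neg]
    exact max_le (by linarith) (by linarith)
  linarith [a.2]

/-- The multiplicative function of `n` taking the value `w p e` at a prime power `p ^ e`. -/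
noncomputable def multExt (w : ℕ → ℕ → ℝ) (n : ℕ) : ℝ := n.factorization.prod w

section multExt
variable {w : ℕ → ℕ → ℝ}

lemma multExt_nonneg (hw : ∀ p e, 0 ≤ w p e) (n : ℕ) : 0 ≤ multExt w n :=
  Finset.prod_nonneg (s := n.factorization.support) (f := fun p => w p (n.factorization p))
    fun _ _ => hw _ _

lemma multExt_one : multExt w 1 = 1 := by simp [multExt]

lemma multExt_mul {m n : ℕ} (h : Nat.Coprime m n) :
    multExt w (m * n) = multExt w m * multExt w n := by
  rw [multExt, Nat.factorization_mul_of_coprime h, Finsupp.prod_add_index_of_disjoint]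
  · rfl
  · simpa using h.disjoint_primeFactors

lemma multExt_prime_pow (hw : ∀ p, w p 0 = 1) {p : ℕ} (hp : p.Prime) (e : ℕ) :
    multExt w (p ^ e) = w p e := by
  rw [multExt, hp.factorization_pow, Finsupp.prod_single_index (hw p)]

lemma multExt_prime_pow_mul_le (hw0 : ∀ p e, 0 ≤ w p e) (hw : ∀ p, w p 0 = 1) {p e : ℕ} {c : ℝ}
    (hp : p.Prime) (hc : ∀ f, w p (e + f) ≤ c * w p f) {m : ℕ} (hm : m ≠ 0) :
    multExt w (p ^ e * m) ≤ c * multExt w m := by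
  obtain ⟨f, m', hpm, rfl⟩ := Nat.exists_eq_pow_mul_and_not_dvd hm p hp.ne_one
  have hcop : ∀ a, Nat.Coprime (p ^ a) m' := fun a =>
    Nat.Coprime.pow_left _ ((Nat.Prime.coprime_iff_not_dvd hp).mpr hpm)
  rw [← mul_assoc, ← pow_add, multExt_mul (hcop _), multExt_mul (hcop _),
    multExt_prime_pow hw hp, multExt_prime_pow hw hp, ← mul_assoc]
  exact mul_le_mul_of_nonneg_right (hc f) (multExt_nonneg hw0 _)

lemma sum_multExt_le_exp (hw0 : ∀ p e, 0 ≤ w p e) (hw : ∀ p, w p 0 = 1) {x : ℝ}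
    (hs : ∀ p : ℕ, p.Prime → Summable (w p)) {a : ℕ → ℝ}
    (ha : ∀ p ∈ primesUpTo x, ∑' e, w p e ≤ Real.exp (a p)) :
    ∑ n ∈ Icc 1 ⌊x⌋₊, multExt w n ≤ Real.exp (∑ p ∈ primesUpTo x, a p) := by
  have key := EulerProduct.summable_and_hasSum_smoothNumbers_prod_primesBelow_tsum
    (f := multExt w) multExt_one (fun h => multExt_mul h)
    (fun {p} hp => by
      refine (hs p hp).congr fun e => ?_
      rw [multExt_prime_pow hw hp, Real.norm_of_nonneg (hw0 _ _)]) (⌊x⌋₊ + 1)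
  have hprod : ∏ p ∈ (⌊x⌋₊ + 1).primesBelow, ∑' e, multExt w (p ^ e) ≤
      Real.exp (∑ p ∈ primesUpTo x, a p) := by
    rw [Real.exp_sum]
    refine (Finset.prod_le_prod (fun p _ => tsum_nonneg fun e => multExt_nonneg hw0 _) ?_)
    intro p hp
    have hpp : p.Prime := Nat.prime_of_mem_primesBelow hp
    simp_rw [multExt_prime_pow hw hpp]
    exact ha p hp
  refine le_trans ?_ (key.2.tsum_eq.le.trans hprod)
  have hmem : ∀ n ∈ Icc 1 ⌊x⌋₊, n ∈ (⌊x⌋₊ + 1).smoothNumbers := by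
    intro n hn
    rw [mem_Icc] at hn
    exact Nat.mem_smoothNumbers_of_lt (by omega) (by omega)
  have h := key.2.summable.sum_le_tsum ((Icc 1 ⌊x⌋₊).subtype (· ∈ (⌊x⌋₊ + 1).smoothNumbers))
    (fun p _ => multExt_nonneg hw0 _)
  refine le_trans (le_of_eq ?_) h
  exact (Finset.sum_subtype_of_mem (multExt w) hmem).symm

end multExt

lemma exists_sum_primesUpTo_inv_sq_le :
    ∃ K : ℝ, 0 ≤ K ∧ ∀ R : ℝ, ∑ p ∈ primesUpTo R, 1 / (p : ℝ) ^ 2 ≤ K := by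
  refine ⟨∑' n : ℕ, 1 / (n : ℝ) ^ 2, by positivity, fun R => ?_⟩
  exact (Real.summable_one_div_nat_pow.mpr one_lt_two).sum_le_tsum _ fun _ _ => by positivity

lemma tsum_geometric_ite {c r : ℝ} (hr0 : 0 ≤ r) (hr : r < 1) :
    HasSum (fun e : ℕ => (if e = 0 then 1 else c) * r ^ e) (1 + c * (r / (1 - r))) := by
  have h := (hasSum_geometric_of_lt_one hr0 hr).mul_left c
  have h2 := (hasSum_ite_eq 0 (1 - c)).add h
  convert! h2 using 1
  · ext e
    by_cases he : e = 0 <;> simp [he]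
  · have : 1 - r ≠ 0 := by linarith
    field_simp
    ring

lemma exists_le_sum_primesUpTo_inv :
    ∃ K : ℝ, 0 ≤ K ∧ ∀ R : ℝ, 2 ≤ R →
      Real.log (Real.log R) - K ≤ ∑ p ∈ primesUpTo R, 1 / (p : ℝ) := by
  obtain ⟨K, hK0, hK⟩ := exists_sum_primesUpTo_inv_sq_le
  refine ⟨2 * K, by positivity, fun R hR => ?_⟩
  have hlog : 0 < Real.log R := Real.log_pos (by linarith)
  have hs : ∀ p : ℕ, p.Prime → HasSum (fun e : ℕ => ((p : ℝ)⁻¹) ^ e) (1 - (p : ℝ)⁻¹)⁻¹ := by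
    intro p hp
    have : (2 : ℝ) ≤ p := by exact_mod_cast hp.two_le
    exact hasSum_geometric_of_lt_one (by positivity) (inv_lt_one_of_one_lt₀ (by linarith))
  have h := sum_multExt_le_exp (w := fun p e => ((p : ℝ)⁻¹) ^ e) (fun p e => by positivity)
    (fun p => by simp) (x := R) (fun p hp => (hs p hp).summable)
    (a := fun p => 1 / (p : ℝ) + 2 * (1 / (p : ℝ) ^ 2)) (fun p hp => by
      obtain ⟨hp, -⟩ := (mem_primesUpTo (by linarith)).mp hp
      have h2 : (2 : ℝ) ≤ p := by exact_mod_cast hp.two_le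
      rw [(hs p hp).tsum_eq]
      refine le_trans ?_ (Real.add_one_le_exp _)
      rw [inv_le_iff_one_le_mul₀ (sub_pos.mpr (inv_lt_one_of_one_lt₀ (by linarith)))]
      have e1 : 0 ≤ (1 : ℝ) / p := by positivity
      have e2 : (1 : ℝ) / p ≤ 1 / 2 := one_div_le_one_div_of_le (by norm_num) h2
      have e3 : 1 / (p : ℝ) ^ 2 = (1 / p) ^ 2 := by rw [div_pow, one_pow]
      rw [e3, ← one_div]
      nlinarith [mul_nonneg (sq_nonneg ((1 : ℝ) / p)) (sub_nonneg.mpr e2)])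
  have hval : ∀ n ∈ Icc 1 ⌊R⌋₊, multExt (fun p e => ((p : ℝ)⁻¹) ^ e) n = (n : ℝ)⁻¹ := by
    intro n hn
    rw [mem_Icc] at hn
    have hn0 : n ≠ 0 := by omega
    conv_rhs => rw [← Nat.prod_factorization_pow_eq_self hn0]
    simp [multExt, Finsupp.prod, Finset.prod_inv_distrib]
  rw [Finset.sum_congr rfl hval] at h
  have hh := log_le_harmonic_floor R (by linarith)
  have hh2 : ((harmonic ⌊R⌋₊ : ℚ) : ℝ) = ∑ n ∈ Icc 1 ⌊R⌋₊, (n : ℝ)⁻¹ := by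
    rw [harmonic_eq_sum_Icc]
    push_cast
    rfl
  rw [hh2] at hh
  have h3 := Real.log_le_log hlog (hh.trans h)
  rw [Real.log_exp, sum_add_distrib, ← mul_sum] at h3
  linarith [hK R]

lemma exists_sum_vonMangoldt_weight_le :
    ∃ C : ℝ, 0 ≤ C ∧ ∀ y : ℝ, 0 ≤ y →
      ∑ q ∈ Ioc 0 ⌊y⌋₊, (if q.Prime then 2 else (q : ℝ) ^ (1 / 4 : ℝ)) *
        ArithmeticFunction.vonMangoldt q ≤ C * y := by
  obtain ⟨C, hC⟩ := Chebyshev.psi_sub_theta_le_mul_sqrt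
  refine ⟨2 * Real.log 4 + |C|, by positivity, fun y hy => ?_⟩
  rcases lt_or_ge y 1 with hy1 | hy1
  · rw [Nat.floor_eq_zero.mpr hy1]
    simp only [Ioc_self, sum_empty]
    positivity
  have h1 := Chebyshev.theta_le_log4_mul_x hy
  have h2 := hC y
  rw [Chebyshev.psi_sub_theta_eq_sum_not_prime] at h2
  rw [Chebyshev.theta] at h1
  rw [← sum_filter_add_sum_filter_not (Ioc 0 ⌊y⌋₊) Nat.Prime]
  have h3 : ∑ q ∈ Ioc 0 ⌊y⌋₊ with q.Prime, (if q.Prime then 2 else (q : ℝ) ^ (1 / 4 : ℝ)) *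
      ArithmeticFunction.vonMangoldt q = 2 * ∑ q ∈ Ioc 0 ⌊y⌋₊ with q.Prime, Real.log q := by
    rw [mul_sum]
    refine sum_congr rfl fun q hq => ?_
    have := (mem_filter.mp hq).2
    rw [if_pos this, ArithmeticFunction.vonMangoldt_apply_prime this]
  have h4 : ∑ q ∈ Ioc 0 ⌊y⌋₊ with ¬ q.Prime, (if q.Prime then 2 else (q : ℝ) ^ (1 / 4 : ℝ)) *
      ArithmeticFunction.vonMangoldt q ≤
      √y * ∑ q ∈ Ioc 0 ⌊y⌋₊ with ¬ q.Prime, ArithmeticFunction.vonMangoldt q := by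
    rw [mul_sum]
    refine sum_le_sum fun q hq => ?_
    obtain ⟨hq1, hq2⟩ := mem_filter.mp hq
    rw [if_neg hq2]
    refine mul_le_mul_of_nonneg_right ?_ ArithmeticFunction.vonMangoldt_nonneg
    have hqy : (q : ℝ) ≤ y := (Nat.le_floor_iff hy).mp (mem_Ioc.mp hq1).2
    calc (q : ℝ) ^ (1 / 4 : ℝ) ≤ y ^ (1 / 4 : ℝ) := by gcongr
      _ ≤ y ^ (1 / 2 : ℝ) := Real.rpow_le_rpow_of_exponent_le hy1 (by norm_num)
      _ = √y := (Real.sqrt_eq_rpow y).symm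
  have h5 : √y * (∑ q ∈ Ioc 0 ⌊y⌋₊ with ¬ q.Prime, ArithmeticFunction.vonMangoldt q) ≤
      √y * (|C| * √y) := by
    refine mul_le_mul_of_nonneg_left (h2.trans ?_) (Real.sqrt_nonneg _)
    exact mul_le_mul_of_nonneg_right (le_abs_self C) (Real.sqrt_nonneg _)
  have h6 : √y * (|C| * √y) = |C| * y := by
    rw [mul_left_comm, Real.mul_self_sqrt hy]
  rw [h3]
  linarith

lemma exists_sum_multExt_mul_log_le :
    ∃ C : ℝ, 0 ≤ C ∧ ∀ (w : ℕ → ℕ → ℝ) (B l : ℝ), (∀ p e, 0 ≤ w p e) → (∀ p, w p 0 = 1) →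
      0 ≤ B → 1 ≤ l → l ^ 4 ≤ 2 → (∀ p e f, w p (e + f) ≤ B * l ^ e * w p f) →
      ∀ x : ℝ, 1 ≤ x → (∑ n ∈ Icc 1 ⌊x⌋₊, multExt w n) * Real.log x ≤
        (C * B + 1) * x * ∑ n ∈ Icc 1 ⌊x⌋₊, multExt w n / n := by
  obtain ⟨C, hC0, hC⟩ := exists_sum_vonMangoldt_weight_le
  refine ⟨C, hC0, fun w B l hw0 hw hB hl1 hl hmul x hx => ?_⟩
  have hx0 : 0 < x := by linarith
  have hIcc : Icc 1 ⌊x⌋₊ = Ioc 0 ⌊x⌋₊ := by ext; simp [Nat.succ_le_iff]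
  rw [hIcc]
  set N := ⌊x⌋₊ with hN
  let c : ℕ → ℝ := fun q => if q.Prime then 2 else (q : ℝ) ^ (1 / 4 : ℝ)
  let g : ArithmeticFunction ℝ := ⟨fun n => if n = 0 then 0 else multExt w n, by simp⟩
  let h : ArithmeticFunction ℝ := ⟨fun q => c q * ArithmeticFunction.vonMangoldt q, by simp⟩
  have hg : ∀ n : ℕ, n ≠ 0 → g n = multExt w n := fun n hn => if_neg hn
  have hl2 : l ≤ 2 := by nlinarith [pow_le_pow_right₀ hl1 (show 1 ≤ 4 by norm_num)]
  have hlp : l ≤ 2 ^ (1 / 4 : ℝ) := by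
    rw [Real.le_rpow_iff_log_le (by linarith) (by norm_num)]
    have := Real.log_le_log (by positivity) hl
    rw [Real.log_pow] at this
    push_cast at this
    linarith
  have hpp : ∀ q m : ℕ, m ≠ 0 → ArithmeticFunction.vonMangoldt q * multExt w (q * m) ≤
      B * (h q * g m) := by
    intro q m hm
    rw [hg m hm]
    change _ ≤ B * (c q * ArithmeticFunction.vonMangoldt q * multExt w m)
    by_cases hq : IsPrimePow q
    · obtain ⟨p, e, hp, he, rfl⟩ := (isPrimePow_nat_iff q).mp hq
      have h1 := multExt_prime_pow_mul_le hw0 hw hp (hmul p e) hm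
      have h2 : l ^ e ≤ c (p ^ e) := by
        simp only [c]
        split_ifs with hpr
        · have : e = 1 := (Nat.Prime.eq_one_of_pow hpr)
          rw [this, pow_one]
          exact hl2
        · calc l ^ e ≤ ((2 : ℝ) ^ (1 / 4 : ℝ)) ^ e := by gcongr
            _ ≤ ((p : ℝ) ^ (1 / 4 : ℝ)) ^ e := by
                have : (2 : ℝ) ≤ p := by exact_mod_cast hp.two_le
                gcongr
            _ = ((p ^ e : ℕ) : ℝ) ^ (1 / 4 : ℝ) := by
                push_cast
                rw [← Real.rpow_natCast, ← Real.rpow_mul (by positivity), mul_comm,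
                  Real.rpow_mul (by positivity), Real.rpow_natCast]
      calc _ ≤ ArithmeticFunction.vonMangoldt (p ^ e) * (B * c (p ^ e) * multExt w m) := by
            refine mul_le_mul_of_nonneg_left (h1.trans ?_) ArithmeticFunction.vonMangoldt_nonneg
            have := multExt_nonneg hw0 m
            gcongr
        _ = _ := by ring
    · rw [ArithmeticFunction.vonMangoldt_eq_zero_iff.mpr hq]
      simp
  have hlog : ∀ n ∈ Ioc 0 N, multExt w n * Real.log n ≤ B * (h * g) n := by
    intro n hn
    have hn0 : n ≠ 0 := by have := (mem_Ioc.mp hn).1; omega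
    rw [← ArithmeticFunction.vonMangoldt_sum, ArithmeticFunction.mul_apply,
      ← Nat.sum_divisorsAntidiagonal (fun i _ => ArithmeticFunction.vonMangoldt i),
      mul_sum, mul_sum]
    refine sum_le_sum fun i hi => ?_
    obtain ⟨h1, h2⟩ := Nat.mem_divisorsAntidiagonal.mp hi
    have := hpp i.1 i.2 (by rintro h0; rw [h0, mul_zero] at h1; omega)
    rw [h1] at this
    linarith
  have hfirst : ∑ n ∈ Ioc 0 N, multExt w n * Real.log n ≤
      C * B * x * ∑ n ∈ Ioc 0 N, multExt w n / n := by
    calc _ ≤ ∑ n ∈ Ioc 0 N, B * (g * h) n := by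
          refine (sum_le_sum hlog).trans (le_of_eq ?_)
          rw [mul_comm h g]
      _ = B * ∑ n ∈ Ioc 0 N, g n * ∑ m ∈ Ioc 0 (N / n), h m := by
          rw [← mul_sum, ArithmeticFunction.sum_Ioc_mul_eq_sum_sum]
      _ ≤ B * ∑ n ∈ Ioc 0 N, multExt w n * (C * (x / n)) := by
          refine mul_le_mul_of_nonneg_left (sum_le_sum fun n hn => ?_) hB
          have hn0 : n ≠ 0 := by have := (mem_Ioc.mp hn).1; omega
          rw [hg n hn0]
          refine mul_le_mul_of_nonneg_left ?_ (multExt_nonneg hw0 n)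
          have := hC (x / n) (by positivity)
          rwa [Nat.floor_div_natCast] at this
      _ = _ := by
          rw [mul_sum, mul_sum]
          refine sum_congr rfl fun n hn => ?_
          ring
  have hsecond : ∀ n ∈ Ioc 0 N, multExt w n * Real.log x ≤
      multExt w n * Real.log n + x * (multExt w n / n) := by
    intro n hn
    have hn0 : (0 : ℝ) < n := by exact_mod_cast (mem_Ioc.mp hn).1
    have h1 : Real.log x = Real.log n + Real.log (x / n) := by
      rw [Real.log_div hx0.ne' hn0.ne']
      ring
    have h2 : Real.log (x / n) ≤ x / n := (Real.log_le_sub_one_of_pos (by positivity)).trans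
      (by linarith)
    calc _ ≤ multExt w n * (Real.log n + x / n) := by
          rw [h1]
          have := multExt_nonneg hw0 n
          gcongr
      _ = _ := by ring
  calc _ = ∑ n ∈ Ioc 0 N, multExt w n * Real.log x := by rw [sum_mul]
    _ ≤ ∑ n ∈ Ioc 0 N, multExt w n * Real.log n + ∑ n ∈ Ioc 0 N, x * (multExt w n / n) := by
        rw [← sum_add_distrib]
        exact sum_le_sum hsecond
    _ ≤ _ := by
        rw [← mul_sum]
        linarith

/-- Weighted moments of a multiplicative function supported on its behaviour at primes up to `R`. -/
noncomputable def rankinWeight (R l : ℝ) (G : ℕ → ℝ) (p e : ℕ) : ℝ :=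
  if e = 0 then 1 else if (p : ℝ) ≤ R then l ^ e * G p else 1

lemma multExt_rankinWeight (R l : ℝ) (G : ℕ → ℝ) (n : ℕ) :
    multExt (rankinWeight R l G) n =
      l ^ bigOmega n R * ∏ p ∈ n.primeFactors.filter (fun p : ℕ => (p : ℝ) ≤ R), G p := by
  rw [bigOmega, ← Finset.prod_pow_eq_pow_sum, ← Finset.prod_mul_distrib, Finset.prod_filter]
  change ∏ p ∈ n.primeFactors, rankinWeight R l G p (n.factorization p) = _
  refine Finset.prod_congr rfl fun p hp => ?_
  have : n.factorization p ≠ 0 := Finsupp.mem_support_iff.mp hp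
  simp [rankinWeight, this]

lemma exists_sum_rankin_le (B l : ℝ) (hB : 1 ≤ B) (hl1 : 1 ≤ l) (hl : l ^ 4 ≤ 2) :
    ∃ K : ℝ, 0 ≤ K ∧ ∀ (x R : ℝ) (G : ℕ → ℝ), 2 ≤ R → R ≤ x → (∀ p, 0 ≤ G p) → (∀ p, G p ≤ B) →
      ∑ n ∈ Icc 1 ⌊x⌋₊, l ^ bigOmega n R *
          ∏ p ∈ n.primeFactors.filter (fun p : ℕ => (p : ℝ) ≤ R), G p ≤
        K * (x / Real.log R) * Real.exp (l * ∑ p ∈ primesUpTo R, G p / p) := by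
  obtain ⟨C, hC0, hC⟩ := exists_sum_multExt_mul_log_le
  obtain ⟨K0, hK0, hsq⟩ := exists_sum_primesUpTo_inv_sq_le
  obtain ⟨K1, hK1, hup⟩ := exists_sum_primesUpTo_inv_le
  obtain ⟨K2, hK2, hlow⟩ := exists_le_sum_primesUpTo_inv
  refine ⟨(C * B + 1) * Real.exp (4 * B * K0 + K1 + K2), by positivity,
    fun x R G hR hRx hG0 hGB => ?_⟩
  simp_rw [← multExt_rankinWeight]
  set w := rankinWeight R l G with hwdef
  have hl2 : l ≤ 6 / 5 := by
    by_contra hcon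
    push Not at hcon
    have := pow_le_pow_left₀ (by norm_num) hcon.le 4
    norm_num at this
    linarith
  have hw0 : ∀ p e, 0 ≤ w p e := by
    intro p e
    simp only [hwdef, rankinWeight]
    have := hG0 p
    split_ifs <;> positivity
  have hw : ∀ p, w p 0 = 1 := fun p => by simp [hwdef, rankinWeight]
  have hmul : ∀ p e f, w p (e + f) ≤ B * l ^ e * w p f := by
    intro p e f
    have hle : 1 ≤ l ^ e := one_le_pow₀ hl1
    have hBl : 1 ≤ B * l ^ e := one_le_mul_of_one_le_of_one_le hB hle
    have := hG0 p
    have := hGB p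
    simp only [hwdef, rankinWeight]
    rcases Nat.eq_zero_or_pos f with hf | hf
    · rcases Nat.eq_zero_or_pos e with he | he
      · simpa [he, hf] using hB
      · rw [hf, add_zero, if_neg he.ne', if_pos rfl, mul_one]
        split_ifs
        · nlinarith
        · exact hBl
    · rw [if_neg (by omega : e + f ≠ 0), if_neg hf.ne']
      split_ifs
      · rw [pow_add, mul_assoc, mul_assoc]
        exact le_mul_of_one_le_left (by positivity) hB
      · linarith
  have hlogx : 0 < Real.log x := Real.log_pos (by linarith)
  have hlogR : 0 < Real.log R := Real.log_pos (by linarith)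
  have h1 := hC w B l hw0 hw (by linarith) hl1 hl hmul x (by linarith)
  let v : ℕ → ℕ → ℝ := fun p e => w p e * ((p : ℝ)⁻¹) ^ e
  have hv : ∀ n ∈ Icc 1 ⌊x⌋₊, multExt w n / n = multExt v n := by
    intro n hn
    have hn0 : n ≠ 0 := by have := (mem_Icc.mp hn).1; omega
    have hn1 : (n : ℝ) = ∏ p ∈ n.factorization.support, (p : ℝ) ^ n.factorization p := by
      conv_lhs => rw [← Nat.prod_factorization_pow_eq_self hn0]
      simp [Finsupp.prod]
    rw [hn1]
    simp only [multExt, Finsupp.prod, v, Finset.prod_mul_distrib, Finset.prod_inv_distrib,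
      inv_pow, div_eq_mul_inv]
  have hvs : ∀ p : ℕ, p.Prime → HasSum (v p) (1 + (if (p : ℝ) ≤ R then G p else 1) *
      (((if (p : ℝ) ≤ R then l else 1) / p) / (1 - (if (p : ℝ) ≤ R then l else 1) / p))) := by
    intro p hp
    have h2 : (2 : ℝ) ≤ p := by exact_mod_cast hp.two_le
    convert! tsum_geometric_ite (c := if (p : ℝ) ≤ R then G p else 1)
      (r := (if (p : ℝ) ≤ R then l else 1) / p) (by split_ifs <;> positivity)
      ((div_lt_one (by linarith)).mpr (by split_ifs <;> linarith)) using 1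
    ext e
    simp only [v, hwdef, rankinWeight]
    by_cases he : e = 0
    · simp [he]
    · simp only [he, if_false]
      split_ifs
      · rw [div_eq_mul_inv, mul_pow]
        ring
      · simp
  set a : ℕ → ℝ := fun p => (if (p : ℝ) ≤ R then l * (G p / p) else 1 / (p : ℝ)) +
    4 * B * (1 / (p : ℝ) ^ 2) with hadef
  have h2 := sum_multExt_le_exp (w := v) (fun p e => mul_nonneg (hw0 p e) (by positivity))
    (fun p => by simp [v, hw]) (x := x) (fun p hp => (hvs p hp).summable)
    (a := a) (fun p hp => by
      obtain ⟨hp, -⟩ := (mem_primesUpTo (by linarith)).mp hp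
      have h2 : (2 : ℝ) ≤ p := by exact_mod_cast hp.two_le
      rw [(hvs p hp).tsum_eq]
      refine le_trans ?_ (Real.add_one_le_exp _)
      rw [add_comm, add_le_add_iff_right]
      have gen : ∀ L H : ℝ, 1 ≤ L → L ≤ 6 / 5 → 0 ≤ H → H ≤ B →
          H * ((L / p) / (1 - L / p)) ≤ L * (H / p) + 4 * B * (1 / (p : ℝ) ^ 2) := by
        intro L H hL1 hL2 hH0 hH
        have hpL : 2 / 5 * (p : ℝ) ≤ p - L := by linarith
        have e1 : (L / p) / (1 - L / p) = L / p + L ^ 2 / (p * (p - L)) := by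
          have : (p : ℝ) - L ≠ 0 := by linarith
          field_simp
          ring
        have e2 : L ^ 2 / (p * (p - L)) ≤ 4 * (1 / (p : ℝ) ^ 2) := by
          rw [mul_one_div, div_le_div_iff₀ (by nlinarith) (by positivity)]
          have : L ^ 2 ≤ 8 / 5 := by nlinarith
          have : L ^ 2 * (p : ℝ) ^ 2 ≤ 8 / 5 * (p : ℝ) ^ 2 := by gcongr
          nlinarith
        have e3 : 0 ≤ L ^ 2 / (p * (p - L)) := by
          have : 0 ≤ p * (p - L) := by nlinarith
          positivity
        rw [e1, mul_add]
        have : H * (L ^ 2 / (p * (p - L))) ≤ B * (4 * (1 / (p : ℝ) ^ 2)) :=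
          mul_le_mul hH e2 e3 (by linarith)
        have e4 : H * (L / p) = L * (H / p) := by ring
        linarith
      simp only [hadef]
      split_ifs with hpR
      · exact gen l (G p) hl1 hl2 (hG0 p) (hGB p)
      · have := gen 1 1 le_rfl (by norm_num) (by norm_num) hB
        simpa using this)
  have hsub : primesUpTo R = (primesUpTo x).filter (fun p : ℕ => (p : ℝ) ≤ R) := by
    ext p
    rw [mem_filter, mem_primesUpTo (by linarith), mem_primesUpTo (by linarith)]
    constructor
    · rintro ⟨hp, hpR⟩
      exact ⟨⟨hp, hpR.trans hRx⟩, hpR⟩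
    · rintro ⟨⟨hp, -⟩, hpR⟩
      exact ⟨hp, hpR⟩
  have h3 : ∑ p ∈ primesUpTo x, a p ≤ l * ∑ p ∈ primesUpTo R, G p / p +
      (Real.log (Real.log x) - Real.log (Real.log R)) + (4 * B * K0 + K1 + K2) := by
    have hx1 := hup x (by linarith)
    have hR1 := hlow R hR
    have hs1 := mul_le_mul_of_nonneg_left (hsq x) (show 0 ≤ 4 * B by linarith)
    have e1 := sum_filter_add_sum_filter_not (primesUpTo x) (fun p : ℕ => (p : ℝ) ≤ R)
      (fun p => 1 / (p : ℝ))
    rw [← hsub] at e1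
    simp only [hadef]
    rw [sum_add_distrib, ← mul_sum, sum_ite, ← hsub, ← mul_sum]
    linarith
  rw [← sum_congr rfl hv] at h2
  have h4 : ∑ n ∈ Icc 1 ⌊x⌋₊, multExt w n / n ≤
      Real.exp (l * ∑ p ∈ primesUpTo R, G p / p) * (Real.log x / Real.log R) *
        Real.exp (4 * B * K0 + K1 + K2) := by
    refine (h2.trans (Real.exp_le_exp.mpr h3)).trans (le_of_eq ?_)
    rw [Real.exp_add, Real.exp_add, Real.exp_sub, Real.exp_log hlogx, Real.exp_log hlogR]
  have h5 : (∑ n ∈ Icc 1 ⌊x⌋₊, multExt w n) * Real.log x ≤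
      ((C * B + 1) * Real.exp (4 * B * K0 + K1 + K2) * (x / Real.log R) *
        Real.exp (l * ∑ p ∈ primesUpTo R, G p / p)) * Real.log x := by
    refine h1.trans ((mul_le_mul_of_nonneg_left h4 ?_).trans (le_of_eq (by ring)))
    have : 0 ≤ x := by linarith
    positivity
  exact le_of_mul_le_mul_right h5 hlogx

open MeasureTheory Filter Topology in
lemma integrableOn_pow_mul_cexp (A : ℕ) (u : ℝ) :
    IntegrableOn (fun y : ℝ => ((y : ℂ)) ^ A * Complex.exp (-((1 + u * Complex.I) * y)))
      (Set.Ioi 0) := by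
  have h := Real.GammaIntegral_convergent (s := (A : ℝ) + 1) (by positivity)
  refine Integrable.mono' (g := fun y : ℝ => Real.exp (-y) * y ^ ((A : ℝ) + 1 - 1)) h
    (by fun_prop) ?_
  refine (ae_restrict_iff' measurableSet_Ioi).mpr (ae_of_all _ fun y hy => ?_)
  have hy0 : (0 : ℝ) < y := hy
  rw [norm_mul, norm_pow, Complex.norm_real, Complex.norm_exp, Real.norm_of_nonneg hy0.le,
    add_sub_cancel_right, Real.rpow_natCast, mul_comm]
  simp

open MeasureTheory Filter Topology in
lemma integral_pow_mul_cexp (A : ℕ) (u : ℝ) :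
    ∫ y : ℝ in Set.Ioi 0, ((y : ℂ)) ^ A * Complex.exp (-((1 + u * Complex.I) * y)) =
      (A.factorial : ℂ) / (1 + u * Complex.I) ^ (A + 1) := by
  set r : ℂ := 1 + u * Complex.I with hr
  have hr0 : r ≠ 0 := by
    intro h
    have := congrArg Complex.re h
    simp [hr] at this
  have hexp : ∀ y : ℝ, HasDerivAt (fun y : ℝ => Complex.exp (-(r * y)))
      (Complex.exp (-(r * y)) * (-r)) y := by
    intro y
    have h1 : HasDerivAt (fun y : ℝ => -(r * (y : ℂ))) (-(r * 1)) y :=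
      ((Complex.ofRealCLM.hasDerivAt).const_mul r).neg
    simpa using h1.cexp
  have hlim : ∀ A : ℕ, Tendsto (fun y : ℝ => ((y : ℂ)) ^ A * Complex.exp (-(r * y))) atTop
      (𝓝 0) := by
    intro A
    rw [tendsto_zero_iff_norm_tendsto_zero]
    refine (Real.tendsto_pow_mul_exp_neg_atTop_nhds_zero A).congr' ?_
    filter_upwards [eventually_ge_atTop 0] with y hy
    rw [norm_mul, norm_pow, Complex.norm_real, Complex.norm_exp, Real.norm_of_nonneg hy]
    simp [hr]
  induction A with
  | zero =>
    have h := integral_Ioi_of_hasDerivAt_of_tendsto'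
      (f := fun y : ℝ => -(Complex.exp (-(r * y)) / r)) (m := 0) (a := 0)
      (f' := fun y : ℝ => ((y : ℂ)) ^ 0 * Complex.exp (-(r * y))) (fun y _ => by
        have := ((hexp y).div_const r).neg
        convert! this using 1
        field_simp) (integrableOn_pow_mul_cexp 0 u) (by
        have := ((hlim 0).div_const r).neg
        simpa using this)
    rw [h]
    simp
  | succ A ih =>
    have h := integral_Ioi_of_hasDerivAt_of_tendsto'
      (f := fun y : ℝ => -((y : ℂ) ^ (A + 1) * Complex.exp (-(r * y)) / r)) (m := 0) (a := 0)
      (f' := fun y : ℝ => ((y : ℂ)) ^ (A + 1) * Complex.exp (-(r * y)) -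
        ((A + 1 : ℕ) : ℂ) / r * ((y : ℂ) ^ A * Complex.exp (-(r * y)))) (fun y _ => by
        have h2 : HasDerivAt (fun y : ℝ => (y : ℂ) ^ (A + 1))
            (((A + 1 : ℕ) : ℂ) * (y : ℂ) ^ A) y := by
          simpa using (hasDerivAt_pow (A + 1) (y : ℂ)).comp_ofReal
        have := ((h2.mul (hexp y)).div_const r).neg
        convert! this using 1
        field_simp
        ring)
      ((integrableOn_pow_mul_cexp (A + 1) u).sub ((integrableOn_pow_mul_cexp A u).const_mul _)) (by
        have := ((hlim (A + 1)).div_const r).neg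
        simpa using this)
    rw [integral_sub (integrableOn_pow_mul_cexp (A + 1) u)
      ((integrableOn_pow_mul_cexp A u).const_mul _), integral_const_mul, ih] at h
    simp only [Complex.ofReal_zero, ne_eq, Nat.add_eq_zero_iff, one_ne_zero, and_false,
      not_false_eq_true, zero_pow, zero_mul, zero_div, neg_zero, sub_zero] at h
    rw [sub_eq_zero.mp h, Nat.factorial_succ]
    push_cast
    field_simp
    ring

lemma norm_one_add_mul_I_sq (u : ℝ) : ‖(1 + u * Complex.I : ℂ)‖ ^ 2 = 1 + u ^ 2 := by
  rw [Complex.sq_norm, Complex.normSq_apply]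
  simp
  ring

lemma one_add_mul_I_ne_zero (u : ℝ) : (1 + u * Complex.I : ℂ) ≠ 0 := by
  intro h
  have := congrArg Complex.re h
  simp at this

open MeasureTheory in
lemma integrable_inv_one_add_mul_I_pow {A : ℕ} (hA : 1 ≤ A) :
    Integrable fun u : ℝ => ((1 + u * Complex.I : ℂ) ^ (A + 1))⁻¹ := by
  refine Integrable.mono' integrable_inv_one_add_sq ?_ (ae_of_all _ fun u => ?_)
  · refine Continuous.aestronglyMeasurable ?_
    exact Continuous.inv₀ (by fun_prop) fun u => pow_ne_zero _ (one_add_mul_I_ne_zero u)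
  · rw [norm_inv, norm_pow, ← norm_one_add_mul_I_sq]
    have h1 : 1 ≤ ‖(1 + u * Complex.I : ℂ)‖ := by
      have := norm_one_add_mul_I_sq u
      nlinarith [norm_nonneg (1 + u * Complex.I : ℂ), sq_nonneg u]
    gcongr
    omega

open MeasureTheory Filter Topology FourierTransform in
lemma fA_mul_exp_eq_integral {A : ℕ} (hA : 1 ≤ A) (y : ℝ) :
    (((if 0 ≤ y then y ^ A * Real.exp (-y) else 0 : ℝ)) : ℂ) =
      (A.factorial : ℂ) / (2 * Real.pi) *
        ∫ u : ℝ, Complex.exp (u * y * Complex.I) * ((1 + u * Complex.I : ℂ) ^ (A + 1))⁻¹ := by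
  set f : ℝ → ℂ := fun y => (((if 0 ≤ y then y ^ A * Real.exp (-y) else 0 : ℝ)) : ℂ) with hf
  have hfind : f = (Set.Ioi (0 : ℝ)).indicator
      (fun y : ℝ => ((y : ℂ)) ^ A * Complex.exp (-((1 + (0 : ℝ) * Complex.I) * y))) := by
    ext y
    rcases lt_trichotomy y 0 with h | h | h
    · rw [Set.indicator_of_notMem (by simpa using h.le)]
      simp [hf, not_le.mpr h]
    · rw [Set.indicator_of_notMem (by simpa using h.le)]
      have : A ≠ 0 := by omega
      simp [hf, h, this]
    · rw [Set.indicator_of_mem (by simpa using h)]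
      simp [hf, h.le]
  have hInt : Integrable f := by
    rw [hfind, integrable_indicator_iff measurableSet_Ioi]
    exact integrableOn_pow_mul_cexp A 0
  have hcont : Continuous f := by
    have : Continuous fun y : ℝ => if 0 ≤ y then y ^ A * Real.exp (-y) else 0 := by
      refine Continuous.if_le (by fun_prop) continuous_const continuous_const continuous_id ?_
      intro y hy
      have : A ≠ 0 := by omega
      simp [← hy, this]
    exact Complex.continuous_ofReal.comp this
  have hF : 𝓕 f = fun ξ : ℝ =>
      (A.factorial : ℂ) * ((1 + ((2 * Real.pi * ξ : ℝ) : ℂ) * Complex.I : ℂ) ^ (A + 1))⁻¹ := by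
    ext ξ
    rw [Real.fourier_real_eq_integral_exp_smul, ← div_eq_mul_inv, ← integral_pow_mul_cexp,
      ← integral_indicator measurableSet_Ioi]
    congr 1
    ext y
    rw [hfind]
    by_cases hy : y ∈ Set.Ioi (0 : ℝ)
    · rw [Set.indicator_of_mem hy, Set.indicator_of_mem hy, smul_eq_mul, mul_left_comm,
        ← Complex.exp_add]
      congr 2
      push_cast
      ring
    · rw [Set.indicator_of_notMem hy, Set.indicator_of_notMem hy, smul_zero]
  have hFi : Integrable (𝓕 f) := by
    rw [hF]
    exact (((integrable_inv_one_add_mul_I_pow hA).comp_mul_left'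
      (show (2 * Real.pi) ≠ 0 by positivity)).const_mul _)
  have key := hInt.fourierInv_fourier_eq hFi hcont.continuousAt (v := y)
  change f y = _
  rw [← key, Real.fourierInv_eq', hF]
  have hsub := MeasureTheory.Measure.integral_comp_mul_left
    (fun u : ℝ => Complex.exp (u * y * Complex.I) * ((1 + u * Complex.I : ℂ) ^ (A + 1))⁻¹)
    (2 * Real.pi)
  have hpi : |(2 * Real.pi)⁻¹| = (2 * Real.pi)⁻¹ := abs_of_pos (by positivity)
  rw [hpi] at hsub
  have h2 : (A.factorial : ℂ) / (2 * Real.pi) *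
      ∫ u : ℝ, Complex.exp (u * y * Complex.I) * ((1 + u * Complex.I : ℂ) ^ (A + 1))⁻¹ =
      (A.factorial : ℂ) * ((2 * Real.pi : ℝ)⁻¹ •
      ∫ u : ℝ, Complex.exp (u * y * Complex.I) * ((1 + u * Complex.I : ℂ) ^ (A + 1))⁻¹) := by
    rw [Complex.real_smul, div_eq_mul_inv, mul_assoc]
    push_cast
    rfl
  rw [h2, ← hsub, ← integral_const_mul]
  congr 1
  ext ξ
  simp only [smul_eq_mul, RCLike.inner_apply, conj_trivial]
  rw [mul_left_comm]
  congr 3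
  push_cast
  ring

lemma norm_one_sub_natCast_cpow_sq {p : ℕ} (hp : 0 < p) (σ t : ℝ) :
    ‖(1 - (p : ℂ) ^ (-((σ : ℂ) + t * Complex.I)) : ℂ)‖ ^ 2 =
      (1 - (p : ℝ) ^ (-σ)) ^ 2 + (p : ℝ) ^ (-σ) * (2 - 2 * Real.cos (t * Real.log p)) := by
  have hp0 : (0 : ℝ) < p := by exact_mod_cast hp
  have h1 : (p : ℂ) ^ (-((σ : ℂ) + t * Complex.I)) =
      ((p : ℝ) ^ (-σ) : ℝ) * Complex.exp (((-(t * Real.log p) : ℝ) : ℂ) * Complex.I) := by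
    rw [Complex.cpow_def_of_ne_zero (by exact_mod_cast hp.ne'), Real.rpow_def_of_pos hp0,
      Complex.ofReal_exp, ← Complex.exp_add, ← Complex.natCast_log]
    congr 1
    push_cast
    ring
  rw [h1, Complex.sq_norm, Complex.normSq_apply]
  simp only [Complex.sub_re, Complex.one_re, Complex.re_ofReal_mul, Complex.exp_ofReal_mul_I_re,
    Complex.sub_im, Complex.one_im, Complex.im_ofReal_mul, Complex.exp_ofReal_mul_I_im,
    Real.cos_neg, Real.sin_neg]
  linear_combination ((p : ℝ) ^ (-σ)) ^ 2 * Real.sin_sq_add_cos_sq (t * Real.log p)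

/-- The absolute value of `∏ (1 - p ^ (-(1 / log R + i t)))` over the primes `p ≤ R` dividing
`n`. -/
noncomputable def eulerNorm (n : ℕ) (R t : ℝ) : ℝ :=
  ∏ p ∈ n.primeFactors.filter (fun p : ℕ => (p : ℝ) ≤ R),
    ‖(1 - (p : ℂ) ^ (-(((1 / Real.log R : ℝ) : ℂ) + t * Complex.I)) : ℂ)‖

lemma eulerNorm_nonneg (n : ℕ) (R t : ℝ) : 0 ≤ eulerNorm n R t :=
  Finset.prod_nonneg fun _ _ => norm_nonneg _

lemma eulerNorm_neg (n : ℕ) (R t : ℝ) : eulerNorm n R (-t) = eulerNorm n R t := by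
  refine Finset.prod_congr rfl fun p hp => ?_
  have hp0 : 0 < p := Nat.pos_of_mem_primeFactors (mem_filter.mp hp).1
  rw [← sq_eq_sq₀ (norm_nonneg _) (norm_nonneg _), norm_one_sub_natCast_cpow_sq hp0,
    norm_one_sub_natCast_cpow_sq hp0, neg_mul, Real.cos_neg]

lemma continuous_eulerNorm (n : ℕ) (R : ℝ) : Continuous (eulerNorm n R) := by
  refine continuous_finsetProd _ fun p hp => ?_
  have hp0 : 0 < p := Nat.pos_of_mem_primeFactors (mem_filter.mp hp).1
  have hp1 : (p : ℂ) ≠ 0 := by exact_mod_cast hp0.ne'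
  refine Continuous.norm (Continuous.sub continuous_const ?_)
  exact Continuous.const_cpow (by fun_prop) (Or.inl hp1)

lemma Mf_fA_eq_sum_divisors {A n : ℕ} (hn : n ≠ 0) {R : ℝ} (hR : 2 ≤ R) :
    Mf (fA A) n R =
      ∑ d ∈ (∏ p ∈ n.primeFactors.filter (fun p : ℕ => (p : ℝ) ≤ R), p).divisors,
        ((ArithmeticFunction.moebius d : ℤ) : ℝ) * fA A (Real.log d / Real.log R) := by
  set P := ∏ p ∈ n.primeFactors.filter (fun p : ℕ => (p : ℝ) ≤ R), p with hP
  have hPn : P ∣ n := (Finset.prod_dvd_prod_of_subset _ _ _ (filter_subset _ _)).trans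
    (Nat.prod_primeFactors_dvd n)
  have hP0 : P ≠ 0 := fun h => hn (by simpa [h] using hPn)
  have hlogR : 0 < Real.log R := Real.log_pos (by linarith)
  refine (Finset.sum_subset (Nat.divisors_subset_of_dvd hn hPn) fun d hd hdP => ?_).symm
  have hdn : d ∣ n := Nat.dvd_of_mem_divisors hd
  by_cases hsq : Squarefree d
  swap
  · simp [ArithmeticFunction.moebius_eq_zero_of_not_squarefree hsq]
  have hd0 : d ≠ 0 := hsq.ne_zero
  have : ∃ p ∈ d.primeFactors, R < (p : ℝ) := by
    by_contra hcon
    push Not at hcon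
    refine hdP (Nat.mem_divisors.mpr ⟨?_, hP0⟩)
    rw [← Nat.prod_primeFactors_of_squarefree hsq]
    refine Finset.prod_dvd_prod_of_subset _ _ _ fun p hp => mem_filter.mpr ⟨?_, hcon p hp⟩
    exact Nat.primeFactors_mono hdn hn hp
  obtain ⟨p, hp, hpR⟩ := this
  have hpd : (p : ℝ) ≤ d := by
    exact_mod_cast Nat.le_of_dvd (Nat.pos_of_ne_zero hd0) (Nat.dvd_of_mem_primeFactors hp)
  have : 1 < Real.log d / Real.log R := by
    rw [one_lt_div hlogR]
    exact Real.log_lt_log (by linarith) (by linarith)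
  rw [fA, if_neg (not_le.mpr this), mul_zero]

lemma sum_moebius_mul_cexp {s : Finset ℕ} (hs : ∀ p ∈ s, p.Prime) {R : ℝ} (u : ℝ) :
    ∑ d ∈ (∏ p ∈ s, p).divisors, ((ArithmeticFunction.moebius d : ℤ) : ℂ) *
        Complex.exp (((1 - Real.log d / Real.log R : ℝ) : ℂ) * (1 + u * Complex.I)) =
      Complex.exp (1 + u * Complex.I) * ∏ p ∈ s,
        (1 - (p : ℂ) ^ (-(((1 / Real.log R : ℝ) : ℂ) + (1 / Real.log R * u : ℝ) * Complex.I))) := by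
  set z : ℂ := -(((1 / Real.log R : ℝ) : ℂ) + (1 / Real.log R * u : ℝ) * Complex.I) with hz
  let f : ArithmeticFunction ℂ := ⟨fun n => if n = 0 then 0 else (n : ℂ) ^ z, by simp⟩
  have hf : ∀ n : ℕ, n ≠ 0 → f n = (n : ℂ) ^ z := fun n hn => if_neg hn
  have hfm : f.IsMultiplicative := by
    refine ArithmeticFunction.IsMultiplicative.iff_ne_zero.mpr ⟨by simp [hf], ?_⟩
    intro m n hm hn _
    rw [hf _ (mul_ne_zero hm hn), hf _ hm, hf _ hn, Nat.cast_mul, Complex.natCast_mul_natCast_cpow]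
  have hsq : Squarefree (∏ p ∈ s, p) := by
    refine Finset.squarefree_prod_of_pairwise_isCoprime (fun p hp q hq hpq => ?_)
      fun p hp => (hs p hp).squarefree
    exact Nat.coprime_iff_isRelPrime.mp ((Nat.coprime_primes (hs p hp) (hs q hq)).mpr hpq)
  have key := ArithmeticFunction.IsMultiplicative.prodPrimeFactors_one_sub_of_squarefree f hfm hsq
  rw [Nat.primeFactors_prod hs] at key
  have hprod : ∏ p ∈ s, (1 - (p : ℂ) ^ z) = ∏ p ∈ s, (1 - f p) :=
    Finset.prod_congr rfl fun p hp => by rw [hf p (hs p hp).ne_zero]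
  rw [hprod, key, mul_sum]
  refine sum_congr rfl fun d hd => ?_
  have hd0 : d ≠ 0 := (Nat.pos_of_mem_divisors hd).ne'
  rw [hf d hd0, mul_left_comm]
  congr 1
  rw [Complex.cpow_def_of_ne_zero (by exact_mod_cast hd0), ← Complex.exp_add, ← Complex.natCast_log]
  congr 1
  rw [hz]
  push_cast
  ring

open MeasureTheory in
lemma abs_Mf_fA_le {A n : ℕ} (hA : 1 ≤ A) (hn : n ≠ 0) {R : ℝ} (hR : 2 ≤ R) :
    Integrable (fun u : ℝ => eulerNorm n R (1 / Real.log R * u) *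
        ‖(1 + u * Complex.I : ℂ)‖⁻¹ ^ (A + 1)) ∧
    |Mf (fA A) n R| ≤ A.factorial / (2 * Real.pi) * (Real.exp 1 *
      ∫ u : ℝ, eulerNorm n R (1 / Real.log R * u) * ‖(1 + u * Complex.I : ℂ)‖⁻¹ ^ (A + 1)) := by
  set s := n.primeFactors.filter (fun p : ℕ => (p : ℝ) ≤ R) with hs
  have hsp : ∀ p ∈ s, p.Prime := fun p hp => Nat.prime_of_mem_primeFactors (mem_filter.mp hp).1
  have hlogR : 0 < Real.log R := Real.log_pos (by linarith)
  let T : ℕ → ℝ → ℂ := fun d u => ((ArithmeticFunction.moebius d : ℤ) : ℂ) *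
    Complex.exp (((1 - Real.log d / Real.log R : ℝ) : ℂ) * (1 + u * Complex.I)) *
      ((1 + u * Complex.I : ℂ) ^ (A + 1))⁻¹
  have hTi : ∀ d, Integrable (T d) := by
    intro d
    refine Integrable.bdd_mul (c := |((ArithmeticFunction.moebius d : ℤ) : ℝ)| *
        Real.exp (1 - Real.log d / Real.log R))
      (integrable_inv_one_add_mul_I_pow hA) (by fun_prop) (ae_of_all _ fun u => ?_)
    have h1 : (1 + u * Complex.I : ℂ).re = 1 := by simp
    rw [norm_mul, Complex.norm_exp, Complex.re_ofReal_mul, h1, mul_one, Complex.norm_intCast]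
  have hM : ((Mf (fA A) n R : ℝ) : ℂ) = (A.factorial : ℂ) / (2 * Real.pi) *
      ∫ u : ℝ, ∑ d ∈ (∏ p ∈ s, p).divisors, T d u := by
    rw [integral_finsetSum _ fun d _ => hTi d, mul_sum, Mf_fA_eq_sum_divisors hn hR,
      Complex.ofReal_sum]
    refine sum_congr rfl fun d _ => ?_
    set y := 1 - Real.log d / Real.log R with hy
    have h1 : fA A (Real.log d / Real.log R) =
        Real.exp y * (if 0 ≤ y then y ^ A * Real.exp (-y) else 0) := by
      rw [fA, hy]
      by_cases h : Real.log d / Real.log R ≤ 1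
      · rw [if_pos h, if_pos (by linarith), mul_left_comm, ← Real.exp_add, add_neg_cancel,
          Real.exp_zero, mul_one]
      · rw [if_neg h, if_neg (by linarith), mul_zero]
    rw [h1, Complex.ofReal_mul, Complex.ofReal_mul, fA_mul_exp_eq_integral hA,
      mul_left_comm ((Real.exp y : ℝ) : ℂ), mul_left_comm]
    congr 1
    rw [← integral_const_mul, ← integral_const_mul]
    congr 1
    ext u
    have e2 : Complex.exp ((y : ℂ) * (1 + u * Complex.I)) =
        Complex.exp y * Complex.exp (u * y * Complex.I) := by
      rw [← Complex.exp_add]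
      congr 1
      ring
    simp only [T, ← hy, e2, Complex.ofReal_exp, Complex.ofReal_intCast]
    ring
  have hTJ : ∀ u, ∑ d ∈ (∏ p ∈ s, p).divisors, T d u = Complex.exp (1 + u * Complex.I) *
      (∏ p ∈ s, (1 - (p : ℂ) ^ (-(((1 / Real.log R : ℝ) : ℂ) +
        (1 / Real.log R * u : ℝ) * Complex.I)))) * ((1 + u * Complex.I : ℂ) ^ (A + 1))⁻¹ := by
    intro u
    rw [← sum_moebius_mul_cexp hsp, sum_mul]
  have hnorm : ∀ u, ‖∑ d ∈ (∏ p ∈ s, p).divisors, T d u‖ = Real.exp 1 *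
      (eulerNorm n R (1 / Real.log R * u) * ‖(1 + u * Complex.I : ℂ)‖⁻¹ ^ (A + 1)) := by
    intro u
    rw [hTJ, norm_mul, norm_mul, norm_prod,
      Complex.norm_exp, norm_inv, norm_pow, inv_pow, mul_assoc]
    simp [eulerNorm, hs]
  have hi : Integrable fun u : ℝ => Real.exp 1 * (eulerNorm n R (1 / Real.log R * u) *
      ‖(1 + u * Complex.I : ℂ)‖⁻¹ ^ (A + 1)) :=
    ((integrable_finsetSum _ fun d _ => hTi d).norm).congr (ae_of_all _ hnorm)
  refine ⟨?_, ?_⟩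
  · exact (hi.const_mul (Real.exp 1)⁻¹).congr (ae_of_all _ fun u => by
      simp [← mul_assoc, Real.exp_ne_zero])
  · rw [← Real.norm_eq_abs, ← Complex.norm_real, hM, norm_mul, ← integral_const_mul]
    have e1 : ‖((A.factorial : ℂ) / (2 * Real.pi))‖ = A.factorial / (2 * Real.pi) := by
      simp [abs_of_pos Real.pi_pos]
    rw [e1]
    refine mul_le_mul_of_nonneg_left ?_ (by positivity)
    refine (norm_integral_le_integral_norm _).trans (le_of_eq ?_)
    exact integral_congr_ae (ae_of_all _ hnorm)

open MeasureTheory in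
lemma pow_intervalIntegral_le {f : ℝ → ℝ} (hf : Continuous f) (hf0 : ∀ x, 0 ≤ f x) (m : ℕ) :
    (∫ x in (0 : ℝ)..1, f x) ^ m ≤ ∫ x in (0 : ℝ)..1, f x ^ m := by
  rw [intervalIntegral.integral_of_le zero_le_one, intervalIntegral.integral_of_le zero_le_one]
  have : IsProbabilityMeasure (volume.restrict (Set.Ioc (0 : ℝ) 1)) := ⟨by simp⟩
  have h1 : Integrable f (volume.restrict (Set.Ioc (0 : ℝ) 1)) :=
    (hf.integrableOn_Icc (a := 0) (b := 1)).mono_set Set.Ioc_subset_Icc_self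
  have h2 : Integrable (fun x => f x ^ m) (volume.restrict (Set.Ioc (0 : ℝ) 1)) :=
    ((hf.pow m).integrableOn_Icc (a := 0) (b := 1)).mono_set Set.Ioc_subset_Icc_self
  exact (convexOn_pow m).map_integral_le (continuous_pow m).continuousOn isClosed_Ici
    (ae_of_all _ fun x => hf0 x) h1 h2

lemma inv_norm_one_add_mul_I_le {m u : ℝ} (hm : 0 ≤ m) (hu : m ≤ u) :
    ‖(1 + u * Complex.I : ℂ)‖⁻¹ ≤ 2 * (m + 1)⁻¹ := by
  have h := norm_one_add_mul_I_sq u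
  have h0 := norm_nonneg (1 + u * Complex.I : ℂ)
  have h1 : (m + 1) / 2 ≤ ‖(1 + u * Complex.I : ℂ)‖ := by
    refine le_of_sq_le_sq ?_ h0
    rw [h]
    nlinarith [sq_nonneg (m - 1)]
  calc ‖(1 + u * Complex.I : ℂ)‖⁻¹ ≤ ((m + 1) / 2)⁻¹ := inv_anti₀ (by positivity) h1
    _ = 2 * (m + 1)⁻¹ := by rw [inv_div, div_eq_mul_inv]

open MeasureTheory Filter Topology in
lemma exists_sum_Mf_pow_le {A : ℕ} (hA : 1 ≤ A) (k : ℕ) :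
    ∃ C : ℝ, 0 ≤ C ∧ ∀ (s : Finset ℕ) (w : ℕ → ℝ) (R B : ℝ), 2 ≤ R →
      (∀ n ∈ s, n ≠ 0 ∧ 0 ≤ w n) →
      (∀ (N : ℕ) (θ : ℝ), 0 ≤ θ → θ ≤ 1 → ∑ n ∈ s, w n * (∑ m ∈ range N,
        ((m + 1 : ℝ) ^ (A + 1))⁻¹ * eulerNorm n R (1 / Real.log R * (m + θ))) ^ (2 * k) ≤ B) →
      ∑ n ∈ s, w n * Mf (fA A) n R ^ (2 * k) ≤ C * B := by
  set c : ℝ := A.factorial / (2 * Real.pi) with hc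
  have hc0 : 0 ≤ c := by positivity
  refine ⟨(c * (Real.exp 1 * 2)) ^ (2 * k) * (2 ^ (A + 1)) ^ (2 * k), by positivity, ?_⟩
  intro s w R B hR hs hB
  set F : ℕ → ℝ → ℝ := fun n u => eulerNorm n R (1 / Real.log R * u) *
    ‖(1 + u * Complex.I : ℂ)‖⁻¹ ^ (A + 1) with hF
  have hF0 : ∀ n u, 0 ≤ F n u := fun n u => mul_nonneg (eulerNorm_nonneg _ _ _) (by positivity)
  have hFc : ∀ n, Continuous (F n) := by
    intro n
    refine ((continuous_eulerNorm n R).comp (by fun_prop)).mul (Continuous.pow ?_ _)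
    exact Continuous.inv₀ (by fun_prop) fun u => norm_ne_zero_iff.mpr (one_add_mul_I_ne_zero u)
  have hFabs : ∀ n u, F n |u| = F n u := by
    intro n u
    rcases abs_choice u with h | h
    · rw [h]
    · rw [h]
      have e1 : ‖(1 + ((-u : ℝ) : ℂ) * Complex.I : ℂ)‖ = ‖(1 + (u : ℂ) * Complex.I : ℂ)‖ := by
        rw [← sq_eq_sq₀ (norm_nonneg _) (norm_nonneg _), norm_one_add_mul_I_sq,
          norm_one_add_mul_I_sq, neg_sq]
      simp only [hF, e1, mul_neg, eulerNorm_neg]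
  set G : ℕ → ℕ → ℝ → ℝ := fun N n θ => ∑ m ∈ range N,
    ((m + 1 : ℝ) ^ (A + 1))⁻¹ * eulerNorm n R (1 / Real.log R * (m + θ)) with hG
  have hGc : ∀ N n, Continuous (G N n) := by
    intro N n
    refine continuous_finsetSum _ fun m _ => continuous_const.mul ?_
    exact (continuous_eulerNorm n R).comp (by fun_prop)
  have hG0 : ∀ N n θ, 0 ≤ G N n θ := fun N n θ =>
    sum_nonneg fun m _ => mul_nonneg (by positivity) (eulerNorm_nonneg _ _ _)
  have hInt : ∀ (N n : ℕ), ∫ u in (0 : ℝ)..N, F n u ≤ 2 ^ (A + 1) * ∫ θ in (0 : ℝ)..1, G N n θ := by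
    intro N n
    have h1 := intervalIntegral.sum_integral_adjacent_intervals (μ := volume) (f := F n)
      (a := fun m : ℕ => (m : ℝ)) (n := N) fun m _ => (hFc n).intervalIntegrable _ _
    simp only [Nat.cast_zero] at h1
    rw [← h1, ← intervalIntegral.integral_const_mul]
    have h2 : ∀ m ∈ range N, ∫ u in (m : ℝ)..((m + 1 : ℕ) : ℝ), F n u =
        ∫ θ in (0 : ℝ)..1, F n (m + θ) := by
      intro m _
      rw [intervalIntegral.integral_comp_add_left (F n) (m : ℝ)]
      simp
    have hFm : ∀ m : ℕ, Continuous fun θ : ℝ => F n (m + θ) := fun m =>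
      (hFc n).comp (by fun_prop : Continuous fun θ : ℝ => (m : ℝ) + θ)
    have hci : ∀ m ∈ range N, IntervalIntegrable (fun θ : ℝ => F n (m + θ)) volume 0 1 :=
      fun m _ => (hFm m).intervalIntegrable _ _
    rw [sum_congr rfl h2, ← intervalIntegral.integral_finsetSum hci]
    refine intervalIntegral.integral_mono_on zero_le_one ?_ ?_ ?_
    · exact (continuous_finsetSum _ fun m _ => hFm m).intervalIntegrable _ _
    · exact ((hGc N n).const_mul _).intervalIntegrable _ _
    · intro θ hθ
      rw [hG, mul_sum]
      refine sum_le_sum fun m _ => ?_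
      have h3 := inv_norm_one_add_mul_I_le (m := (m : ℝ)) (u := m + θ) (by positivity)
        (by linarith [hθ.1])
      have h4 := pow_le_pow_left₀ (inv_nonneg.mpr (norm_nonneg _)) h3 (A + 1)
      rw [mul_pow, inv_pow (m + 1 : ℝ)] at h4
      calc F n (m + θ) ≤ eulerNorm n R (1 / Real.log R * (m + θ)) *
            (2 ^ (A + 1) * ((m + 1 : ℝ) ^ (A + 1))⁻¹) :=
            mul_le_mul_of_nonneg_left h4 (eulerNorm_nonneg _ _ _)
        _ = _ := by ring
  have hN : ∀ N : ℕ, ∑ n ∈ s, w n * (∫ u in (0 : ℝ)..N, F n u) ^ (2 * k) ≤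
      (2 ^ (A + 1)) ^ (2 * k) * B := by
    intro N
    have h1 : ∀ n ∈ s, w n * (∫ u in (0 : ℝ)..N, F n u) ^ (2 * k) ≤
        (2 ^ (A + 1)) ^ (2 * k) * ∫ θ in (0 : ℝ)..1, w n * G N n θ ^ (2 * k) := by
      intro n hn
      rw [intervalIntegral.integral_const_mul, mul_left_comm]
      refine mul_le_mul_of_nonneg_left ?_ (hs n hn).2
      have h2 : 0 ≤ ∫ u in (0 : ℝ)..N, F n u :=
        intervalIntegral.integral_nonneg (by positivity) fun u _ => hF0 n u
      refine (pow_le_pow_left₀ h2 (hInt N n) _).trans ?_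
      rw [mul_pow]
      exact mul_le_mul_of_nonneg_left (pow_intervalIntegral_le (hGc N n) (hG0 N n) _)
        (by positivity)
    refine (sum_le_sum h1).trans ?_
    rw [← mul_sum]
    refine mul_le_mul_of_nonneg_left ?_ (by positivity)
    have hci : ∀ n ∈ s, IntervalIntegrable (fun θ => w n * G N n θ ^ (2 * k)) volume 0 1 :=
      fun n _ => (((hGc N n).pow _).const_mul _).intervalIntegrable _ _
    rw [← intervalIntegral.integral_finsetSum hci]
    calc ∫ θ in (0 : ℝ)..1, ∑ n ∈ s, w n * G N n θ ^ (2 * k) ≤ ∫ _ in (0 : ℝ)..1, B := by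
          refine intervalIntegral.integral_mono_on zero_le_one ?_ (by simp) fun θ hθ =>
            hB N θ hθ.1 hθ.2
          exact (continuous_finsetSum _ fun n _ =>
            ((hGc N n).pow _).const_mul _).intervalIntegrable _ _
      _ = B := by simp
  have hlim : ∑ n ∈ s, w n * (∫ u in Set.Ioi (0 : ℝ), F n u) ^ (2 * k) ≤
      (2 ^ (A + 1)) ^ (2 * k) * B := by
    suffices ht : Tendsto (fun N : ℕ => ∑ n ∈ s, w n * (∫ u in (0 : ℝ)..N, F n u) ^ (2 * k)) atTop
        (𝓝 (∑ n ∈ s, w n * (∫ u in Set.Ioi (0 : ℝ), F n u) ^ (2 * k))) by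
      exact le_of_tendsto ht (Eventually.of_forall hN)
    refine tendsto_finsetSum _ fun n hn => ?_
    have hi : IntegrableOn (F n) (Set.Ioi 0) :=
      ((abs_Mf_fA_le hA (hs n hn).1 hR).1).integrableOn
    exact ((intervalIntegral_tendsto_integral_Ioi 0 hi
      tendsto_natCast_atTop_atTop).pow _).const_mul _
  have hfin : ∀ n ∈ s, w n * Mf (fA A) n R ^ (2 * k) ≤ (c * (Real.exp 1 * 2)) ^ (2 * k) *
      (w n * (∫ u in Set.Ioi (0 : ℝ), F n u) ^ (2 * k)) := by
    intro n hn
    have h1 := (abs_Mf_fA_le hA (hs n hn).1 hR).2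
    have h2 : ∫ u, F n u = 2 * ∫ u in Set.Ioi (0 : ℝ), F n u := by
      rw [← integral_comp_abs]
      simp only [hFabs]
    change _ ≤ c * (Real.exp 1 * ∫ u, F n u) at h1
    rw [h2] at h1
    rw [mul_left_comm, ← mul_pow]
    refine mul_le_mul_of_nonneg_left ?_ (hs n hn).2
    rw [← Even.pow_abs (even_two_mul k)]
    refine pow_le_pow_left₀ (abs_nonneg _) (h1.trans (le_of_eq (by ring))) _
  calc _ ≤ _ := sum_le_sum hfin
    _ = (c * (Real.exp 1 * 2)) ^ (2 * k) *
        ∑ n ∈ s, w n * (∫ u in Set.Ioi (0 : ℝ), F n u) ^ (2 * k) := by rw [mul_sum]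
    _ ≤ (c * (Real.exp 1 * 2)) ^ (2 * k) * ((2 ^ (A + 1)) ^ (2 * k) * B) :=
        mul_le_mul_of_nonneg_left hlim (by positivity)
    _ = _ := by ring

/-- `|1 - e ^ (i θ)|`. -/
noncomputable def chord (θ : ℝ) : ℝ := Real.sqrt (2 - 2 * Real.cos θ)

lemma chord_nonneg (θ : ℝ) : 0 ≤ chord θ := Real.sqrt_nonneg _

lemma chord_sq (θ : ℝ) : chord θ ^ 2 = 2 - 2 * Real.cos θ :=
  Real.sq_sqrt (by linarith [Real.cos_le_one θ])

lemma chord_le_two (θ : ℝ) : chord θ ≤ 2 := by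
  refine le_of_sq_le_sq ?_ zero_le_two
  rw [chord_sq]
  linarith [Real.neg_one_le_cos θ]

/-- The Euler factor `|1 - p ^ (-(σ + i t))|`. -/
noncomputable def eulerFactor (σ t : ℝ) (p : ℕ) : ℝ :=
  ‖(1 - (p : ℂ) ^ (-((σ : ℂ) + t * Complex.I)) : ℂ)‖

lemma eulerFactor_nonneg (σ t : ℝ) (p : ℕ) : 0 ≤ eulerFactor σ t p := norm_nonneg _

lemma eulerFactor_le {p : ℕ} (hp : 0 < p) {σ : ℝ} (hσ : 0 ≤ σ) (t : ℝ) :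
    eulerFactor σ t p ≤ 2 ∧
      eulerFactor σ t p ≤ chord (t * Real.log p) + (1 - (p : ℝ) ^ (-σ)) := by
  have h := norm_one_sub_natCast_cpow_sq hp σ t
  have hp1 : (1 : ℝ) ≤ p := by exact_mod_cast hp
  have hq0 : 0 < (p : ℝ) ^ (-σ) := Real.rpow_pos_of_pos (by linarith) _
  have hq1 : (p : ℝ) ^ (-σ) ≤ 1 := Real.rpow_le_one_of_one_le_of_nonpos hp1 (by linarith)
  have hc := chord_sq (t * Real.log p)
  have hc0 := chord_nonneg (t * Real.log p)
  have hc2 := chord_le_two (t * Real.log p)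
  set q := (p : ℝ) ^ (-σ)
  rw [← hc] at h
  constructor
  · refine le_of_sq_le_sq ?_ zero_le_two
    rw [eulerFactor, h]
    nlinarith
  · refine le_of_sq_le_sq ?_ (by linarith)
    rw [eulerFactor, h]
    nlinarith [mul_nonneg hc0 (sub_nonneg.mpr hq1),
      mul_nonneg (sub_nonneg.mpr hq1) (sq_nonneg (chord (t * Real.log p)))]

lemma eulerFactor_le_two {σ : ℝ} (hσ : 0 < σ) (t : ℝ) (p : ℕ) : eulerFactor σ t p ≤ 2 := by
  rcases Nat.eq_zero_or_pos p with rfl | hp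
  · have : -((σ : ℂ) + t * Complex.I) ≠ 0 := by
      intro h
      have := congrArg Complex.re h
      simp at this
      exact hσ.ne' this
    simp only [eulerFactor, Nat.cast_zero, Complex.zero_cpow this, sub_zero, norm_one]
    norm_num
  · exact (eulerFactor_le hp hσ.le t).1

lemma eulerNorm_eq_prod (n : ℕ) (R t : ℝ) : eulerNorm n R t =
    ∏ p ∈ n.primeFactors.filter (fun p : ℕ => (p : ℝ) ≤ R), eulerFactor (1 / Real.log R) t p := rfl

lemma mul_le_mul_add_mul {a b y z c d M N e : ℝ} (hb : 0 ≤ b) (hy : 0 ≤ y) (hc : 0 ≤ c)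
    (hd : 0 ≤ d) (he : 0 ≤ e) (hyM : y ≤ M) (hbN : b ≤ N) (h1 : a ≤ y + c * e)
    (h2 : b ≤ z + d * e) : a * b ≤ y * z + (M * d + N * c) * e := by
  have e1 : a * b ≤ (y + c * e) * b := mul_le_mul_of_nonneg_right h1 hb
  have e2 : y * b ≤ y * (z + d * e) := mul_le_mul_of_nonneg_left h2 hy
  have e3 : c * e * b ≤ c * e * N := mul_le_mul_of_nonneg_left hbN (by positivity)
  have e4 : y * (d * e) ≤ M * (d * e) := mul_le_mul_of_nonneg_right hyM (by positivity)
  nlinarith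

lemma pow_le_pow_add_mul {a y e : ℝ} (ha : 0 ≤ a) (hy : 0 ≤ y) (he : 0 ≤ e) {M : ℝ} (haM : a ≤ M)
    (hyM : y ≤ M) {c : ℝ} (hc : 0 ≤ c) (h : a ≤ y + c * e) (k : ℕ) :
    a ^ k ≤ y ^ k + k * M ^ (k - 1) * c * e := by
  induction k with
  | zero => simp
  | succ k ih =>
    have hM : 0 ≤ M := ha.trans haM
    rw [pow_succ, pow_succ]
    refine (mul_le_mul_add_mul (M := M ^ k) (N := M) ha (by positivity)
      (c := k * M ^ (k - 1) * c) (by positivity) hc he (pow_le_pow_left₀ hy hyM k) haM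
      (by linarith) h).trans (le_of_eq ?_)
    rcases k with _ | k
    · simp
    · simp only [Nat.add_sub_cancel]
      push_cast
      ring

lemma one_add_mul_sq_sub_one_le_pow {k : ℕ} (hk : 2 ≤ k) {r : ℝ} (hr : 0 ≤ r) :
    1 + (k : ℝ) / 2 * (r ^ 2 - 1) ≤ r ^ k := by
  have hk2 : (2 : ℝ) ≤ k := by exact_mod_cast hk
  have h := one_add_mul_self_le_rpow_one_add (s := r ^ 2 - 1) (by nlinarith [sq_nonneg r])
    (p := (k : ℝ) / 2) (by linarith)
  have e : (r ^ 2) ^ ((k : ℝ) / 2) = r ^ k := by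
    rw [← Real.rpow_natCast r 2, ← Real.rpow_mul hr, ← Real.rpow_natCast r k]
    congr 1
    push_cast
    ring
  rwa [add_sub_cancel, e] at h

lemma abs_sq_sub_sq_pow_le {k : ℕ} (hk : 2 ≤ k) {y z : ℝ} (hy : 0 ≤ y) (hz : 0 ≤ z) :
    |y ^ 2 - z ^ 2| ^ k ≤ (y ^ k - z ^ k) ^ 2 := by
  wlog h : z ≤ y generalizing y z
  · have := this hz hy (le_of_not_ge h)
    rwa [abs_sub_comm, sub_sq_comm]
  have h0 : 0 ≤ y ^ 2 - z ^ 2 := by nlinarith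
  rw [abs_of_nonneg h0]
  set d := Real.sqrt (y ^ 2 - z ^ 2) with hd
  have hd0 : 0 ≤ d := Real.sqrt_nonneg _
  have hd2 : d ^ 2 = y ^ 2 - z ^ 2 := Real.sq_sqrt h0
  have hdy : d ≤ y := le_of_sq_le_sq (by nlinarith) hy
  obtain ⟨l, rfl⟩ := Nat.exists_eq_add_of_le hk
  have h1 : z ^ (2 + l) ≤ z ^ 2 * y ^ l := by
    rw [pow_add]
    exact mul_le_mul_of_nonneg_left (pow_le_pow_left₀ hz h l) (by positivity)
  have h2 : d ^ (2 + l) ≤ d ^ 2 * y ^ l := by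
    rw [pow_add]
    exact mul_le_mul_of_nonneg_left (pow_le_pow_left₀ hd0 hdy l) (by positivity)
  have h3 : d ^ (2 + l) ≤ y ^ (2 + l) - z ^ (2 + l) := by
    have : y ^ (2 + l) = z ^ 2 * y ^ l + d ^ 2 * y ^ l := by
      rw [hd2, pow_add]
      ring
    linarith
  rw [← hd2, ← pow_mul, mul_comm 2, pow_mul]
  exact pow_le_pow_left₀ (by positivity) h3 2

/-- The gain exponent in the pair estimate for `k`-th powers. -/
noncomputable def pairGain (k : ℕ) : ℝ := if k = 1 then 1 / 8 else 2 ^ (k - 1)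

lemma exists_pow_mul_pow_le {k : ℕ} (hk : 1 ≤ k) : ∃ b : ℝ, 0 ≤ b ∧ ∀ y z : ℝ, 0 ≤ y → 0 ≤ z →
    y ≤ 2 → z ≤ 2 → y ^ k * z ^ k ≤ 1 / 2 * ((y ^ 2) ^ k + (z ^ 2) ^ k) -
      max 0 (pairGain k + b * ((y ^ 2 - z ^ 2) ^ 2 - 4)) := by
  have main : ∀ y z : ℝ, y ^ k * z ^ k =
      1 / 2 * ((y ^ 2) ^ k + (z ^ 2) ^ k) - 1 / 2 * (y ^ k - z ^ k) ^ 2 := by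
    intro y z
    rw [← pow_mul, ← pow_mul, mul_comm 2, pow_mul, pow_mul]
    ring
  suffices h : ∃ b : ℝ, 0 ≤ b ∧ ∀ y z : ℝ, 0 ≤ y → 0 ≤ z → y ≤ 2 → z ≤ 2 →
      pairGain k + b * ((y ^ 2 - z ^ 2) ^ 2 - 4) ≤ 1 / 2 * (y ^ k - z ^ k) ^ 2 by
    obtain ⟨b, hb, h⟩ := h
    refine ⟨b, hb, fun y z hy hz hy2 hz2 => ?_⟩
    rw [main]
    have := max_le (show 0 ≤ 1 / 2 * (y ^ k - z ^ k) ^ 2 by positivity) (h y z hy hz hy2 hz2)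
    linarith
  rcases eq_or_ne k 1 with rfl | hk1
  · refine ⟨1 / 32, by norm_num, fun y z hy hz hy2 hz2 => ?_⟩
    have h1 : (y ^ 2 - z ^ 2) ^ 2 = (y + z) ^ 2 * (y - z) ^ 2 := by ring
    have h2 : (y + z) ^ 2 * (y - z) ^ 2 ≤ 16 * (y - z) ^ 2 :=
      mul_le_mul_of_nonneg_right (by nlinarith) (sq_nonneg _)
    simp only [pairGain, if_true, pow_one]
    rw [h1]
    linarith
  · refine ⟨k * 2 ^ k / 16, by positivity, fun y z hy hz _ _ => ?_⟩
    have hk2 : 2 ≤ k := by omega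
    have h1 := abs_sq_sub_sq_pow_le hk2 hy hz
    have h2 := one_add_mul_sq_sub_one_le_pow hk2 (r := |y ^ 2 - z ^ 2| / 2) (by positivity)
    rw [div_pow, div_pow, sq_abs, le_div_iff₀ (by positivity)] at h2
    have h3 : (2 : ℝ) ^ k = 2 * 2 ^ (k - 1) := by
      rw [← pow_succ']
      congr 1
      omega
    rw [pairGain, if_neg hk1]
    rw [h3] at h2 ⊢
    nlinarith

lemma mul_four_le {a b c d : ℝ} (hb : 0 ≤ b) (hc : 0 ≤ c) (hb2 : b ≤ 2) (hc2 : c ≤ 2) :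
    a * b * (c * d) ≤ 1 / 4 * (a ^ 2 * b ^ 2 + c ^ 2 * d ^ 2 + a ^ 2 * c ^ 2 + b ^ 2 * d ^ 2) -
      1 / 32 * ((b ^ 2 - c ^ 2) ^ 2 * d ^ 2) := by
  set P := a * b - c * d with hP
  set Q := a * c - b * d with hQ
  have h1 : (b ^ 2 - c ^ 2) ^ 2 * d ^ 2 = (P * c - Q * b) ^ 2 := by rw [hP, hQ]; ring
  have h2 : (P * c - Q * b) ^ 2 ≤ 8 * (P ^ 2 + Q ^ 2) := by
    have e1 : (P * c - Q * b) ^ 2 ≤ 2 * (P ^ 2 * c ^ 2) + 2 * (Q ^ 2 * b ^ 2) := by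
      nlinarith [sq_nonneg (P * c + Q * b)]
    have e2 : P ^ 2 * c ^ 2 ≤ P ^ 2 * 4 :=
      mul_le_mul_of_nonneg_left (by nlinarith) (sq_nonneg _)
    have e3 : Q ^ 2 * b ^ 2 ≤ Q ^ 2 * 4 :=
      mul_le_mul_of_nonneg_left (by nlinarith) (sq_nonneg _)
    linarith
  have h3 : a * b * (c * d) =
      1 / 4 * (a ^ 2 * b ^ 2 + c ^ 2 * d ^ 2 + a ^ 2 * c ^ 2 + b ^ 2 * d ^ 2)
      - 1 / 4 * (P ^ 2 + Q ^ 2) := by rw [hP, hQ]; ring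
  rw [h1, h3]
  linarith

lemma chord_sq_pow_eq_sum (k : ℕ) (θ : ℝ) : (chord θ ^ 2) ^ k =
    ∑ i ∈ range (2 * k + 1), (-1) ^ (i + k) * ((2 * k).choose i : ℝ) *
      Real.cos (((i : ℝ) - k) * θ) := by
  have h1 : ((2 - 2 * Real.cos θ : ℝ) : ℂ) = -(Complex.exp (-(θ * Complex.I))) *
      (-Complex.exp (θ * Complex.I) + 1) ^ 2 := by
    have e1 : Complex.exp (-(θ * Complex.I)) * Complex.exp (θ * Complex.I) = 1 := by
      rw [← Complex.exp_add]; simp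
    have e2 := Complex.two_cos (θ : ℂ)
    push_cast
    rw [e2, neg_mul]
    linear_combination (Complex.exp (θ * Complex.I) - 2) * e1
  have h2 : (((2 - 2 * Real.cos θ) ^ k : ℝ) : ℂ) = ∑ i ∈ range (2 * k + 1),
      (((-1) ^ (i + k) * ((2 * k).choose i : ℝ) : ℝ) : ℂ) *
        Complex.exp (((((i : ℝ) - k) * θ : ℝ) : ℂ) * Complex.I) := by
    rw [Complex.ofReal_pow, h1, mul_pow, ← pow_mul, add_pow, mul_sum]
    refine sum_congr rfl fun i _ => ?_
    have e3 : Complex.exp (((((i : ℝ) - k) * θ : ℝ) : ℂ) * Complex.I) =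
        Complex.exp (-(θ * Complex.I)) ^ k * Complex.exp (θ * Complex.I) ^ i := by
      rw [← Complex.exp_nat_mul, ← Complex.exp_nat_mul, ← Complex.exp_add]
      congr 1
      push_cast
      ring
    rw [e3, one_pow, neg_pow, neg_pow (Complex.exp (θ * Complex.I)), pow_add]
    push_cast
    ring
  have h3 := congrArg Complex.re h2
  rw [Complex.ofReal_re, Complex.re_sum] at h3
  rw [chord_sq, h3]
  refine sum_congr rfl fun i _ => ?_
  rw [Complex.re_ofReal_mul, Complex.exp_ofReal_mul_I_re]

lemma chord_sq_sub_sq (a b : ℝ) : (chord a ^ 2 - chord b ^ 2) ^ 2 - 4 =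
    2 * Real.cos (2 * a) + 2 * Real.cos (2 * b) - 4 * Real.cos (a + b) - 4 * Real.cos (a - b) := by
  rw [chord_sq, chord_sq, Real.cos_two_mul, Real.cos_two_mul, Real.cos_add, Real.cos_sub]
  ring

lemma chord_sq_sub_sq_mul (a b c : ℝ) : (chord a ^ 2 - chord b ^ 2) ^ 2 * chord c ^ 2 =
    8 + 4 * Real.cos (2 * a) + 4 * Real.cos (2 * b) - 8 * Real.cos (a + b) - 8 * Real.cos (a - b)
      - 8 * Real.cos c - 2 * Real.cos (2 * a + c) - 2 * Real.cos (2 * a - c)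
      - 2 * Real.cos (2 * b + c) - 2 * Real.cos (2 * b - c) + 4 * Real.cos (a + b + c)
      + 4 * Real.cos (a + b - c) + 4 * Real.cos (a - b + c) + 4 * Real.cos (a - b - c) := by
  have h := chord_sq_sub_sq a b
  have h2 : (chord a ^ 2 - chord b ^ 2) ^ 2 = 4 +
    (2 * Real.cos (2 * a) + 2 * Real.cos (2 * b) -
      4 * Real.cos (a + b) - 4 * Real.cos (a - b)) := by
    linarith
  rw [h2, chord_sq, Real.cos_add (2 * a), Real.cos_sub (2 * a), Real.cos_add (2 * b),
    Real.cos_sub (2 * b), Real.cos_add (a + b), Real.cos_sub (a + b), Real.cos_add (a - b),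
    Real.cos_sub (a - b)]
  ring

lemma exists_primeCosSum_bound_mul {ε : ℝ} (hε : 0 < ε) {c : ℝ} (hc : 0 ≤ c) :
    ∃ K : ℝ, 0 ≤ K ∧ ∀ σ τ W : ℝ, 0 < σ → 1 ≤ W → |τ| ≤ c * W →
      |primeCosSum σ τ - negLogPlus (σ + |τ|)| ≤ ε * Real.log W + K := by
  obtain ⟨K, hK0, hK⟩ := exists_primeCosSum_bound hε
  refine ⟨ε * Real.log (2 + c) + K,
    add_nonneg (mul_nonneg hε.le (Real.log_nonneg (by linarith))) hK0,
    fun σ τ W hσ hW hτ => (hK σ τ hσ).trans ?_⟩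
  have h1 : Real.log (2 + |τ|) ≤ Real.log (2 + c) + Real.log W := by
    rw [← Real.log_mul (by linarith) (by linarith)]
    refine Real.log_le_log (by positivity) ?_
    nlinarith
  nlinarith

lemma exists_tsum_chord_pow_le {k : ℕ} (hk : 1 ≤ k) {ε : ℝ} (hε : 0 < ε) :
    ∃ K : ℝ, 0 ≤ K ∧ ∀ σ t W : ℝ, 0 < σ → 0 ≤ t → 1 ≤ W → t ≤ 4 * W →
      ∑' p : Nat.Primes, (p : ℝ) ^ (-1 - σ) * (chord (t * Real.log p) ^ 2) ^ k ≤
        (2 * k).choose k * (negLogPlus σ - negLogPlus (σ + t)) + ε * Real.log W + K := by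
  set c : ℕ → ℝ := fun i => (-1) ^ (i + k) * ((2 * k).choose i : ℝ) with hc
  set S : ℝ := ∑ i ∈ range (2 * k + 1), |c i| with hS
  have hS0 : 0 ≤ S := sum_nonneg fun _ _ => abs_nonneg _
  have hk1 : (1 : ℝ) ≤ k := by exact_mod_cast hk
  obtain ⟨K, hK0, hK⟩ := exists_primeCosSum_bound_mul (ε := ε / (S + 1)) (by positivity)
    (c := 4 * k) (by positivity)
  have hlk : 0 ≤ Real.log k := Real.log_nonneg hk1
  refine ⟨S * (Real.log k + K), by positivity, fun σ t W hσ ht hW htW => ?_⟩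
  have hlW : 0 ≤ Real.log W := Real.log_nonneg hW
  have hsum : HasSum (fun p : Nat.Primes => (p : ℝ) ^ (-1 - σ) * (chord (t * Real.log p) ^ 2) ^ k)
      (∑ i ∈ range (2 * k + 1), c i * primeCosSum σ (((i : ℝ) - k) * t)) := by
    have h := hasSum_sum fun i (_ : i ∈ range (2 * k + 1)) =>
      (hasSum_primeCosSum hσ (((i : ℝ) - k) * t)).mul_left (c i)
    refine h.congr_fun fun p => ?_
    rw [chord_sq_pow_eq_sum, mul_sum]
    refine sum_congr rfl fun i _ => ?_
    rw [mul_assoc ((i : ℝ) - k)]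
    ring
  rw [hsum.tsum_eq]
  have hzero : ∑ i ∈ range (2 * k + 1), c i = 0 := by
    have h := chord_sq_pow_eq_sum k 0
    rw [chord_sq] at h
    simp only [Real.cos_zero, mul_one, sub_self, mul_zero] at h
    rw [zero_pow (by omega)] at h
    exact h.symm
  set N' := negLogPlus (σ + t) with hN'
  have hterm : ∀ i ∈ range (2 * k + 1), c i * primeCosSum σ (((i : ℝ) - k) * t) - c i * N' ≤
      (if i = k then (2 * k).choose k * (negLogPlus σ - N') else 0) +
        |c i| * (Real.log k + (ε / (S + 1) * Real.log W + K)) := by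
    intro i hi
    have hik : |(i : ℝ) - k| ≤ k := by
      have : (i : ℝ) ≤ 2 * k := by
        have := mem_range.mp hi
        exact_mod_cast (by omega : i ≤ 2 * k)
      rw [abs_le]
      constructor <;> linarith [(Nat.cast_nonneg i : (0 : ℝ) ≤ i)]
    have habs : |((i : ℝ) - k) * t| = |(i : ℝ) - k| * t := by rw [abs_mul, abs_of_nonneg ht]
    have h1 := hK σ (((i : ℝ) - k) * t) W hσ hW (by rw [habs]; nlinarith [abs_nonneg ((i : ℝ) - k)])
    rw [habs] at h1
    set E := ε / (S + 1) * Real.log W + K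
    have h2 : c i * (primeCosSum σ (((i : ℝ) - k) * t) - negLogPlus (σ + |(i : ℝ) - k| * t)) ≤
        |c i| * E := by
      refine (le_abs_self _).trans ?_
      rw [abs_mul]
      exact mul_le_mul_of_nonneg_left h1 (abs_nonneg _)
    split_ifs with hi'
    · subst hi'
      have hci : c i = (2 * i).choose i := by
        simp [hc, ← two_mul]
      simp only [sub_self, abs_zero, zero_mul, add_zero] at h2 ⊢
      have : 0 ≤ |c i| * Real.log i := by positivity
      rw [← hci]
      nlinarith
    · have h3 : (1 : ℝ) ≤ |(i : ℝ) - k| := by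
        have : (1 : ℤ) ≤ |(i : ℤ) - k| := by
          have : (i : ℤ) - k ≠ 0 := by omega
          exact Int.one_le_abs this
        exact_mod_cast this
      have h4 : σ + t ≤ σ + |(i : ℝ) - k| * t := by nlinarith
      have h5 := negLogPlus_anti (by linarith) h4
      have h6 := negLogPlus_sub_le (by linarith) h4
      have h7 : Real.log ((σ + |(i : ℝ) - k| * t) / (σ + t)) ≤ Real.log k := by
        refine Real.log_le_log (by positivity) ?_
        rw [div_le_iff₀ (by linarith)]
        nlinarith
      have h8 : c i * (negLogPlus (σ + |(i : ℝ) - k| * t) - N') ≤ |c i| * Real.log k := by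
        refine (le_abs_self _).trans ?_
        rw [abs_mul]
        refine mul_le_mul_of_nonneg_left ?_ (abs_nonneg _)
        rw [abs_le]
        constructor <;> linarith
      linarith
  have h1 := sum_le_sum hterm
  rw [sum_sub_distrib, ← sum_mul, hzero, sum_add_distrib, ← sum_mul,
    Finset.sum_ite_eq' (range (2 * k + 1)) k, if_pos (mem_range.mpr (by omega)), ← hS] at h1
  have h2 : S * (ε / (S + 1)) ≤ ε := by
    rw [mul_div_assoc', div_le_iff₀ (by positivity)]
    nlinarith
  have h3 := mul_le_mul_of_nonneg_right h2 hlW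
  nlinarith

/-- The difference of `∑ p ^ (-1 - σ) cos (τ log p)` at the abscissas `σ` and `Δ`. -/
noncomputable def primeCosDiff (σ Δ τ : ℝ) : ℝ := primeCosSum σ τ - primeCosSum Δ τ

lemma hasSum_primeCosDiff {σ Δ : ℝ} (hσ : 0 < σ) (hΔ : 0 < Δ) (τ : ℝ) :
    HasSum (fun p : Nat.Primes => ((p : ℝ) ^ (-1 - σ) - (p : ℝ) ^ (-1 - Δ)) *
      Real.cos (τ * Real.log p)) (primeCosDiff σ Δ τ) := by
  have h := (hasSum_primeCosSum hσ τ).sub (hasSum_primeCosSum hΔ τ)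
  unfold primeCosDiff
  simpa only [sub_mul] using h

lemma prime_rpow_anti {σ Δ : ℝ} (h : σ ≤ Δ) (p : Nat.Primes) :
    (p : ℝ) ^ (-1 - Δ) ≤ (p : ℝ) ^ (-1 - σ) :=
  Real.rpow_le_rpow_of_exponent_le (by exact_mod_cast p.2.one_lt.le) (by linarith)

lemma primeCosDiff_le_zero_arg {σ Δ : ℝ} (hσ : 0 < σ) (h : σ ≤ Δ) (τ : ℝ) :
    primeCosDiff σ Δ τ ≤ primeCosDiff σ Δ 0 := by
  refine hasSum_le (fun p => ?_) (hasSum_primeCosDiff hσ (hσ.trans_le h) τ)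
    (hasSum_primeCosDiff hσ (hσ.trans_le h) 0)
  rw [zero_mul, Real.cos_zero]
  exact mul_le_mul_of_nonneg_left (Real.cos_le_one _) (sub_nonneg.mpr (prime_rpow_anti h p))

lemma exists_primeCosDiff_bound {ε : ℝ} (hε : 0 < ε) {c : ℝ} (hc : 0 ≤ c) :
    ∃ K : ℝ, 0 ≤ K ∧ ∀ σ Δ τ W : ℝ, 0 < σ → σ ≤ Δ → 1 ≤ W → |τ| ≤ c * W →
      -(ε * Real.log W + K) ≤ primeCosDiff σ Δ τ ∧
      (Δ ≤ 2 * (σ + |τ|) → primeCosDiff σ Δ τ ≤ ε * Real.log W + K) ∧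
      negLogPlus σ - negLogPlus Δ - (ε * Real.log W + K) ≤ primeCosDiff σ Δ 0 := by
  obtain ⟨K, hK0, hK⟩ := exists_primeCosSum_bound_mul (ε := ε / 2) (by positivity) hc
  have hl3 : 0 ≤ Real.log 3 := Real.log_nonneg (by norm_num)
  refine ⟨2 * K + Real.log 3, by positivity, fun σ Δ τ W hσ hΔ hW hτ => ?_⟩
  have hΔ0 : 0 < Δ := hσ.trans_le hΔ
  have h1 := abs_le.mp (hK σ τ W hσ hW hτ)
  have h2 := abs_le.mp (hK Δ τ W hΔ0 hW hτ)
  have h3 := abs_le.mp (hK σ 0 W hσ hW (by rw [abs_zero]; positivity))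
  have h4 := abs_le.mp (hK Δ 0 W hΔ0 hW (by rw [abs_zero]; positivity))
  rw [abs_zero, add_zero] at h3 h4
  have hτ0 := abs_nonneg τ
  have h5 := negLogPlus_anti (a := σ + |τ|) (b := Δ + |τ|) (by linarith) (by linarith)
  refine ⟨?_, fun h => ?_, ?_⟩
  · unfold primeCosDiff
    linarith [h1.1, h2.2]
  · have h6 := negLogPlus_sub_le (a := σ + |τ|) (b := Δ + |τ|) (by linarith) (by linarith)
    have h7 : Real.log ((Δ + |τ|) / (σ + |τ|)) ≤ Real.log 3 := by
      refine Real.log_le_log (by positivity) ?_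
      rw [div_le_iff₀ (by linarith)]
      linarith
    unfold primeCosDiff
    linarith [h1.2, h2.1]
  · unfold primeCosDiff
    linarith [h3.1, h4.2]

lemma summable_primes_chord_pow {σ : ℝ} (hσ : 0 < σ) (t : ℝ) (k : ℕ) :
    Summable fun p : Nat.Primes => (p : ℝ) ^ (-1 - σ) * (chord (t * Real.log p) ^ 2) ^ k := by
  refine summable_primes_weight_mul hσ (B := (2 ^ 2) ^ k) fun p => ?_
  rw [abs_of_nonneg (by positivity)]
  exact pow_le_pow_left₀ (by positivity)
    (pow_le_pow_left₀ (chord_nonneg _) (chord_le_two _) 2) k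

lemma exists_tsum_chord_pair_le {k : ℕ} (hk : 1 ≤ k) {ε : ℝ} (hε : 0 < ε) :
    ∃ K : ℝ, 0 ≤ K ∧ ∀ σ W u v : ℝ, 0 < σ → σ ≤ 2 → 1 ≤ W → 0 ≤ u → u ≤ 2 * W → 0 ≤ v →
      v ≤ 2 * W →
      ∑' p : Nat.Primes, (p : ℝ) ^ (-1 - σ) *
          (chord (σ * u * Real.log p) ^ k * chord (σ * v * Real.log p) ^ k) ≤
        (2 * k).choose k * (negLogPlus σ - negLogPlus (σ * (3 * W))) -
          pairGain k * (negLogPlus σ - negLogPlus (σ * (1 + |u - v|))) + ε * Real.log W + K := by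
  obtain ⟨b, hb, hpt⟩ := exists_pow_mul_pow_le hk
  have hg0 : 0 ≤ pairGain k := by unfold pairGain; split_ifs <;> positivity
  obtain ⟨K1, hK1, hP⟩ := exists_tsum_chord_pow_le hk (ε := ε / 2) (by positivity)
  obtain ⟨K2, hK2, hD⟩ := exists_primeCosDiff_bound (ε := ε / (2 * (pairGain k + 12 * b + 1)))
    (by positivity) (c := 8) (by norm_num)
  refine ⟨K1 + (pairGain k + 12 * b + 1) * K2, by positivity, ?_⟩
  intro σ W u v hσ hσ2 hW hu huW hv hvW
  have hlW := Real.log_nonneg hW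
  set Δ := σ * (1 + |u - v|) with hΔ
  have hδ := abs_nonneg (u - v)
  have hσΔ : σ ≤ Δ := by nlinarith
  have hΔ0 : 0 < Δ := hσ.trans_le hσΔ
  set s := σ * u with hs
  set t := σ * v with ht
  have hs0 : 0 ≤ s := by positivity
  have ht0 : 0 ≤ t := by positivity
  have hsW : s ≤ 4 * W := by nlinarith
  have htW : t ≤ 4 * W := by nlinarith
  have hst : |s - t| = Δ - σ := by
    rw [hs, ht, ← mul_sub, abs_mul, abs_of_pos hσ, hΔ]
    ring
  have hDs := hD σ Δ (2 * s) W hσ hσΔ hW (by rw [abs_of_nonneg (by positivity)]; linarith)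
  have hDt := hD σ Δ (2 * t) W hσ hσΔ hW (by rw [abs_of_nonneg (by positivity)]; linarith)
  have hDp := hD σ Δ (s + t) W hσ hσΔ hW (by rw [abs_of_nonneg (by positivity)]; linarith)
  have hDm := hD σ Δ (s - t) W hσ hσΔ hW (by rw [abs_le]; constructor <;> linarith)
  have hDp2 := hDp.2.1 (by
    have := abs_sub_le_of_nonneg_of_le hs0 (le_add_of_nonneg_right ht0) ht0
      (le_add_of_nonneg_left hs0)
    rw [abs_of_nonneg (by positivity : 0 ≤ s + t)]
    linarith)
  have hDm2 := hDm.2.1 (by rw [hst]; linarith)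
  have hRHS := (((summable_primes_chord_pow hσ s k).hasSum.mul_left (1 / 2)).add
    ((summable_primes_chord_pow hσ t k).hasSum.mul_left (1 / 2))).sub
    (((hasSum_primeCosDiff hσ hΔ0 0).mul_left (pairGain k)).add
      (((((hasSum_primeCosDiff hσ hΔ0 (2 * s)).mul_left 2).add
        ((hasSum_primeCosDiff hσ hΔ0 (2 * t)).mul_left 2)).sub
        (((hasSum_primeCosDiff hσ hΔ0 (s + t)).mul_left 4).add
          ((hasSum_primeCosDiff hσ hΔ0 (s - t)).mul_left 4))).mul_left b))
  have hsm : Summable fun p : Nat.Primes => (p : ℝ) ^ (-1 - σ) *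
      (chord (s * Real.log p) ^ k * chord (t * Real.log p) ^ k) := by
    refine summable_primes_weight_mul hσ (B := 2 ^ k * 2 ^ k) fun p => ?_
    have h1 := pow_le_pow_left₀ (chord_nonneg (s * Real.log p)) (chord_le_two _) k
    have h2 := pow_le_pow_left₀ (chord_nonneg (t * Real.log p)) (chord_le_two _) k
    have h3 := pow_nonneg (chord_nonneg (t * Real.log p)) k
    have h4 := pow_nonneg (chord_nonneg (s * Real.log p)) k
    rw [abs_of_nonneg (by positivity)]
    exact mul_le_mul h1 h2 h3 (by positivity)
  have hle := hasSum_le (fun p => ?_) hsm.hasSum hRHS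
  · refine hle.trans ?_
    have hPs := hP σ s W hσ hs0 hW hsW
    have hPt := hP σ t W hσ ht0 hW htW
    have hNs := negLogPlus_anti (a := σ + s) (b := σ * (3 * W)) (by positivity)
      (by rw [hs]; nlinarith)
    have hNt := negLogPlus_anti (a := σ + t) (b := σ * (3 * W)) (by positivity)
      (by rw [ht]; nlinarith)
    have hC : (0 : ℝ) ≤ (2 * k).choose k := by positivity
    have hNs2 := mul_le_mul_of_nonneg_left (sub_le_sub_left hNs (negLogPlus σ)) hC
    have hNt2 := mul_le_mul_of_nonneg_left (sub_le_sub_left hNt (negLogPlus σ)) hC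
    have hg := mul_le_mul_of_nonneg_left hDs.2.2 hg0
    set E := ε / (2 * (pairGain k + 12 * b + 1)) * Real.log W + K2 with hE
    have hE0 : 0 ≤ E := by positivity
    have hb1 : b * (-(12 * E)) ≤ b * (2 * primeCosDiff σ Δ (2 * s) + 2 * primeCosDiff σ Δ (2 * t) -
        (4 * primeCosDiff σ Δ (s + t) + 4 * primeCosDiff σ Δ (s - t))) :=
      mul_le_mul_of_nonneg_left (by linarith [hDs.1, hDt.1]) hb
    have hEE : (pairGain k + 12 * b + 1) * E =
        ε / 2 * Real.log W + (pairGain k + 12 * b + 1) * K2 := by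
      rw [hE]
      field_simp
    rw [mul_sub (pairGain k)] at hg
    have hEE2 : (pairGain k + 12 * b + 1) * E = pairGain k * E + b * (12 * E) + E := by ring
    rw [mul_neg] at hb1
    linarith
  · have h := hpt _ _ (chord_nonneg (s * Real.log p)) (chord_nonneg (t * Real.log p))
      (chord_le_two _) (chord_le_two _)
    have hw := prime_rpow_anti hσΔ p
    have hw2 : 0 ≤ (p : ℝ) ^ (-1 - Δ) := by positivity
    have hZ := chord_sq_sub_sq (s * Real.log p) (t * Real.log p)
    rw [← add_mul, ← sub_mul, ← mul_assoc 2 s, ← mul_assoc 2 t] at hZ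
    simp only [zero_mul, Real.cos_zero, mul_one]
    set w1 := (p : ℝ) ^ (-1 - σ)
    set w2 := (p : ℝ) ^ (-1 - Δ)
    set m := pairGain k + b * ((chord (s * Real.log p) ^ 2 - chord (t * Real.log p) ^ 2) ^ 2 - 4)
      with hm
    have hm0 := le_max_left 0 m
    have hm1 := le_max_right 0 m
    generalize max 0 m = M at h hm0 hm1
    have h1 : (w1 - w2) * m ≤ w1 * M :=
      (mul_le_mul_of_nonneg_left hm1 (by linarith)).trans
        (mul_le_mul_of_nonneg_right (by linarith) hm0)
    have h2 := mul_le_mul_of_nonneg_left h (hw2.trans hw)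
    rw [hm, hZ] at h1
    linarith

lemma hasSum_chord_triple {σ Δ : ℝ} (hσ : 0 < σ) (hΔ0 : 0 < Δ) (r s t : ℝ) :
    HasSum (fun p : Nat.Primes => ((p : ℝ) ^ (-1 - σ) - (p : ℝ) ^ (-1 - Δ)) *
        ((chord (r * Real.log p) ^ 2 - chord (s * Real.log p) ^ 2) ^ 2 *
          chord (t * Real.log p) ^ 2))
      (primeCosDiff σ Δ 0 * 8 + primeCosDiff σ Δ (2 * r) * 4 + primeCosDiff σ Δ (2 * s) * 4 -
        primeCosDiff σ Δ (r + s) * 8 - primeCosDiff σ Δ (r - s) * 8 - primeCosDiff σ Δ t * 8 -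
        primeCosDiff σ Δ (2 * r + t) * 2 - primeCosDiff σ Δ (2 * r - t) * 2 -
        primeCosDiff σ Δ (2 * s + t) * 2 - primeCosDiff σ Δ (2 * s - t) * 2 +
        primeCosDiff σ Δ (r + s + t) * 4 + primeCosDiff σ Δ (r + s - t) * 4 +
        primeCosDiff σ Δ (r - s + t) * 4 + primeCosDiff σ Δ (r - s - t) * 4) := by
  have D := fun τ c => (hasSum_primeCosDiff hσ hΔ0 τ).mul_right c
  have h := (((((((((((((D 0 8).add (D (2 * r) 4)).add (D (2 * s) 4)).sub
    (D (r + s) 8)).sub (D (r - s) 8)).sub (D t 8)).sub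
    (D (2 * r + t) 2)).sub (D (2 * r - t) 2)).sub
    (D (2 * s + t) 2)).sub (D (2 * s - t) 2)).add
    (D (r + s + t) 4)).add (D (r + s - t) 4)).add
    (D (r - s + t) 4)).add (D (r - s - t) 4)
  refine h.congr_fun fun p => ?_
  have hZ := chord_sq_sub_sq_mul (r * Real.log p) (s * Real.log p) (t * Real.log p)
  simp only [← mul_assoc, ← add_mul, ← sub_mul] at hZ
  rw [hZ, zero_mul, Real.cos_zero]
  ring

lemma exists_le_hasSum_chord_triple {ε : ℝ} (hε : 0 < ε) :
    ∃ K : ℝ, 0 ≤ K ∧ ∀ σ Δ W r s t : ℝ, 0 < σ → σ ≤ Δ → 1 ≤ W → 0 ≤ r → r ≤ 4 * W → 0 ≤ s →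
      s ≤ 4 * W → 0 ≤ t → t ≤ 4 * W → |r - s| = Δ - σ → Δ ≤ 2 * (σ + t) →
      ∃ S : ℝ, HasSum (fun p : Nat.Primes => ((p : ℝ) ^ (-1 - σ) - (p : ℝ) ^ (-1 - Δ)) *
        ((chord (r * Real.log p) ^ 2 - chord (s * Real.log p) ^ 2) ^ 2 *
          chord (t * Real.log p) ^ 2)) S ∧
        4 * (negLogPlus σ - negLogPlus Δ) - (ε * Real.log W + K) ≤ S := by
  obtain ⟨K2, hK2, hD⟩ := exists_primeCosDiff_bound (ε := ε / 60)
    (by positivity) (c := 12) (by norm_num)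
  refine ⟨60 * K2, by positivity, ?_⟩
  intro σ Δ W r s t hσ hσΔ hW a1 a2 a3 a4 a5 a6 hbc hΔd
  have hlW := Real.log_nonneg hW
  refine ⟨_, hasSum_chord_triple hσ (hσ.trans_le hσΔ) r s t, ?_⟩
  have B := fun τ (h1 : -(12 * W) ≤ τ) (h2 : τ ≤ 12 * W) =>
    hD σ Δ τ W hσ hσΔ hW (abs_le.mpr ⟨h1, h2⟩)
  have l1 := (B (2 * r) (by linarith) (by linarith)).1
  have l2 := (B (2 * s) (by linarith) (by linarith)).1
  have l3 := (B (r + s + t) (by linarith) (by linarith)).1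
  have l4 := (B (r + s - t) (by linarith) (by linarith)).1
  have l5 := (B (r - s + t) (by linarith) (by linarith)).1
  have l6 := (B (r - s - t) (by linarith) (by linarith)).1
  have u1 := (B (r + s) (by linarith) (by linarith)).2.1 (by
    have h := abs_sub_le_of_nonneg_of_le a1 (le_add_of_nonneg_right a3) a3
      (le_add_of_nonneg_left a1)
    rw [abs_of_nonneg (by linarith : 0 ≤ r + s)]
    linarith)
  have u2 := (B (r - s) (by linarith) (by linarith)).2.1 (by rw [hbc]; linarith)
  have u3 := (B t (by linarith) (by linarith)).2.1 (by rw [abs_of_nonneg a5]; exact hΔd)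
  have u4 := (B (2 * r + t) (by linarith) (by linarith)).2.1 (by
    rw [abs_of_nonneg (by linarith)]
    linarith)
  have u5 := (B (2 * s + t) (by linarith) (by linarith)).2.1 (by
    rw [abs_of_nonneg (by linarith)]
    linarith)
  have z1 := primeCosDiff_le_zero_arg hσ hσΔ (2 * r - t)
  have z2 := primeCosDiff_le_zero_arg hσ hσΔ (2 * s - t)
  have z0 := (B t (by linarith) (by linarith)).2.2
  have hE : ε * Real.log W + 60 * K2 = 60 * (ε / 60 * Real.log W + K2) := by ring
  have hE0 : 0 ≤ ε / 60 * Real.log W + K2 := by positivity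
  rw [hE]
  linarith

lemma exists_tsum_chord_quad_le {ε : ℝ} (hε : 0 < ε) :
    ∃ K : ℝ, 0 ≤ K ∧ ∀ σ W a b c d : ℝ, 0 < σ → σ ≤ 2 → 1 ≤ W → 0 ≤ a → a ≤ 2 * W → 0 ≤ b →
      b ≤ 2 * W → 0 ≤ c → c ≤ 2 * W → 0 ≤ d → d ≤ 2 * W → |b - c| ≤ 1 + 2 * d →
      ∑' p : Nat.Primes, (p : ℝ) ^ (-1 - σ) *
          (chord (σ * a * Real.log p) * chord (σ * b * Real.log p) *
            (chord (σ * c * Real.log p) * chord (σ * d * Real.log p))) ≤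
        6 * (negLogPlus σ - negLogPlus (σ * (3 * W))) -
          1 / 2 * ((negLogPlus σ - negLogPlus (σ * (1 + |a - b|))) +
            (negLogPlus σ - negLogPlus (σ * (1 + |c - d|))) +
            (negLogPlus σ - negLogPlus (σ * (1 + |a - c|))) +
            (negLogPlus σ - negLogPlus (σ * (1 + |b - d|)))) -
          1 / 8 * (negLogPlus σ - negLogPlus (σ * (1 + |b - c|))) + ε * Real.log W + K := by
  obtain ⟨K1, hK1, hP⟩ := exists_tsum_chord_pair_le (k := 2) (by norm_num)
    (ε := ε / 2) (by positivity)
  obtain ⟨K2, hK2, hD⟩ := exists_le_hasSum_chord_triple (ε := ε / 2) (by positivity)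
  refine ⟨K1 + K2, by positivity, ?_⟩
  intro σ W a b c d hσ hσ2 hW ha haW hb hbW hc hcW hd hdW hbcd
  have hlW := Real.log_nonneg hW
  have hab := hP σ W a b hσ hσ2 hW ha haW hb hbW
  have hcd := hP σ W c d hσ hσ2 hW hc hcW hd hdW
  have hac := hP σ W a c hσ hσ2 hW ha haW hc hcW
  have hbd := hP σ W b d hσ hσ2 hW hb hbW hd hdW
  have hg2 : pairGain 2 = 2 := by norm_num [pairGain]
  have hch : (((2 * 2).choose 2 : ℕ) : ℝ) = 6 := by norm_num [Nat.choose]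
  rw [hg2, hch] at hab hcd hac hbd
  set Δ := σ * (1 + |b - c|) with hΔ
  have hδ := abs_nonneg (b - c)
  have hσΔ : σ ≤ Δ := by nlinarith
  have hΔ0 : 0 < Δ := hσ.trans_le hσΔ
  have bd : ∀ x : ℝ, 0 ≤ x → x ≤ 2 * W → 0 ≤ σ * x ∧ σ * x ≤ 4 * W := fun x h0 h1 =>
    ⟨by positivity, by nlinarith⟩
  have hxa := bd a ha haW
  have hxb := bd b hb hbW
  have hxc := bd c hc hcW
  have hxd := bd d hd hdW
  have hbc : |σ * b - σ * c| = Δ - σ := by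
    rw [← mul_sub, abs_mul, abs_of_pos hσ, hΔ]
    ring
  have hΔd : Δ ≤ 2 * (σ + σ * d) := by rw [hΔ]; nlinarith
  set q := σ * a
  set r := σ * b
  set s := σ * c
  set t := σ * d
  have sm : ∀ x y : ℝ, Summable fun p : Nat.Primes => (p : ℝ) ^ (-1 - σ) *
      (chord (x * Real.log p) ^ 2 * chord (y * Real.log p) ^ 2) := by
    intro x y
    refine summable_primes_weight_mul hσ (B := 2 ^ 2 * 2 ^ 2) fun p => ?_
    have h1 := pow_le_pow_left₀ (chord_nonneg (x * Real.log p)) (chord_le_two _) 2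
    have h2 := pow_le_pow_left₀ (chord_nonneg (y * Real.log p)) (chord_le_two _) 2
    rw [abs_of_nonneg (by positivity)]
    exact mul_le_mul h1 h2 (by positivity) (by positivity)
  have sm4 : Summable fun p : Nat.Primes => (p : ℝ) ^ (-1 - σ) *
      (chord (q * Real.log p) * chord (r * Real.log p) *
        (chord (s * Real.log p) * chord (t * Real.log p))) := by
    refine summable_primes_weight_mul hσ (B := 2 * 2 * (2 * 2)) fun p => ?_
    have h0 := fun x => chord_nonneg x
    rw [abs_of_nonneg (mul_nonneg (mul_nonneg (h0 _) (h0 _)) (mul_nonneg (h0 _) (h0 _)))]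
    exact mul_le_mul (mul_le_mul (chord_le_two _) (chord_le_two _) (h0 _) (by norm_num))
      (mul_le_mul (chord_le_two _) (chord_le_two _) (h0 _) (by norm_num))
      (mul_nonneg (h0 _) (h0 _)) (by norm_num)
  obtain ⟨S, hS, hS2⟩ := hD σ Δ W r s t hσ hσΔ hW hxb.1 hxb.2 hxc.1 hxc.2 hxd.1 hxd.2 hbc hΔd
  have hRHS := (((((sm q r).hasSum.add (sm s t).hasSum).add (sm q s).hasSum).add
    (sm r t).hasSum).mul_left (1 / 4)).sub (hS.mul_left (1 / 32))
  have hle := hasSum_le (fun p => ?_) sm4.hasSum hRHS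
  · refine hle.trans ?_
    have hεW : 0 ≤ ε * Real.log W := by positivity
    linarith
  · have h := mul_four_le (a := chord (q * Real.log p)) (d := chord (t * Real.log p))
      (chord_nonneg (r * Real.log p)) (chord_nonneg (s * Real.log p)) (chord_le_two _)
      (chord_le_two _)
    have hw := prime_rpow_anti hσΔ p
    have hw2 : 0 ≤ (p : ℝ) ^ (-1 - Δ) := by positivity
    have hm0 : 0 ≤ (chord (r * Real.log p) ^ 2 - chord (s * Real.log p) ^ 2) ^ 2 *
      chord (t * Real.log p) ^ 2 := by positivity
    set w1 := (p : ℝ) ^ (-1 - σ)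
    set w2 := (p : ℝ) ^ (-1 - Δ)
    set m := (chord (r * Real.log p) ^ 2 - chord (s * Real.log p) ^ 2) ^ 2 *
      chord (t * Real.log p) ^ 2
    have h1 : (w1 - w2) * m ≤ w1 * m := mul_le_mul_of_nonneg_right (by linarith) hm0
    have h2 := mul_le_mul_of_nonneg_left h (hw2.trans hw)
    linarith

lemma exists_sum_rankin_of_tsum_le {B l B' : ℝ} (hB : 1 ≤ B) (hl1 : 1 ≤ l) (hl : l ^ 4 ≤ 2)
    (hB' : 0 ≤ B') :
    ∃ K : ℝ, 0 ≤ K ∧ ∀ (x R L : ℝ) (G Y : ℕ → ℝ), 2 ≤ R → R ≤ x → (∀ p, 0 ≤ G p) →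
      (∀ p, G p ≤ B) → (∀ p : ℕ, p.Prime → 0 ≤ Y p) → (∀ p : ℕ, p.Prime → Y p ≤ B) →
      (∀ p : ℕ, p.Prime → G p ≤ Y p + B' * (1 - (p : ℝ) ^ (-(1 / Real.log R)))) →
      ∑' p : Nat.Primes, (p : ℝ) ^ (-1 - 1 / Real.log R) * Y p ≤ L →
      ∑ n ∈ Icc 1 ⌊x⌋₊, l ^ bigOmega n R *
          ∏ p ∈ n.primeFactors.filter (fun p : ℕ => (p : ℝ) ≤ R), G p ≤
        K * (x / Real.log R) * Real.exp (l * L) := by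
  obtain ⟨K1, hK1, h1⟩ := exists_sum_rankin_le B l hB hl1 hl
  obtain ⟨K2, hK2, h2⟩ := exists_sum_primesUpTo_div_le
  refine ⟨K1 * Real.exp (l * ((B + B') * K2)), by positivity, ?_⟩
  intro x R L G Y hR hx hG0 hGB hY0 hYB hGY hL
  have hlog : 0 < Real.log R := Real.log_pos (by linarith)
  refine (h1 x R G hR hx hG0 hGB).trans ?_
  have h := h2 R G Y B B' hR hB' hY0 hYB hGY
  have hle : l * ∑ p ∈ primesUpTo R, G p / p ≤ l * ((B + B') * K2) + l * L := by
    rw [← mul_add]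
    exact mul_le_mul_of_nonneg_left (by linarith) (by linarith)
  have hx0 : 0 ≤ K1 * (x / Real.log R) := by
    have : 0 ≤ x := by linarith
    positivity
  calc _ ≤ K1 * (x / Real.log R) * Real.exp (l * ((B + B') * K2) + l * L) :=
        mul_le_mul_of_nonneg_left (Real.exp_le_exp.mpr hle) hx0
    _ = _ := by rw [Real.exp_add]; ring

lemma negLogPlus_gain_nonneg {σ a : ℝ} (hσ : 0 < σ) (ha : 1 ≤ a) :
    0 ≤ negLogPlus σ - negLogPlus (σ * a) :=
  sub_nonneg.mpr (negLogPlus_anti hσ (by nlinarith))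

lemma log_sub_negLogPlus_gain_le {σ a v : ℝ} (hσ : 0 < σ) (ha : 1 ≤ a) (hav : a ≤ v) :
    Real.log a - (negLogPlus σ - negLogPlus (σ * a)) ≤
      Real.log v - (negLogPlus σ - negLogPlus (σ * v)) := by
  have ha0 : 0 < a := by linarith
  have h := negLogPlus_sub_le (mul_pos hσ ha0) (mul_le_mul_of_nonneg_left hav hσ.le)
  rw [mul_div_mul_left _ _ hσ.ne', Real.log_div (by linarith) ha0.ne'] at h
  linarith

lemma one_div_log_le_two {R : ℝ} (hR : 2 ≤ R) : 0 < 1 / Real.log R ∧ 1 / Real.log R ≤ 2 := by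
  have h := Real.log_le_log (by norm_num) hR
  have h2 := Real.log_two_gt_d9
  refine ⟨by have : 0 < Real.log R := by linarith
             positivity, ?_⟩
  rw [div_le_iff₀ (by linarith)]
  linarith

lemma one_sub_rpow_nonneg {p : ℕ} (hp : 0 < p) {σ : ℝ} (hσ : 0 ≤ σ) :
    0 ≤ 1 - (p : ℝ) ^ (-σ) :=
  sub_nonneg.mpr (Real.rpow_le_one_of_one_le_of_nonpos (by exact_mod_cast hp) (by linarith))

/-- Rankin-weighted mixed moment of two Euler products at different heights. -/
lemma exists_sum_eulerNorm_pair_le {k : ℕ} (hk : 1 ≤ k) {l E β : ℝ} (hl1 : 1 ≤ l)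
    (hl : l ^ 4 ≤ 2) (hE : l * (2 * k).choose k < E) (hβ0 : 0 ≤ β) (hβ : β ≤ pairGain k)
    (hβC : β ≤ (2 * k).choose k) :
    ∃ K : ℝ, 0 ≤ K ∧ ∀ x R W u v : ℝ, 2 ≤ R → R ≤ x → 1 ≤ W → 0 ≤ u → u ≤ 2 * W → 0 ≤ v →
      v ≤ 2 * W →
      ∑ n ∈ Icc 1 ⌊x⌋₊, l ^ bigOmega n R *
          (eulerNorm n R (1 / Real.log R * u) ^ k * eulerNorm n R (1 / Real.log R * v) ^ k) ≤
        K * (x / Real.log R) * (W ^ E * (1 + |u - v|) ^ (-β)) := by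
  set C : ℝ := (((2 * k).choose k : ℕ) : ℝ) with hC
  have hC0 : 0 ≤ C := by positivity
  have hl0 : 0 < l := by linarith
  have hε : 0 < E / l - C := by
    rw [sub_pos, lt_div_iff₀ hl0]
    linarith
  obtain ⟨K1, hK1, h1⟩ := exists_tsum_chord_pair_le hk hε
  obtain ⟨K2, hK2, h2⟩ := exists_sum_rankin_of_tsum_le (B := 2 ^ k * 2 ^ k) (l := l)
    (B' := 2 ^ k * (k * 2 ^ (k - 1) * 1) + 2 ^ k * (k * 2 ^ (k - 1) * 1))
    (by have : (1 : ℝ) ≤ 2 ^ k := one_le_pow₀ (by norm_num)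
        nlinarith) hl1 hl (by positivity)
  refine ⟨K2 * Real.exp (l * (C * Real.log 3 + K1)), by positivity, ?_⟩
  intro x R W u v hR hx hW hu huW hv hvW
  obtain ⟨hσ0, hσ2⟩ := one_div_log_le_two hR
  have hx0 : 0 ≤ x := by linarith
  have hlog : 0 < Real.log R := Real.log_pos (by linarith)
  set σ := 1 / Real.log R with hσ
  have hδ : |u - v| ≤ 2 * W := abs_sub_le_of_nonneg_of_le hu huW hv hvW
  have hδ0 := abs_nonneg (u - v)
  set L := C * Real.log (3 * W) - β * Real.log (1 + |u - v|) + (E / l - C) * Real.log W + K1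
    with hL
  have hpow : ∀ t p, eulerFactor σ t p ^ k ≤ 2 ^ k := fun t p =>
    pow_le_pow_left₀ (eulerFactor_nonneg _ _ _) (eulerFactor_le_two hσ0 _ _) k
  have hcpow : ∀ t, chord t ^ k ≤ 2 ^ k := fun t =>
    pow_le_pow_left₀ (chord_nonneg _) (chord_le_two _) k
  have hen : ∀ t p, 0 ≤ eulerFactor σ t p ^ k := fun t p => pow_nonneg (eulerFactor_nonneg _ _ _) _
  have hcn : ∀ t, 0 ≤ chord t ^ k := fun t => pow_nonneg (chord_nonneg _) _
  have hep : ∀ t (p : ℕ), p.Prime → eulerFactor σ t p ^ k ≤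
      chord (t * Real.log p) ^ k + k * 2 ^ (k - 1) * 1 * (1 - (p : ℝ) ^ (-σ)) := by
    intro t p hp
    obtain ⟨g1, g2⟩ := eulerFactor_le hp.pos hσ0.le t
    exact pow_le_pow_add_mul (eulerFactor_nonneg _ _ _) (chord_nonneg _)
      (one_sub_rpow_nonneg hp.pos hσ0.le) g1 (chord_le_two _) zero_le_one (by linarith) k
  have h := h2 x R L (fun p => eulerFactor σ (σ * u) p ^ k * eulerFactor σ (σ * v) p ^ k)
    (fun p => chord (σ * u * Real.log p) ^ k * chord (σ * v * Real.log p) ^ k) hR hx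
    (fun p => mul_nonneg (hen _ _) (hen _ _))
    (fun p => mul_le_mul (hpow _ _) (hpow _ _) (hen _ _) (by positivity))
    (fun p _ => mul_nonneg (hcn _) (hcn _))
    (fun p _ => mul_le_mul (hcpow _) (hcpow _) (hcn _) (by positivity))
    (fun p hp => mul_le_mul_add_mul (hen _ _) (hcn _) (by positivity) (by positivity)
      (one_sub_rpow_nonneg hp.pos hσ0.le) (hcpow _) (hpow _ _) (hep _ p hp) (hep _ p hp))
    (by
      refine (h1 σ W u v hσ0 hσ2 hW hu huW hv hvW).trans ?_
      have g1 := negLogPlus_gain_nonneg (a := 1 + |u - v|) hσ0 (by linarith)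
      have g2 := log_sub_negLogPlus_gain_le (a := 1 + |u - v|) (v := 3 * W) hσ0 (by linarith)
        (by linarith)
      have g3 := log_sub_negLogPlus_gain_le (a := 1) (v := 3 * W) hσ0 le_rfl (by linarith)
      rw [Real.log_one, mul_one, sub_self, sub_zero] at g3
      have g4 := mul_le_mul_of_nonneg_left g2 hβ0
      have g5 := mul_le_mul_of_nonneg_right hβ g1
      have g6 := mul_le_mul_of_nonneg_right hβC g3
      rw [hL]
      linarith)
  have hexp : Real.exp (l * L) ≤
      Real.exp (l * (C * Real.log 3 + K1)) * (W ^ E * (1 + |u - v|) ^ (-β)) := by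
    rw [Real.rpow_def_of_pos (by linarith), Real.rpow_def_of_pos (by linarith), ← Real.exp_add,
      ← Real.exp_add]
    refine Real.exp_le_exp.mpr ?_
    rw [hL, Real.log_mul (by norm_num) (by linarith)]
    have q1 : l * (E / l - C) = E - l * C := by field_simp
    have q2 : 0 ≤ (l - 1) * (β * Real.log (1 + |u - v|)) :=
      mul_nonneg (by linarith) (mul_nonneg hβ0 (Real.log_nonneg (by linarith)))
    have q3 : l * (C * (Real.log 3 + Real.log W) - β * Real.log (1 + |u - v|) +
        (E / l - C) * Real.log W + K1) = l * (C * Real.log 3 + K1) + l * C * Real.log W -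
        l * (β * Real.log (1 + |u - v|)) + l * (E / l - C) * Real.log W := by ring
    rw [q3, q1]
    linarith
  calc _ = ∑ n ∈ Icc 1 ⌊x⌋₊, l ^ bigOmega n R *
        ∏ p ∈ n.primeFactors.filter (fun p : ℕ => (p : ℝ) ≤ R),
          eulerFactor σ (σ * u) p ^ k * eulerFactor σ (σ * v) p ^ k := by
        refine sum_congr rfl fun n _ => ?_
        rw [eulerNorm_eq_prod, eulerNorm_eq_prod, prod_mul_distrib, prod_pow, prod_pow]
    _ ≤ K2 * (x / Real.log R) * Real.exp (l * L) := h
    _ ≤ K2 * (x / Real.log R) * (Real.exp (l * (C * Real.log 3 + K1)) *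
          (W ^ E * (1 + |u - v|) ^ (-β))) :=
        mul_le_mul_of_nonneg_left hexp (by positivity)
    _ = _ := by ring

lemma exists_sum_eulerNorm_quad_le {l E : ℝ} (hl1 : 1 ≤ l) (hl : l ^ 4 ≤ 2) (hE : l * 6 < E) :
    ∃ K : ℝ, 0 ≤ K ∧ ∀ x R W a b c d : ℝ, 2 ≤ R → R ≤ x → 1 ≤ W → 0 ≤ a → a ≤ 2 * W → 0 ≤ b →
      b ≤ 2 * W → 0 ≤ c → c ≤ 2 * W → 0 ≤ d → d ≤ 2 * W → |b - c| ≤ 1 + 2 * d →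
      ∑ n ∈ Icc 1 ⌊x⌋₊, l ^ bigOmega n R *
          (eulerNorm n R (1 / Real.log R * a) * eulerNorm n R (1 / Real.log R * b) *
            (eulerNorm n R (1 / Real.log R * c) * eulerNorm n R (1 / Real.log R * d))) ≤
        K * (x / Real.log R) * (W ^ E * ((1 + |a - b|) ^ (-(1 / 2) : ℝ) *
          (1 + |c - d|) ^ (-(1 / 2) : ℝ) * (1 + |a - c|) ^ (-(1 / 2) : ℝ) *
          (1 + |b - d|) ^ (-(1 / 2) : ℝ) * (1 + |b - c|) ^ (-(1 / 8) : ℝ))) := by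
  have hl0 : 0 < l := by linarith
  have hε : 0 < E / l - 6 := by
    rw [sub_pos, lt_div_iff₀ hl0]
    linarith
  obtain ⟨K1, hK1, h1⟩ := exists_tsum_chord_quad_le hε
  obtain ⟨K2, hK2, h2⟩ := exists_sum_rankin_of_tsum_le (B := 2 * 2 * (2 * 2)) (l := l)
    (B' := 2 * 2 * (2 * 1 + 2 * 1) + 2 * 2 * (2 * 1 + 2 * 1)) (by norm_num) hl1 hl (by positivity)
  refine ⟨K2 * Real.exp (l * (6 * Real.log 3 + K1)), by positivity, ?_⟩
  intro x R W a b c d hR hx hW ha haW hb hbW hc hcW hd hdW hbcd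
  obtain ⟨hσ0, hσ2⟩ := one_div_log_le_two hR
  have hx0 : 0 ≤ x := by linarith
  have hlog : 0 < Real.log R := Real.log_pos (by linarith)
  set σ := 1 / Real.log R with hσ
  have hab : |a - b| ≤ 2 * W := abs_sub_le_of_nonneg_of_le ha haW hb hbW
  have hcd : |c - d| ≤ 2 * W := abs_sub_le_of_nonneg_of_le hc hcW hd hdW
  have hac : |a - c| ≤ 2 * W := abs_sub_le_of_nonneg_of_le ha haW hc hcW
  have hbd : |b - d| ≤ 2 * W := abs_sub_le_of_nonneg_of_le hb hbW hd hdW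
  have hbc : |b - c| ≤ 2 * W := abs_sub_le_of_nonneg_of_le hb hbW hc hcW
  have hab0 := abs_nonneg (a - b)
  have hcd0 := abs_nonneg (c - d)
  have hac0 := abs_nonneg (a - c)
  have hbd0 := abs_nonneg (b - d)
  have hbc0 := abs_nonneg (b - c)
  set D := 1 / 2 * Real.log (1 + |a - b|) + 1 / 2 * Real.log (1 + |c - d|) +
    1 / 2 * Real.log (1 + |a - c|) + 1 / 2 * Real.log (1 + |b - d|) +
    1 / 8 * Real.log (1 + |b - c|) with hD
  have hD0 : 0 ≤ D := by
    have e1 := Real.log_nonneg (by linarith : 1 ≤ 1 + |a - b|)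
    have e2 := Real.log_nonneg (by linarith : 1 ≤ 1 + |c - d|)
    have e3 := Real.log_nonneg (by linarith : 1 ≤ 1 + |a - c|)
    have e4 := Real.log_nonneg (by linarith : 1 ≤ 1 + |b - d|)
    have e5 := Real.log_nonneg (by linarith : 1 ≤ 1 + |b - c|)
    positivity
  set L := 6 * Real.log (3 * W) - D + (E / l - 6) * Real.log W + K1 with hL
  have hen : ∀ t p, 0 ≤ eulerFactor σ t p := fun t p => eulerFactor_nonneg _ _ _
  have he2 : ∀ t p, eulerFactor σ t p ≤ 2 := fun t p => eulerFactor_le_two hσ0 _ _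
  have hen2 : ∀ t u p, 0 ≤ eulerFactor σ t p * eulerFactor σ u p := fun t u p =>
    mul_nonneg (hen _ _) (hen _ _)
  have he4 : ∀ t u p, eulerFactor σ t p * eulerFactor σ u p ≤ 2 * 2 := fun t u p =>
    mul_le_mul (he2 _ _) (he2 _ _) (hen _ _) (by norm_num)
  have hcn2 : ∀ t u, 0 ≤ chord t * chord u := fun t u =>
    mul_nonneg (chord_nonneg _) (chord_nonneg _)
  have hc4 : ∀ t u, chord t * chord u ≤ 2 * 2 := fun t u =>
    mul_le_mul (chord_le_two _) (chord_le_two _) (chord_nonneg _) (by norm_num)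
  have hep : ∀ t (p : ℕ), p.Prime → eulerFactor σ t p ≤
      chord (t * Real.log p) + 1 * (1 - (p : ℝ) ^ (-σ)) := by
    intro t p hp
    have g2 := (eulerFactor_le hp.pos hσ0.le t).2
    linarith
  have hep2 : ∀ t u (p : ℕ), p.Prime → eulerFactor σ t p * eulerFactor σ u p ≤
      chord (t * Real.log p) * chord (u * Real.log p) +
        (2 * 1 + 2 * 1) * (1 - (p : ℝ) ^ (-σ)) := fun t u p hp =>
    mul_le_mul_add_mul (hen _ _) (chord_nonneg _) zero_le_one zero_le_one
      (one_sub_rpow_nonneg hp.pos hσ0.le) (chord_le_two _) (he2 _ _) (hep _ p hp) (hep _ p hp)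
  have h := h2 x R L (fun p => eulerFactor σ (σ * a) p * eulerFactor σ (σ * b) p *
      (eulerFactor σ (σ * c) p * eulerFactor σ (σ * d) p))
    (fun p => chord (σ * a * Real.log p) * chord (σ * b * Real.log p) *
      (chord (σ * c * Real.log p) * chord (σ * d * Real.log p))) hR hx
    (fun p => mul_nonneg (hen2 _ _ _) (hen2 _ _ _))
    (fun p => mul_le_mul (he4 _ _ _) (he4 _ _ _) (hen2 _ _ _) (by norm_num))
    (fun p _ => mul_nonneg (hcn2 _ _) (hcn2 _ _))
    (fun p _ => mul_le_mul (hc4 _ _) (hc4 _ _) (hcn2 _ _) (by norm_num))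
    (fun p hp => mul_le_mul_add_mul (hen2 _ _ _) (hcn2 _ _) (by norm_num) (by norm_num)
      (one_sub_rpow_nonneg hp.pos hσ0.le) (hc4 _ _) (he4 _ _ _) (hep2 _ _ p hp) (hep2 _ _ p hp))
    (by
      refine (h1 σ W a b c d hσ0 hσ2 hW ha haW hb hbW hc hcW hd hdW hbcd).trans ?_
      have g : ∀ z, 0 ≤ z → z ≤ 2 * W → _ := fun z h0 hz =>
        log_sub_negLogPlus_gain_le (a := 1 + z) (v := 3 * W) hσ0 (by linarith) (by linarith)
      have g1 := g _ hab0 hab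
      have g2 := g _ hcd0 hcd
      have g3 := g _ hac0 hac
      have g4 := g _ hbd0 hbd
      have g5 := g _ hbc0 hbc
      have g6 := g 0 le_rfl (by linarith)
      rw [add_zero, Real.log_one, mul_one, sub_self, sub_zero] at g6
      rw [hL, hD]
      linarith)
  have hexp : Real.exp (l * L) ≤ Real.exp (l * (6 * Real.log 3 + K1)) *
      (W ^ E * ((1 + |a - b|) ^ (-(1 / 2) : ℝ) *
          (1 + |c - d|) ^ (-(1 / 2) : ℝ) * (1 + |a - c|) ^ (-(1 / 2) : ℝ) *
          (1 + |b - d|) ^ (-(1 / 2) : ℝ) * (1 + |b - c|) ^ (-(1 / 8) : ℝ))) := by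
    rw [Real.rpow_def_of_pos (by linarith), Real.rpow_def_of_pos (by linarith),
      Real.rpow_def_of_pos (by linarith), Real.rpow_def_of_pos (by linarith),
      Real.rpow_def_of_pos (by linarith), Real.rpow_def_of_pos (by linarith), ← Real.exp_add,
      ← Real.exp_add, ← Real.exp_add, ← Real.exp_add, ← Real.exp_add, ← Real.exp_add]
    refine Real.exp_le_exp.mpr ?_
    have q1 : l * (E / l - 6) = E - l * 6 := by field_simp
    have q2 : 0 ≤ (l - 1) * D := mul_nonneg (by linarith) hD0
    have q3 : l * L = l * (6 * Real.log 3 + K1) + l * 6 * Real.log W -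
        l * D + l * (E / l - 6) * Real.log W := by
      rw [hL, Real.log_mul (by norm_num) (by linarith)]
      ring
    rw [q3, q1]
    linarith
  calc _ = ∑ n ∈ Icc 1 ⌊x⌋₊, l ^ bigOmega n R *
        ∏ p ∈ n.primeFactors.filter (fun p : ℕ => (p : ℝ) ≤ R),
          eulerFactor σ (σ * a) p * eulerFactor σ (σ * b) p *
            (eulerFactor σ (σ * c) p * eulerFactor σ (σ * d) p) := by
        refine sum_congr rfl fun n _ => ?_
        simp only [eulerNorm_eq_prod, prod_mul_distrib, ← hσ]
    _ ≤ K2 * (x / Real.log R) * Real.exp (l * L) := h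
    _ ≤ K2 * (x / Real.log R) * (Real.exp (l * (6 * Real.log 3 + K1)) * _) :=
        mul_le_mul_of_nonneg_left hexp (by positivity)
    _ = _ := by ring

/-- Sums of `(1 + |m - i|) ^ (-s)` over a set of integers within distance `W` of `i` are at most
`C * W ^ (1 + η - s)`. -/
def DecaySumBound (C η : ℝ) : Prop :=
  ∀ (s W : ℝ) (i : ℕ) (B : Finset ℕ), s ≤ 1 + η → 0 ≤ W → (∀ m ∈ B, 1 + |(m : ℝ) - i| ≤ W) →
    ∑ m ∈ B, (1 + |(m : ℝ) - i|) ^ (-s) ≤ C * W ^ (1 + η - s)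

lemma exists_sum_one_add_abs_sub_rpow_le {η : ℝ} (hη : 0 < η) :
    ∃ C : ℝ, 0 ≤ C ∧ DecaySumBound C η := by
  have hnat : Summable fun n : ℕ => (1 + |((n : ℤ) : ℝ)|) ^ (-(1 + η)) := by
    have h := (summable_nat_add_iff 1).mpr
      (Real.summable_nat_rpow.mpr (by linarith : -(1 + η) < -1))
    refine h.congr fun n => ?_
    have h0 : (0 : ℝ) ≤ n := Nat.cast_nonneg n
    push_cast
    rw [abs_of_nonneg h0, add_comm]
  have hs : Summable fun z : ℤ => (1 + |(z : ℝ)|) ^ (-(1 + η)) := by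
    refine Summable.of_nat_of_neg hnat ?_
    simpa using hnat
  refine ⟨∑' z : ℤ, (1 + |(z : ℝ)|) ^ (-(1 + η)), tsum_nonneg fun z => by positivity, ?_⟩
  intro s W i B hsη hW0 hW
  have hinj : Function.Injective fun m : ℕ => (m : ℤ) - i := fun a b h => by
    simpa using h
  have h1 : ∑ m ∈ B, (1 + |(m : ℝ) - i|) ^ (-(1 + η)) ≤
      ∑' z : ℤ, (1 + |(z : ℝ)|) ^ (-(1 + η)) := by
    have h := hs.sum_le_tsum (B.image fun m : ℕ => (m : ℤ) - i) fun _ _ => by positivity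
    rw [sum_image fun a _ b _ h => hinj h] at h
    simpa using h
  calc ∑ m ∈ B, (1 + |(m : ℝ) - i|) ^ (-s)
      ≤ ∑ m ∈ B, (1 + |(m : ℝ) - i|) ^ (-(1 + η)) * W ^ (1 + η - s) := by
        refine sum_le_sum fun m hm => ?_
        have hpos : 0 < 1 + |(m : ℝ) - i| := by positivity
        calc (1 + |(m : ℝ) - i|) ^ (-s) =
            (1 + |(m : ℝ) - i|) ^ (-(1 + η)) * (1 + |(m : ℝ) - i|) ^ (1 + η - s) := by
              rw [← Real.rpow_add hpos]
              congr 1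
              ring
          _ ≤ _ := mul_le_mul_of_nonneg_left
              (Real.rpow_le_rpow hpos.le (hW m hm) (by linarith)) (by positivity)
    _ = (∑ m ∈ B, (1 + |(m : ℝ) - i|) ^ (-(1 + η))) * W ^ (1 + η - s) := by rw [sum_mul]
    _ ≤ _ := mul_le_mul_of_nonneg_right h1 (Real.rpow_nonneg hW0 _)

lemma sum_mul_pow_le {ι : Type*} (s : Finset ι) (ω b : ι → ℝ) (hω : ∀ i ∈ s, 0 < ω i)
    (hb : ∀ i ∈ s, 0 ≤ b i) {n : ℕ} (hn : 1 ≤ n) :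
    (∑ i ∈ s, ω i * b i) ^ n ≤ (∑ i ∈ s, ω i) ^ (n - 1) * ∑ i ∈ s, ω i * b i ^ n := by
  rcases s.eq_empty_or_nonempty with rfl | hs
  · simp [show n ≠ 0 by omega]
  have hpos : 0 < ∑ i ∈ s, ω i := sum_pos hω hs
  have h := Real.pow_arith_mean_le_arith_mean_pow s (fun i => ω i / ∑ i ∈ s, ω i) b
    (fun i hi => (div_pos (hω i hi) hpos).le) (by rw [← sum_div, div_self hpos.ne']) hb n
  simp only [div_mul_eq_mul_div, ← sum_div] at h
  rw [div_pow, div_le_div_iff₀ (by positivity) hpos] at h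
  obtain ⟨m, rfl⟩ : ∃ m, n = m + 1 := ⟨n - 1, by omega⟩
  rw [Nat.add_sub_cancel]
  refine le_of_mul_le_mul_right ?_ hpos
  calc _ ≤ _ := h
    _ = _ := by ring

section Blocks

variable {ι : Type*} {S : Finset ι} {w : ι → ℝ} {e : ι → ℕ → ℝ} {C η W P β : ℝ} {B : Finset ℕ}

lemma sum_sum_one_add_abs_sub_rpow_le (hC0 : 0 ≤ C) (hC : DecaySumBound C η) (hW0 : 0 ≤ W)
    (hB : ∀ m ∈ B, ∀ m' ∈ B, 1 + |(m : ℝ) - m'| ≤ W) (hcard : (B.card : ℝ) ≤ W)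
    (hβ : β ≤ 1 + η) :
    ∑ m ∈ B, ∑ m' ∈ B, (1 + |(m' : ℝ) - m|) ^ (-β) ≤ W * (C * W ^ (1 + η - β)) := by
  calc _ ≤ ∑ m ∈ B, C * W ^ (1 + η - β) :=
        sum_le_sum fun m hm => hC β W m B hβ hW0 fun m' hm' => hB m' hm' m hm
    _ = B.card * (C * W ^ (1 + η - β)) := by rw [sum_const, nsmul_eq_mul]
    _ ≤ _ := mul_le_mul_of_nonneg_right hcard (mul_nonneg hC0 (Real.rpow_nonneg hW0 _))

lemma sum_mul_sum_sq_le_of_pair (hC0 : 0 ≤ C) (hC : DecaySumBound C η) (hW0 : 0 ≤ W)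
    (hP : 0 ≤ P) (hB : ∀ m ∈ B, ∀ m' ∈ B, 1 + |(m : ℝ) - m'| ≤ W) (hcard : (B.card : ℝ) ≤ W)
    (hβ : β ≤ 1 + η)
    (h : ∀ m ∈ B, ∀ m' ∈ B, ∑ n ∈ S, w n * (e n m' * e n m) ≤
      P * (1 + |(m' : ℝ) - m|) ^ (-β)) :
    ∑ n ∈ S, w n * (∑ m ∈ B, e n m) ^ 2 ≤ P * (W * (C * W ^ (1 + η - β))) := by
  calc ∑ n ∈ S, w n * (∑ m ∈ B, e n m) ^ 2
      = ∑ m ∈ B, ∑ m' ∈ B, ∑ n ∈ S, w n * (e n m' * e n m) := by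
        have hexpand : ∀ f : ℕ → ℝ, (∑ m ∈ B, f m) ^ 2 = ∑ m ∈ B, ∑ m' ∈ B, f m' * f m :=
          fun f => by rw [sq, sum_mul_sum, sum_comm]
        simp only [hexpand, mul_sum]
        rw [sum_comm]
        refine sum_congr rfl fun m _ => ?_
        rw [sum_comm]
    _ ≤ ∑ m ∈ B, ∑ m' ∈ B, P * (1 + |(m' : ℝ) - m|) ^ (-β) :=
        sum_le_sum fun m hm => sum_le_sum fun m' hm' => h m hm m' hm'
    _ = P * ∑ m ∈ B, ∑ m' ∈ B, (1 + |(m' : ℝ) - m|) ^ (-β) := by simp only [mul_sum]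
    _ ≤ _ := mul_le_mul_of_nonneg_left
        (sum_sum_one_add_abs_sub_rpow_le hC0 hC hW0 hB hcard hβ) hP

lemma sum_pow_le_sum_sum_of_decay {k : ℕ} (hk : 1 ≤ k) {s : ℝ} {e : ℕ → ℝ} (hC0 : 0 ≤ C)
    (hC : DecaySumBound C η) (hW0 : 0 ≤ W) (hB : ∀ m ∈ B, ∀ m' ∈ B, 1 + |(m : ℝ) - m'| ≤ W)
    (hs : s ≤ 1 + η) (hsβ : s * (2 * k - 1) = β - 1) (he : ∀ m, 0 ≤ e m) :
    (∑ m ∈ B, e m) ^ (2 * k) ≤ (C * W ^ (1 + η - s)) ^ (2 * k - 1) *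
      ∑ m ∈ B, ∑ m' ∈ B, e m' ^ k * e m ^ k * (1 + |(m' : ℝ) - m|) ^ (β - 1) := by
  have hD0 : 0 ≤ C * W ^ (1 + η - s) := mul_nonneg hC0 (Real.rpow_nonneg hW0 _)
  have hpos : ∀ m m' : ℕ, 0 < 1 + |(m' : ℝ) - m| := fun m m' => by positivity
  have hterm : ∀ m m' : ℕ, 0 ≤ e m' ^ k * e m ^ k * (1 + |(m' : ℝ) - m|) ^ (β - 1) := fun m m' =>
    mul_nonneg (mul_nonneg (pow_nonneg (he _) _) (pow_nonneg (he _) _))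
      (Real.rpow_nonneg (hpos _ _).le _)
  rcases B.eq_empty_or_nonempty with rfl | hne
  · rw [sum_empty, zero_pow (by omega), sum_empty, mul_zero]
  obtain ⟨m, hm, hmax⟩ := B.exists_max_image e hne
  have h := sum_mul_pow_le B (fun m' : ℕ => (1 + |(m' : ℝ) - m|) ^ (-s))
    (fun m' => e m' * (1 + |(m' : ℝ) - m|) ^ s) (fun m' _ => Real.rpow_pos_of_pos (hpos _ _) _)
    (fun m' _ => mul_nonneg (he _) (Real.rpow_nonneg (hpos _ _).le _)) (n := 2 * k) (by omega)
  have hl : ∑ m' ∈ B, (1 + |(m' : ℝ) - m|) ^ (-s) * (e m' * (1 + |(m' : ℝ) - m|) ^ s) =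
      ∑ m' ∈ B, e m' := by
    refine sum_congr rfl fun m' _ => ?_
    rw [mul_left_comm, ← Real.rpow_add (hpos m m'), neg_add_cancel, Real.rpow_zero, mul_one]
  rw [hl] at h
  refine h.trans ?_
  refine mul_le_mul ?_ ?_ (sum_nonneg fun m' _ => mul_nonneg (Real.rpow_nonneg (hpos _ _).le _)
    (pow_nonneg (mul_nonneg (he _) (Real.rpow_nonneg (hpos _ _).le _)) _)) (pow_nonneg hD0 _)
  · exact pow_le_pow_left₀ (sum_nonneg fun m' _ => Real.rpow_nonneg (hpos _ _).le _)
      (hC s W m B hs hW0 fun m' hm' => hB m' hm' m hm) _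
  · calc _ ≤ ∑ m' ∈ B, e m' ^ k * e m ^ k * (1 + |(m' : ℝ) - m|) ^ (β - 1) := by
          refine sum_le_sum fun m' hm' => ?_
          rw [mul_pow, mul_left_comm, two_mul, pow_add (e m'), ← Real.rpow_natCast
            ((1 + |(m' : ℝ) - m|) ^ s), ← Real.rpow_mul (hpos m m').le,
            ← Real.rpow_add (hpos m m')]
          have hexp : -s + s * ((k + k : ℕ) : ℝ) = β - 1 := by
            push_cast
            rw [← hsβ]
            ring
          rw [hexp]
          refine mul_le_mul_of_nonneg_right ?_ (Real.rpow_nonneg (hpos _ _).le _)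
          exact mul_le_mul_of_nonneg_left (pow_le_pow_left₀ (he _) (hmax m' hm') _)
            (pow_nonneg (he _) _)
      _ ≤ _ := single_le_sum (f := fun m => ∑ m' ∈ B, e m' ^ k * e m ^ k *
            (1 + |(m' : ℝ) - m|) ^ (β - 1)) (fun m _ => sum_nonneg fun m' _ => hterm m m') hm

lemma sum_mul_sum_pow_le_of_pair {k : ℕ} (hk : 1 ≤ k) {s : ℝ} (hC0 : 0 ≤ C)
    (hC : DecaySumBound C η) (hη : 0 ≤ η) (hW0 : 0 ≤ W) (hP : 0 ≤ P)
    (hB : ∀ m ∈ B, ∀ m' ∈ B, 1 + |(m : ℝ) - m'| ≤ W) (hcard : (B.card : ℝ) ≤ W)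
    (hs : s ≤ 1 + η) (hsβ : s * (2 * k - 1) = β - 1) (he : ∀ n m, 0 ≤ e n m)
    (hw : ∀ n ∈ S, 0 ≤ w n)
    (h : ∀ m ∈ B, ∀ m' ∈ B, ∑ n ∈ S, w n * (e n m' ^ k * e n m ^ k) ≤
      P * (1 + |(m' : ℝ) - m|) ^ (-β)) :
    ∑ n ∈ S, w n * (∑ m ∈ B, e n m) ^ (2 * k) ≤
      (C * W ^ (1 + η - s)) ^ (2 * k - 1) * (P * (W * (C * W ^ η))) := by
  have hD0 : 0 ≤ (C * W ^ (1 + η - s)) ^ (2 * k - 1) :=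
    pow_nonneg (mul_nonneg hC0 (Real.rpow_nonneg hW0 _)) _
  have hpos : ∀ m m' : ℕ, 0 < 1 + |(m' : ℝ) - m| := fun m m' => by positivity
  calc ∑ n ∈ S, w n * (∑ m ∈ B, e n m) ^ (2 * k)
      ≤ ∑ n ∈ S, w n * ((C * W ^ (1 + η - s)) ^ (2 * k - 1) *
        ∑ m ∈ B, ∑ m' ∈ B, e n m' ^ k * e n m ^ k * (1 + |(m' : ℝ) - m|) ^ (β - 1)) :=
        sum_le_sum fun n hn => mul_le_mul_of_nonneg_left
          (sum_pow_le_sum_sum_of_decay hk hC0 hC hW0 hB hs hsβ (he n)) (hw n hn)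
    _ = (C * W ^ (1 + η - s)) ^ (2 * k - 1) * ∑ m ∈ B, ∑ m' ∈ B,
        (∑ n ∈ S, w n * (e n m' ^ k * e n m ^ k)) * (1 + |(m' : ℝ) - m|) ^ (β - 1) := by
        simp only [mul_sum, sum_mul]
        rw [sum_comm]
        refine sum_congr rfl fun m _ => ?_
        rw [sum_comm]
        refine sum_congr rfl fun m' _ => sum_congr rfl fun n _ => by ring
    _ ≤ (C * W ^ (1 + η - s)) ^ (2 * k - 1) * ∑ m ∈ B, ∑ m' ∈ B,
        P * (1 + |(m' : ℝ) - m|) ^ (-1 : ℝ) := by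
        refine mul_le_mul_of_nonneg_left (sum_le_sum fun m hm => sum_le_sum fun m' hm' => ?_) hD0
        calc _ ≤ P * (1 + |(m' : ℝ) - m|) ^ (-β) * (1 + |(m' : ℝ) - m|) ^ (β - 1) :=
              mul_le_mul_of_nonneg_right (h m hm m' hm') (Real.rpow_nonneg (hpos _ _).le _)
          _ = _ := by
              rw [mul_assoc, ← Real.rpow_add (hpos _ _)]
              congr 2
              ring
    _ = (C * W ^ (1 + η - s)) ^ (2 * k - 1) * (P * ∑ m ∈ B, ∑ m' ∈ B,
        (1 + |(m' : ℝ) - m|) ^ (-1 : ℝ)) := by simp only [mul_sum]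
    _ ≤ _ := by
        refine mul_le_mul_of_nonneg_left (mul_le_mul_of_nonneg_left ?_ hP) hD0
        have h1 := sum_sum_one_add_abs_sub_rpow_le (β := 1) hC0 hC hW0 hB hcard (by linarith)
        rwa [add_sub_cancel_left] at h1

lemma sum_rpow_half_mul_rpow_half_le (hC : DecaySumBound C η) (hη : 0 ≤ η) (hW0 : 0 ≤ W)
    (hB : ∀ m ∈ B, ∀ m' ∈ B, 1 + |(m : ℝ) - m'| ≤ W) {b c : ℕ} (hb : b ∈ B) (hc : c ∈ B) :
    ∑ a ∈ B, (1 + |(a : ℝ) - b|) ^ (-(1 / 2) : ℝ) * (1 + |(a : ℝ) - c|) ^ (-(1 / 2) : ℝ) ≤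
      C * W ^ η := by
  have h1 := hC 1 W b B (by linarith) hW0 fun m hm => hB m hm b hb
  have h2 := hC 1 W c B (by linarith) hW0 fun m hm => hB m hm c hc
  rw [add_sub_cancel_left] at h1 h2
  have hsq : ∀ x : ℝ, 0 ≤ x → (1 + x) ^ (-1 : ℝ) = ((1 + x) ^ (-(1 / 2) : ℝ)) ^ 2 := fun x hx => by
    rw [← Real.rpow_natCast, ← Real.rpow_mul (by linarith)]
    norm_num
  calc _ ≤ ∑ a ∈ B, ((1 + |(a : ℝ) - b|) ^ (-1 : ℝ) / 2 + (1 + |(a : ℝ) - c|) ^ (-1 : ℝ) / 2) := by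
        refine sum_le_sum fun a _ => ?_
        rw [hsq _ (abs_nonneg _), hsq _ (abs_nonneg _)]
        nlinarith [sq_nonneg ((1 + |(a : ℝ) - b|) ^ (-(1 / 2) : ℝ) -
          (1 + |(a : ℝ) - c|) ^ (-(1 / 2) : ℝ))]
    _ ≤ _ := by
        rw [sum_add_distrib, ← sum_div, ← sum_div]
        linarith

lemma sum_mul_sum_pow_four_le_of_quad (hC0 : 0 ≤ C) (hC : DecaySumBound C η) (hη : 0 ≤ η)
    (hW0 : 0 ≤ W) (hP : 0 ≤ P) (hB : ∀ m ∈ B, ∀ m' ∈ B, 1 + |(m : ℝ) - m'| ≤ W)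
    (hcard : (B.card : ℝ) ≤ W)
    (h : ∀ a ∈ B, ∀ b ∈ B, ∀ c ∈ B, ∀ d ∈ B,
      ∑ n ∈ S, w n * (e n a * e n b * (e n c * e n d)) ≤
      P * ((1 + |(a : ℝ) - b|) ^ (-(1 / 2) : ℝ) * (1 + |(c : ℝ) - d|) ^ (-(1 / 2) : ℝ) *
        (1 + |(a : ℝ) - c|) ^ (-(1 / 2) : ℝ) * (1 + |(b : ℝ) - d|) ^ (-(1 / 2) : ℝ) *
        (1 + |(b : ℝ) - c|) ^ (-(1 / 8) : ℝ))) :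
    ∑ n ∈ S, w n * (∑ m ∈ B, e n m) ^ 4 ≤
      (C * W ^ η) ^ 2 * (P * (W * (C * W ^ (1 + η - 1 / 8)))) := by
  have hD0 : 0 ≤ C * W ^ η := mul_nonneg hC0 (Real.rpow_nonneg hW0 _)
  have hexpand : ∀ f : ℕ → ℝ, (∑ m ∈ B, f m) ^ 4 =
      ∑ c ∈ B, ∑ b ∈ B, ∑ a ∈ B, ∑ d ∈ B, f a * f b * (f c * f d) := fun f => by
    simp only [← mul_sum, ← sum_mul]
    ring
  calc ∑ n ∈ S, w n * (∑ m ∈ B, e n m) ^ 4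
      = ∑ c ∈ B, ∑ b ∈ B, ∑ a ∈ B, ∑ d ∈ B, ∑ n ∈ S,
          w n * (e n a * e n b * (e n c * e n d)) := by
        simp only [hexpand, mul_sum]
        rw [sum_comm]
        refine sum_congr rfl fun c _ => ?_
        rw [sum_comm]
        refine sum_congr rfl fun b _ => ?_
        rw [sum_comm]
        refine sum_congr rfl fun a _ => ?_
        rw [sum_comm]
    _ ≤ ∑ c ∈ B, ∑ b ∈ B, ∑ a ∈ B, ∑ d ∈ B, P * ((1 + |(a : ℝ) - b|) ^ (-(1 / 2) : ℝ) *
          (1 + |(c : ℝ) - d|) ^ (-(1 / 2) : ℝ) * (1 + |(a : ℝ) - c|) ^ (-(1 / 2) : ℝ) *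
          (1 + |(b : ℝ) - d|) ^ (-(1 / 2) : ℝ) * (1 + |(b : ℝ) - c|) ^ (-(1 / 8) : ℝ)) :=
        sum_le_sum fun c hc => sum_le_sum fun b hb => sum_le_sum fun a ha => sum_le_sum fun d hd =>
          h a ha b hb c hc d hd
    _ = ∑ c ∈ B, ∑ b ∈ B, P * ((1 + |(b : ℝ) - c|) ^ (-(1 / 8) : ℝ) *
          ((∑ a ∈ B, (1 + |(a : ℝ) - b|) ^ (-(1 / 2) : ℝ) *
            (1 + |(a : ℝ) - c|) ^ (-(1 / 2) : ℝ)) *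
          ∑ d ∈ B, (1 + |(d : ℝ) - b|) ^ (-(1 / 2) : ℝ) *
            (1 + |(d : ℝ) - c|) ^ (-(1 / 2) : ℝ))) := by
        refine sum_congr rfl fun c _ => sum_congr rfl fun b _ => ?_
        rw [sum_mul_sum, mul_sum, mul_sum]
        refine sum_congr rfl fun a _ => ?_
        rw [mul_sum, mul_sum]
        refine sum_congr rfl fun d _ => ?_
        rw [abs_sub_comm (c : ℝ) d, abs_sub_comm (b : ℝ) d]
        ring
    _ ≤ ∑ c ∈ B, ∑ b ∈ B, P * ((1 + |(b : ℝ) - c|) ^ (-(1 / 8) : ℝ) *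
          ((C * W ^ η) * (C * W ^ η))) := by
        refine sum_le_sum fun c hc => sum_le_sum fun b hb => mul_le_mul_of_nonneg_left
          (mul_le_mul_of_nonneg_left ?_ (by positivity)) hP
        have h1 := sum_rpow_half_mul_rpow_half_le hC hη hW0 hB hb hc
        exact mul_le_mul h1 h1 (sum_nonneg fun _ _ => by positivity) hD0
    _ = (C * W ^ η) ^ 2 * (P * ∑ c ∈ B, ∑ b ∈ B, (1 + |(b : ℝ) - c|) ^ (-(1 / 8) : ℝ)) := by
        simp only [mul_sum]
        refine sum_congr rfl fun c _ => sum_congr rfl fun b _ => by ring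
    _ ≤ _ := mul_le_mul_of_nonneg_left (mul_le_mul_of_nonneg_left
        (sum_sum_one_add_abs_sub_rpow_le hC0 hC hW0 hB hcard (by linarith)) hP) (by positivity)

end Blocks

/-- The naturals `m` with `2 ^ j ≤ m + 1 < 2 ^ (j + 1)`. -/
def dyadicBlock (j : ℕ) : Finset ℕ := Ico (2 ^ j - 1) (2 ^ (j + 1) - 1)

lemma mem_dyadicBlock {j m : ℕ} : m ∈ dyadicBlock j ↔ 2 ^ j ≤ m + 1 ∧ m + 1 < 2 ^ (j + 1) := by
  have h := Nat.one_le_two_pow (n := j)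
  rw [dyadicBlock, mem_Ico]
  omega

lemma dyadicBlock_bounds {j m : ℕ} (hm : m ∈ dyadicBlock j) :
    (2 : ℝ) ^ j ≤ m + 1 ∧ (m : ℝ) + 2 ≤ 2 * 2 ^ j := by
  obtain ⟨h1, h2⟩ := mem_dyadicBlock.mp hm
  rw [pow_succ] at h2
  refine ⟨by exact_mod_cast h1, ?_⟩
  have : m + 2 ≤ 2 * 2 ^ j := by omega
  exact_mod_cast this

lemma card_dyadicBlock (j : ℕ) : ((dyadicBlock j).card : ℝ) = 2 ^ j := by
  have h : (dyadicBlock j).card = 2 ^ j := by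
    rw [dyadicBlock, Nat.card_Ico, pow_succ]
    have := Nat.one_le_two_pow (n := j)
    omega
  exact_mod_cast h

lemma one_add_abs_sub_le_of_mem_dyadicBlock {j m m' : ℕ} (hm : m ∈ dyadicBlock j)
    (hm' : m' ∈ dyadicBlock j) : 1 + |(m : ℝ) - m'| ≤ 2 ^ j := by
  have h := dyadicBlock_bounds hm
  have h' := dyadicBlock_bounds hm'
  have : |(m : ℝ) - m'| ≤ 2 ^ j - 1 := abs_le.mpr ⟨by linarith, by linarith⟩
  linarith

lemma two_mul_le_choose (k : ℕ) : 2 * k ≤ (2 * k).choose k := by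
  have h := Nat.choose_le_centralBinom 1 k
  rwa [Nat.choose_one_right, Nat.centralBinom_eq_two_mul_choose] at h

lemma choose_add_two_le {k A : ℕ} (hk : 1 ≤ k) (hA : (2 * k).choose k < 2 * k * (A + 1)) :
    (2 * k).choose k + 2 ≤ 2 * k * (A + 1) := by
  have h := Nat.two_dvd_centralBinom_of_one_le hk
  rw [Nat.centralBinom_eq_two_mul_choose] at h
  obtain ⟨c, hc⟩ := h
  rw [mul_assoc] at hA ⊢
  omega

lemma pair_block_large {k : ℕ} (hk : 1 ≤ k) {l E β η s Φ : ℝ} (hl1 : 1 ≤ l) (hl : l ^ 4 ≤ 2)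
    (hE : l * (2 * k).choose k < E) (hβ0 : 0 ≤ β) (hβ : β ≤ pairGain k)
    (hβC : β ≤ (2 * k).choose k) (hη : 0 < η) (hs : s ≤ 1 + η) (hsβ : s * (2 * k - 1) = β - 1)
    (hΦ : E + (1 + η - s) * (2 * k - 1) + 1 + η ≤ Φ) :
    ∃ K : ℝ, 0 ≤ K ∧ ∀ (x R θ : ℝ) (j : ℕ), 2 ≤ R → R ≤ x → 0 ≤ θ → θ ≤ 1 →
      ∑ n ∈ Icc 1 ⌊x⌋₊, l ^ bigOmega n R *
          (∑ m ∈ dyadicBlock j, eulerNorm n R (1 / Real.log R * (m + θ))) ^ (2 * k) ≤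
        K * (x / Real.log R) * ((2 : ℝ) ^ j) ^ Φ := by
  obtain ⟨C, hC0, hC⟩ := exists_sum_one_add_abs_sub_rpow_le hη
  obtain ⟨K, hK0, hK⟩ := exists_sum_eulerNorm_pair_le hk hl1 hl hE hβ0 hβ hβC
  refine ⟨C ^ (2 * k - 1) * (K * C), by positivity, ?_⟩
  intro x R θ j hR hx hθ0 hθ1
  have hlog : 0 < Real.log R := Real.log_pos (by linarith)
  have hx0 : 0 ≤ x := by linarith
  set W : ℝ := 2 ^ j with hW
  have hW1 : 1 ≤ W := one_le_pow₀ (by norm_num)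
  have hW0 : 0 < W := by linarith
  have h := sum_mul_sum_pow_le_of_pair (S := Icc 1 ⌊x⌋₊) (w := fun n => l ^ bigOmega n R)
    (e := fun n m => eulerNorm n R (1 / Real.log R * (m + θ))) (B := dyadicBlock j)
    (P := K * (x / Real.log R) * W ^ E) hk hC0 hC hη.le hW0.le (by positivity)
    (fun m hm m' hm' => one_add_abs_sub_le_of_mem_dyadicBlock hm hm') (card_dyadicBlock j).le hs
    hsβ (fun n m => eulerNorm_nonneg _ _ _) (fun n _ => by positivity)
    (fun m hm m' hm' => by
      have b := dyadicBlock_bounds hm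
      have b' := dyadicBlock_bounds hm'
      have g := hK x R W (m' + θ) (m + θ) hR hx hW1 (by positivity) (by linarith) (by positivity)
        (by linarith)
      rw [add_sub_add_right_eq_sub] at g
      rw [mul_assoc _ (W ^ E)]
      exact g)
  refine h.trans ?_
  have hpow : (W ^ (1 + η - s)) ^ (2 * k - 1) * (W ^ E * (W * W ^ η)) ≤ W ^ Φ := by
    rw [← Real.rpow_natCast (W ^ (1 + η - s)), ← Real.rpow_mul hW0.le]
    nth_rewrite 3 [← Real.rpow_one W]
    rw [← Real.rpow_add hW0, ← Real.rpow_add hW0, ← Real.rpow_add hW0]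
    refine Real.rpow_le_rpow_of_exponent_le hW1 ?_
    rw [Nat.cast_sub (by omega)]
    push_cast
    linarith
  calc _ = C ^ (2 * k - 1) * (K * C) * (x / Real.log R) *
        ((W ^ (1 + η - s)) ^ (2 * k - 1) * (W ^ E * (W * W ^ η))) := by
        rw [mul_pow]
        ring
    _ ≤ _ := mul_le_mul_of_nonneg_left hpow (by positivity)

lemma pair_block_one {l E η Φ : ℝ} (hl1 : 1 ≤ l) (hl : l ^ 4 ≤ 2) (hE : l * 2 < E) (hη : 0 < η)
    (hΦ : E + 1 + (1 + η - 1 / 8) ≤ Φ) :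
    ∃ K : ℝ, 0 ≤ K ∧ ∀ (x R θ : ℝ) (j : ℕ), 2 ≤ R → R ≤ x → 0 ≤ θ → θ ≤ 1 →
      ∑ n ∈ Icc 1 ⌊x⌋₊, l ^ bigOmega n R *
          (∑ m ∈ dyadicBlock j, eulerNorm n R (1 / Real.log R * (m + θ))) ^ 2 ≤
        K * (x / Real.log R) * ((2 : ℝ) ^ j) ^ Φ := by
  obtain ⟨C, hC0, hC⟩ := exists_sum_one_add_abs_sub_rpow_le hη
  obtain ⟨K, hK0, hK⟩ := exists_sum_eulerNorm_pair_le (k := 1) (β := 1 / 8) le_rfl hl1 hl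
    (by simpa using hE) (by norm_num) (by norm_num [pairGain]) (by norm_num)
  refine ⟨K * C, by positivity, ?_⟩
  intro x R θ j hR hx hθ0 hθ1
  have hlog : 0 < Real.log R := Real.log_pos (by linarith)
  have hx0 : 0 ≤ x := by linarith
  set W : ℝ := 2 ^ j with hW
  have hW1 : 1 ≤ W := one_le_pow₀ (by norm_num)
  have hW0 : 0 < W := by linarith
  have h := sum_mul_sum_sq_le_of_pair (S := Icc 1 ⌊x⌋₊) (w := fun n => l ^ bigOmega n R)
    (e := fun n m => eulerNorm n R (1 / Real.log R * (m + θ))) (B := dyadicBlock j)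
    (P := K * (x / Real.log R) * W ^ E) (β := 1 / 8) hC0 hC hW0.le (by positivity)
    (fun m hm m' hm' => one_add_abs_sub_le_of_mem_dyadicBlock hm hm') (card_dyadicBlock j).le
    (by linarith)
    (fun m hm m' hm' => by
      have b := dyadicBlock_bounds hm
      have b' := dyadicBlock_bounds hm'
      have g := hK x R W (m' + θ) (m + θ) hR hx hW1 (by positivity) (by linarith) (by positivity)
        (by linarith)
      rw [add_sub_add_right_eq_sub] at g
      simp only [pow_one] at g
      rw [mul_assoc _ (W ^ E)]
      exact g)
  refine h.trans ?_
  have hpow : W ^ E * (W * W ^ (1 + η - 1 / 8)) ≤ W ^ Φ := by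
    nth_rewrite 2 [← Real.rpow_one W]
    rw [← Real.rpow_add hW0, ← Real.rpow_add hW0]
    exact Real.rpow_le_rpow_of_exponent_le hW1 (by linarith)
  calc _ = K * C * (x / Real.log R) * (W ^ E * (W * W ^ (1 + η - 1 / 8))) := by ring
    _ ≤ _ := mul_le_mul_of_nonneg_left hpow (by positivity)

lemma quad_block {l E η Φ : ℝ} (hl1 : 1 ≤ l) (hl : l ^ 4 ≤ 2) (hE : l * 6 < E) (hη : 0 < η)
    (hΦ : η * 2 + (E + (1 + (1 + η - 1 / 8))) ≤ Φ) :
    ∃ K : ℝ, 0 ≤ K ∧ ∀ (x R θ : ℝ) (j : ℕ), 2 ≤ R → R ≤ x → 0 ≤ θ → θ ≤ 1 →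
      ∑ n ∈ Icc 1 ⌊x⌋₊, l ^ bigOmega n R *
          (∑ m ∈ dyadicBlock j, eulerNorm n R (1 / Real.log R * (m + θ))) ^ 4 ≤
        K * (x / Real.log R) * ((2 : ℝ) ^ j) ^ Φ := by
  obtain ⟨C, hC0, hC⟩ := exists_sum_one_add_abs_sub_rpow_le hη
  obtain ⟨K, hK0, hK⟩ := exists_sum_eulerNorm_quad_le hl1 hl hE
  refine ⟨C ^ 2 * (K * C), by positivity, ?_⟩
  intro x R θ j hR hx hθ0 hθ1
  have hlog : 0 < Real.log R := Real.log_pos (by linarith)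
  have hx0 : 0 ≤ x := by linarith
  set W : ℝ := 2 ^ j with hW
  have hW1 : 1 ≤ W := one_le_pow₀ (by norm_num)
  have hW0 : 0 < W := by linarith
  have h := sum_mul_sum_pow_four_le_of_quad (S := Icc 1 ⌊x⌋₊) (w := fun n => l ^ bigOmega n R)
    (e := fun n m => eulerNorm n R (1 / Real.log R * (m + θ))) (B := dyadicBlock j)
    (P := K * (x / Real.log R) * W ^ E) hC0 hC hη.le hW0.le (by positivity)
    (fun m hm m' hm' => one_add_abs_sub_le_of_mem_dyadicBlock hm hm') (card_dyadicBlock j).le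
    (fun a ha b hb c hc d hd => by
      have ba := dyadicBlock_bounds ha
      have bb := dyadicBlock_bounds hb
      have bc := dyadicBlock_bounds hc
      have bd := dyadicBlock_bounds hd
      have hbc := one_add_abs_sub_le_of_mem_dyadicBlock hb hc
      have g := hK x R W (a + θ) (b + θ) (c + θ) (d + θ) hR hx hW1 (by positivity) (by linarith)
        (by positivity) (by linarith) (by positivity) (by linarith) (by positivity) (by linarith)
        (by rw [add_sub_add_right_eq_sub]; linarith)
      simp only [add_sub_add_right_eq_sub] at g
      rw [mul_assoc _ (W ^ E)]
      exact g)
  refine h.trans ?_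
  have hpow : (W ^ η) ^ 2 * (W ^ E * (W * W ^ (1 + η - 1 / 8))) ≤ W ^ Φ := by
    rw [← Real.rpow_natCast (W ^ η), ← Real.rpow_mul hW0.le]
    nth_rewrite 3 [← Real.rpow_one W]
    rw [← Real.rpow_add hW0, ← Real.rpow_add hW0, ← Real.rpow_add hW0]
    refine Real.rpow_le_rpow_of_exponent_le hW1 ?_
    push_cast
    linarith
  calc _ = C ^ 2 * (K * C) * (x / Real.log R) *
        ((W ^ η) ^ 2 * (W ^ E * (W * W ^ (1 + η - 1 / 8)))) := by
        rw [mul_pow]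
        ring
    _ ≤ _ := mul_le_mul_of_nonneg_left hpow (by positivity)

lemma two_mul_le_two_pow_pred {k : ℕ} (hk : 4 ≤ k) : 2 * k ≤ 2 ^ (k - 1) := by
  induction k, hk using Nat.le_induction with
  | base => norm_num
  | succ n hn ih =>
    rw [show n + 1 - 1 = (n - 1) + 1 by omega, pow_succ]
    omega

/-- Dyadic blocks of the Mellin frequencies, with a Rankin weight `l ^ Ω(n; R)`, `l > 1`. -/
lemma exists_block_le {k A : ℕ} (hk : 1 ≤ k) (hA : (2 * k).choose k < 2 * k * (A + 1)) :
    ∃ l : ℝ, 1 < l ∧ ∃ K : ℝ, 0 ≤ K ∧ ∀ (x R θ : ℝ) (j : ℕ), 2 ≤ R → R ≤ x → 0 ≤ θ → θ ≤ 1 →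
      ∑ n ∈ Icc 1 ⌊x⌋₊, l ^ bigOmega n R *
          (∑ m ∈ dyadicBlock j, eulerNorm n R (1 / Real.log R * (m + θ))) ^ (2 * k) ≤
        K * (x / Real.log R) * ((2 : ℝ) ^ j) ^ (2 * k * (A + 1) - 1 / 16 : ℝ) := by
  have hC2 : 2 * k ≤ (2 * k).choose k := two_mul_le_choose k
  have hA2 := choose_add_two_le hk hA
  set c := (2 * k).choose k with hc
  have hC2' : (2 * k : ℝ) ≤ c := by exact_mod_cast hC2
  have hA2' : (c : ℝ) + 2 ≤ 2 * k * (A + 1) := by exact_mod_cast hA2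
  have hk' : (1 : ℝ) ≤ k := by exact_mod_cast hk
  have hc0 : (0 : ℝ) < c := by linarith
  have hl2 : 1 / (64 * (c : ℝ)) ≤ 1 / 128 := by
    apply one_div_le_one_div_of_le <;> linarith
  have hlpos : 0 < 1 / (64 * (c : ℝ)) := by positivity
  refine ⟨1 + 1 / (64 * c), by linarith, ?_⟩
  set l : ℝ := 1 + 1 / (64 * c) with hl
  have hl1 : 1 ≤ l := by linarith
  have hl4 : l ^ 4 ≤ 2 :=
    (pow_le_pow_left₀ (by linarith) (by linarith : l ≤ 1 + 1 / 128) 4).trans (by norm_num)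
  have hlc : l * c = c + 1 / 64 := by
    rw [hl]
    field_simp
  have hlE : l * c < c + 1 / 32 := by linarith
  have hη : (0 : ℝ) < 1 / (64 * k) := by positivity
  have hηk : 1 / (64 * (k : ℝ)) * k = 1 / 64 := by field_simp
  have hlarge : ∀ β : ℝ, 1 ≤ β → β ≤ pairGain k → β ≤ c → β ≤ 2 * k →
      (c : ℝ) + 2 * k + 1 - β + 1 / 8 ≤ 2 * k * (A + 1) →
      ∃ K : ℝ, 0 ≤ K ∧ ∀ (x R θ : ℝ) (j : ℕ), 2 ≤ R → R ≤ x → 0 ≤ θ → θ ≤ 1 →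
      ∑ n ∈ Icc 1 ⌊x⌋₊, l ^ bigOmega n R *
          (∑ m ∈ dyadicBlock j, eulerNorm n R (1 / Real.log R * (m + θ))) ^ (2 * k) ≤
        K * (x / Real.log R) * ((2 : ℝ) ^ j) ^ (2 * k * (A + 1) - 1 / 16 : ℝ) := by
    intro β hβ1 hβ hβc hβk hle
    have hk0 : (0 : ℝ) < 2 * k - 1 := by linarith
    have hs : (β - 1) / (2 * k - 1) * (2 * k - 1 : ℝ) = β - 1 := div_mul_cancel₀ _ hk0.ne'
    refine pair_block_large (s := (β - 1) / (2 * k - 1)) hk hl1 hl4 (E := c + 1 / 32) hlE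
      (by linarith) hβ hβc hη ?_ hs ?_
    · rw [div_le_iff₀ hk0]
      nlinarith
    · rw [sub_mul, hs]
      linarith
  rcases (by omega : k = 1 ∨ k = 2 ∨ k = 3 ∨ 4 ≤ k) with rfl | rfl | rfl | h4
  · have e : (c : ℝ) = 2 := by norm_num [hc]
    rw [e] at hlE hA2'
    refine pair_block_one hl1 hl4 hlE (by norm_num : (0 : ℝ) < 1 / 64) ?_
    push_cast at hA2' ⊢
    have hA1 : (1 : ℝ) ≤ A := by linarith
    linarith
  · have e : (c : ℝ) = 6 := by norm_num [hc, Nat.choose]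
    rw [e] at hlE hA2'
    refine quad_block hl1 hl4 hlE (by norm_num : (0 : ℝ) < 1 / 256) ?_
    push_cast at hA2' ⊢
    linarith
  · have e : c = 20 := by norm_num [hc, Nat.choose]
    refine hlarge 4 (by norm_num) (by norm_num [pairGain]) (by rw [e]; norm_num) (by norm_num) ?_
    rw [e] at hA
    have hA3 : 3 ≤ A := by omega
    have hA3' : (3 : ℝ) ≤ A := by exact_mod_cast hA3
    rw [e]
    push_cast
    linarith
  · refine hlarge (2 * k) (by linarith) ?_ hC2' le_rfl (by linarith)
    rw [pairGain, if_neg (by omega)]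
    exact_mod_cast two_mul_le_two_pow_pred h4

lemma sum_range_two_pow_sub_one (f : ℕ → ℝ) (J : ℕ) :
    ∑ m ∈ range (2 ^ J - 1), f m = ∑ j ∈ range J, ∑ m ∈ dyadicBlock j, f m := by
  induction J with
  | zero => simp
  | succ J ih =>
    rw [sum_range_succ, ← ih, dyadicBlock, range_eq_Ico, range_eq_Ico]
    refine (sum_Ico_consecutive f (Nat.zero_le _) ?_).symm
    exact Nat.sub_le_sub_right (Nat.pow_le_pow_right (by norm_num) (by omega)) 1

lemma sum_range_mul_le_dyadic {e : ℕ → ℝ} (he : ∀ m, 0 ≤ e m) (a N : ℕ) :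
    ∑ m ∈ range N, ((m + 1 : ℝ) ^ a)⁻¹ * e m ≤
      ∑ j ∈ range N, (((2 : ℝ) ^ j) ^ a)⁻¹ * ∑ m ∈ dyadicBlock j, e m := by
  have hN : N ≤ 2 ^ N - 1 := by
    have := Nat.lt_two_pow_self (n := N)
    omega
  calc _ ≤ ∑ m ∈ range (2 ^ N - 1), ((m + 1 : ℝ) ^ a)⁻¹ * e m :=
        sum_le_sum_of_subset_of_nonneg (range_subset_range.mpr hN) fun m _ _ =>
          mul_nonneg (by positivity) (he m)
    _ = ∑ j ∈ range N, ∑ m ∈ dyadicBlock j, ((m + 1 : ℝ) ^ a)⁻¹ * e m :=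
        sum_range_two_pow_sub_one _ _
    _ ≤ _ := by
        refine sum_le_sum fun j _ => ?_
        rw [mul_sum]
        refine sum_le_sum fun m hm => mul_le_mul_of_nonneg_right ?_ (he m)
        exact inv_anti₀ (by positivity)
          (pow_le_pow_left₀ (by positivity) (dyadicBlock_bounds hm).1 a)

lemma exists_sum_rankin_Mf_pow_le {k A : ℕ} (hk : 1 ≤ k)
    (hA : (2 * k).choose k < 2 * k * (A + 1)) :
    ∃ l : ℝ, 1 < l ∧ ∃ K : ℝ, 0 ≤ K ∧ ∀ x R : ℝ, 2 ≤ R → R ≤ x →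
      ∑ n ∈ Icc 1 ⌊x⌋₊, l ^ bigOmega n R * Mf (fA A) n R ^ (2 * k) ≤ K * (x / Real.log R) := by
  have hA1 : 1 ≤ A := by
    rcases Nat.eq_zero_or_pos A with rfl | h
    · have := two_mul_le_choose k
      omega
    · exact h
  obtain ⟨l, hl, K, hK0, hK⟩ := exists_block_le hk hA
  obtain ⟨C, hC0, hC⟩ := exists_sum_Mf_pow_le hA1 k
  have hk' : (1 : ℝ) ≤ k := by exact_mod_cast hk
  set κ : ℝ := 1 / (64 * k) with hκ
  have hκ0 : 0 < κ := by positivity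
  have hκk : κ * (2 * k) = 1 / 32 := by
    rw [hκ]
    field_simp
    norm_num
  set r : ℝ := (2 : ℝ) ^ (-κ) with hr
  have hr0 : 0 < r := Real.rpow_pos_of_pos (by norm_num) _
  have hr1 : r < 1 := Real.rpow_lt_one_of_one_lt_of_neg (by norm_num) (by linarith)
  have hG0 : 0 < 1 - r := by linarith
  have hgeom : ∀ N : ℕ, ∑ j ∈ range N, r ^ j ≤ (1 - r)⁻¹ := fun N => by
    rw [← tsum_geometric_of_lt_one hr0.le hr1]
    exact (summable_geometric_of_lt_one hr0.le hr1).sum_le_tsum _ fun _ _ => by positivity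
  refine ⟨l, hl, C * ((1 - r)⁻¹ ^ (2 * k - 1) * (K * (1 - r)⁻¹)), by positivity, ?_⟩
  intro x R hR hx
  have hlog : 0 < Real.log R := Real.log_pos (by linarith)
  have hx0 : 0 ≤ x := by linarith
  rw [mul_assoc]
  refine hC (Icc 1 ⌊x⌋₊) (fun n => l ^ bigOmega n R) R _ hR
    (fun n hn => ⟨by have := (mem_Icc.mp hn).1; omega, by positivity⟩) fun N θ hθ0 hθ1 => ?_
  set Q : ℕ → ℕ → ℝ := fun n j =>
    ∑ m ∈ dyadicBlock j, eulerNorm n R (1 / Real.log R * (m + θ)) with hQ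
  have hQ0 : ∀ n j, 0 ≤ Q n j := fun n j => sum_nonneg fun m _ => eulerNorm_nonneg _ _ _
  set b : ℕ → ℝ := fun j => (r ^ j)⁻¹ * (((2 : ℝ) ^ j) ^ (A + 1))⁻¹ with hb
  have hb0 : ∀ j, 0 ≤ b j := fun j => by positivity
  have hbpow : ∀ j, b j ^ (2 * k) * ((2 : ℝ) ^ j) ^ (2 * k * (A + 1) - 1 / 16 : ℝ) ≤ 1 := by
    intro j
    have hW1 : (1 : ℝ) ≤ 2 ^ j := one_le_pow₀ (by norm_num)
    have hrW : r ^ j = ((2 : ℝ) ^ j) ^ (-κ) := by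
      rw [hr, ← Real.rpow_natCast, ← Real.rpow_mul (by norm_num), ← Real.rpow_natCast,
        ← Real.rpow_mul (by norm_num), mul_comm]
    simp only [hb, hrW]
    set W : ℝ := 2 ^ j
    have hW0 : 0 < W := by linarith
    rw [← Real.rpow_natCast W, ← Real.rpow_neg hW0.le, ← Real.rpow_neg hW0.le,
      ← Real.rpow_add hW0, ← Real.rpow_natCast, ← Real.rpow_mul hW0.le, ← Real.rpow_add hW0]
    refine Real.rpow_le_one_of_one_le_of_nonpos hW1 ?_
    push_cast
    linarith
  have hpt : ∀ n, (∑ m ∈ range N,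
      ((m + 1 : ℝ) ^ (A + 1))⁻¹ * eulerNorm n R (1 / Real.log R * (m + θ))) ^ (2 * k) ≤
      (1 - r)⁻¹ ^ (2 * k - 1) * ∑ j ∈ range N, r ^ j * (b j ^ (2 * k) * Q n j ^ (2 * k)) := by
    intro n
    have h1 := sum_range_mul_le_dyadic (e := fun m => eulerNorm n R (1 / Real.log R * (m + θ)))
      (fun m => eulerNorm_nonneg _ _ _) (A + 1) N
    have h2 := sum_mul_pow_le (range N) (fun j => r ^ j) (fun j => b j * Q n j)
      (fun j _ => by positivity) (fun j _ => mul_nonneg (hb0 j) (hQ0 n j)) (n := 2 * k) (by omega)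
    have h3 : ∑ j ∈ range N, r ^ j * (b j * Q n j) =
        ∑ j ∈ range N, (((2 : ℝ) ^ j) ^ (A + 1))⁻¹ * Q n j := by
      refine sum_congr rfl fun j _ => ?_
      have : r ^ j ≠ 0 := by positivity
      simp only [hb]
      field_simp
    rw [h3] at h2
    refine (pow_le_pow_left₀ (sum_nonneg fun m _ => mul_nonneg (by positivity)
      (eulerNorm_nonneg _ _ _)) h1 _).trans (h2.trans ?_)
    simp only [mul_pow]
    refine mul_le_mul_of_nonneg_right ?_ (sum_nonneg fun j _ => mul_nonneg (by positivity)
      (mul_nonneg (pow_nonneg (hb0 j) _) (pow_nonneg (hQ0 n j) _)))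
    exact pow_le_pow_left₀ (sum_nonneg fun j _ => by positivity) (hgeom N) _
  have hxl : 0 ≤ x / Real.log R := by positivity
  calc _ ≤ ∑ n ∈ Icc 1 ⌊x⌋₊, l ^ bigOmega n R * ((1 - r)⁻¹ ^ (2 * k - 1) *
        ∑ j ∈ range N, r ^ j * (b j ^ (2 * k) * Q n j ^ (2 * k))) :=
        sum_le_sum fun n _ => mul_le_mul_of_nonneg_left (hpt n) (by positivity)
    _ = (1 - r)⁻¹ ^ (2 * k - 1) * ∑ j ∈ range N, r ^ j * (b j ^ (2 * k) *
        ∑ n ∈ Icc 1 ⌊x⌋₊, l ^ bigOmega n R * Q n j ^ (2 * k)) := by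
        simp only [mul_sum]
        rw [sum_comm]
        exact sum_congr rfl fun j _ => sum_congr rfl fun n _ => by ring
    _ ≤ (1 - r)⁻¹ ^ (2 * k - 1) * ∑ j ∈ range N, r ^ j * (K * (x / Real.log R)) := by
        refine mul_le_mul_of_nonneg_left (sum_le_sum fun j _ => mul_le_mul_of_nonneg_left ?_
          (by positivity)) (by positivity)
        calc _ ≤ b j ^ (2 * k) * (K * (x / Real.log R) *
              ((2 : ℝ) ^ j) ^ (2 * k * (A + 1) - 1 / 16 : ℝ)) :=
              mul_le_mul_of_nonneg_left (hK x R θ j hR hx hθ0 hθ1) (pow_nonneg (hb0 j) _)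
          _ = K * (x / Real.log R) * (b j ^ (2 * k) *
              ((2 : ℝ) ^ j) ^ (2 * k * (A + 1) - 1 / 16 : ℝ)) := by ring
          _ ≤ _ := mul_le_of_le_one_right (by positivity) (hbpow j)
    _ = (1 - r)⁻¹ ^ (2 * k - 1) * ((∑ j ∈ range N, r ^ j) * (K * (x / Real.log R))) := by
        rw [sum_mul]
    _ ≤ (1 - r)⁻¹ ^ (2 * k - 1) * ((1 - r)⁻¹ * (K * (x / Real.log R))) :=
        mul_le_mul_of_nonneg_left (mul_le_mul_of_nonneg_right (hgeom N) (by positivity))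
          (by positivity)
    _ = _ := by ring

end

/-- Let `k ≥ 1` and `A ≥ 0` be integers with `A > binom(2k,k)/(2k) − 1`. Then there is
`C(k,A) > 0` such that for all `x ≥ R ≥ 2` and every real `T ≥ 1`,
`Σ_{n ≤ x, Ω(n;R) ≥ T} M_{f_A}(n;R)^{2k} ≤ C(k,A)·x/(T·log R)`. -/
theorem moment_fA_many_prime_factors_bound (k A : ℕ) (hk : 1 ≤ k)
    (hA : Nat.choose (2 * k) k < 2 * k * (A + 1)) :
    ∃ C : ℝ, 0 < C ∧ ∀ x R T : ℝ, 2 ≤ R → R ≤ x → 1 ≤ T →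
      ∑ n ∈ (Finset.Icc 1 ⌊x⌋₊).filter (fun n : ℕ => T ≤ (bigOmega n R : ℝ)),
        Mf (fA A) n R ^ (2 * k) ≤ C * x / (T * Real.log R) := by
  obtain ⟨l, hl, K, hK0, hK⟩ := exists_sum_rankin_Mf_pow_le hk hA
  have hl0 : 0 < l - 1 := by linarith
  refine ⟨(K + 1) / (l - 1), by positivity, fun x R T hR hx hT => ?_⟩
  have hlog : 0 < Real.log R := Real.log_pos (by linarith)
  have hx0 : 0 < x := by linarith
  have hT0 : 0 < T := by linarith
  have hM0 : ∀ n, 0 ≤ Mf (fA A) n R ^ (2 * k) := fun n => (even_two_mul k).pow_nonneg _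
  have hmarkov : (l - 1) * T * ∑ n ∈ (Finset.Icc 1 ⌊x⌋₊).filter
      (fun n : ℕ => T ≤ (bigOmega n R : ℝ)), Mf (fA A) n R ^ (2 * k) ≤
      K * (x / Real.log R) := by
    refine le_trans ?_ (hK x R hR hx)
    rw [Finset.mul_sum]
    refine le_trans (Finset.sum_le_sum fun n hn => mul_le_mul_of_nonneg_right ?_ (hM0 n))
      (Finset.sum_le_sum_of_subset_of_nonneg (Finset.filter_subset _ _) fun n _ _ =>
        mul_nonneg (by positivity) (hM0 n))
    have hTn := (Finset.mem_filter.mp hn).2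
    have hb := one_add_mul_sub_le_pow (by linarith : -1 ≤ l) (bigOmega n R)
    nlinarith
  have hle : K * (x / Real.log R) ≤ (K + 1) * (x / Real.log R) :=
    mul_le_mul_of_nonneg_right (by linarith) (by positivity)
  calc _ ≤ (K + 1) * (x / Real.log R) / ((l - 1) * T) := by
        rw [le_div_iff₀ (by positivity)]
        linarith
    _ = _ := by field_simp
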